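/- There exists a constant c ≥ 1 such that for every 2-TVASS V = (Q, Σ, Δ) and all configurations p(x⃗) and q(y⃗) with p(x⃗) →* q(y⃗), there exists a linear path scheme L with |L| ≤ (|Q| + ‖Σ‖)^c and |L|_* ≤ c·|Q|³ such that p(x⃗) →^L q(y⃗). In particular, every 2-TVASS is flattenable. -/

import Mathlib

namespace TVASSpaper

/-- Actions of a `d`-TVASS: `some a` is an addition of the vector `a ∈ ℤ^d`,
    `none` is the zero-test action `tst` (on the first counter). -/
abbrev Act (d : ℕ) := Option (Fin d → ℤ)

/-- Transitions. -/
abbrev Trans (d : ℕ) (Q : Type) := Q × Act d × Q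

/-- Configurations: a state together with a vector of `d` counters. -/
abbrev Config (d : ℕ) (Q : Type) := Q × (Fin d → ℕ)

/-- A `d`-TVASS: a finite set `acts` of actions and a finite set of transitions
    `trans ⊆ Q × acts × Q`. The state set `Q` is a (finite, nonempty) type. -/
structure TVASS (d : ℕ) (Q : Type) where
  acts : Finset (Act d)
  trans : Finset (Trans d Q)
  mem_acts : ∀ t ∈ trans, t.2.1 ∈ acts

variable {d : ℕ} {Q : Type}

/-- The step induced by a single transition: an addition transition `(p, a, q)`
    induces `p(x) → q(x + a)` whenever `x + a ∈ ℕ^d`; a zero-test transition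
    `(p, tst, q)` induces `p(x) → q(x)` whenever the first counter is `0`. -/
def StepBy [NeZero d] (t : Trans d Q) (c c' : Config d Q) : Prop :=
  t.1 = c.1 ∧ t.2.2 = c'.1 ∧
    match t.2.1 with
    | some a => ∀ i, (c'.2 i : ℤ) = (c.2 i : ℤ) + a i
    | none => c.2 0 = 0 ∧ c'.2 = c.2

/-- `Run V c π c'` : there is a run from `c` to `c'` taking the steps of the
    word of transitions `π` in order. -/
inductive Run [NeZero d] (V : TVASS d Q) :
    Config d Q → List (Trans d Q) → Config d Q → Prop
  | nil (c : Config d Q) : Run V c [] c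
  | cons {t : Trans d Q} {c c' c'' : Config d Q} {π : List (Trans d Q)} :
      t ∈ V.trans → StepBy t c c' → Run V c' π c'' → Run V c (t :: π) c''

/-- One step of the TVASS. -/
def Step [NeZero d] (V : TVASS d Q) (c c' : Config d Q) : Prop :=
  ∃ t ∈ V.trans, StepBy t c c'

/-- Reachability `c →* c'`. -/
def Reach [NeZero d] (V : TVASS d Q) (c c' : Config d Q) : Prop :=
  ∃ π, Run V c π c'

/-- `IsPathFrom V p π q` : `π` is a path (word of transitions of `V` with
    matching endpoints) from state `p` to state `q`. -/
inductive IsPathFrom (V : TVASS d Q) : Q → List (Trans d Q) → Q → Prop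
  | nil (p : Q) : IsPathFrom V p [] p
  | cons {t : Trans d Q} {π : List (Trans d Q)} {q : Q} :
      t ∈ V.trans → IsPathFrom V t.2.2 π q → IsPathFrom V t.1 (t :: π) q

/-- `n`-fold concatenation of a word. -/
def pw {α : Type*} (l : List α) (n : ℕ) : List α := (List.replicate n l).flatten

/-- A linear path scheme `α₀ β₁* α₁ ⋯ β_k* α_k`, given by the head path `α₀`
    and the list of pairs `(β₁, α₁), …, (β_k, α_k)`. -/
structure LPS (d : ℕ) (Q : Type) where
  head : List (Trans d Q)
  rest : List (List (Trans d Q) × List (Trans d Q))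

/-- Length `|L|` of a linear path scheme. -/
def LPS.len (L : LPS d Q) : ℕ :=
  L.head.length + (L.rest.map fun p => p.1.length + p.2.length).sum

/-- Number of stars `|L|_*` of a linear path scheme. -/
def LPS.stars (L : LPS d Q) : ℕ := L.rest.length

def wordRest : List (List (Trans d Q) × List (Trans d Q)) → List ℕ → List (Trans d Q)
  | [], _ => []
  | p :: rest, ns => pw p.1 (ns.headD 0) ++ p.2 ++ wordRest rest ns.tail

/-- The word `α₀ β₁^{n₁} α₁ ⋯ β_k^{n_k} α_k` of `L` for exponents `ns`. -/
def LPS.word (L : LPS d Q) (ns : List ℕ) : List (Trans d Q) :=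
  L.head ++ wordRest L.rest ns

/-- Well-formedness of the tail of a linear path scheme starting in state `s`:
    the `βᵢ` are cycles and the `αᵢ` are paths, with matching endpoints. -/
inductive ChainLPS (V : TVASS d Q) :
    Q → List (List (Trans d Q) × List (Trans d Q)) → Q → Prop
  | nil (q : Q) : ChainLPS V q [] q
  | cons {s s' q : Q} {β α : List (Trans d Q)}
      {rest : List (List (Trans d Q) × List (Trans d Q))} :
      IsPathFrom V s β s → IsPathFrom V s α s' → ChainLPS V s' rest q →
      ChainLPS V s ((β, α) :: rest) q

/-- `L` is a genuine linear path scheme from `p` to `q` in `V`. -/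
def IsLPS (V : TVASS d Q) (p : Q) (L : LPS d Q) (q : Q) : Prop :=
  ∃ s, IsPathFrom V p L.head s ∧ ChainLPS V s L.rest q

/-- `c →^L c'` : reachability along the linear path scheme `L`. -/
def ReachLPS [NeZero d] (V : TVASS d Q) (L : LPS d Q) (c c' : Config d Q) : Prop :=
  ∃ ns, Run V c (L.word ns) c'

/-- `‖x⃗‖`: maximum component of a vector of naturals. -/
def vnorm {d : ℕ} (v : Fin d → ℕ) : ℕ := Finset.univ.sup v

/-- Maximum absolute value of a component of an integer vector. -/
def vnormZ {d : ℕ} (v : Fin d → ℤ) : ℕ := Finset.univ.sup fun i => (v i).natAbs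

/-- `‖Σ‖`: maximum absolute value of a component of a vector in `Σ ∖ {tst}`
    (0 if `Σ ⊆ {tst}`). -/
def TVASS.actNorm (V : TVASS d Q) : ℕ :=
  V.acts.sup fun a => a.elim 0 vnormZ

/-- Displacement of a word of transitions (zero-tests contribute `0`). -/
def disp (π : List (Trans d Q)) : Fin d → ℤ :=
  fun i => (π.map fun t => (t.2.1.elim 0 id : Fin d → ℤ) i).sum

/-- `m_π(i)`: max over prefixes `α` of `π` (including the empty prefix) of `-Δ(α)(i)`. -/
def mpre (π : List (Trans d Q)) (i : Fin d) : ℤ :=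
  (π.inits.map fun α => -(disp α i)).foldr max 0

/-- `m_π̄(i)`: max over suffixes `σ` of `π` (including the empty suffix) of `Δ(σ)(i)`. -/
def msuf (π : List (Trans d Q)) (i : Fin d) : ℤ :=
  (π.tails.map fun σ => disp σ i).foldr max 0

/-- `π` contains no zero-test transition. -/
def noTst (π : List (Trans d Q)) : Prop := ∀ t ∈ π, t.2.1 ≠ none

/-- `x⃗ ≥₁ m⃗` : `x⃗(1) = m⃗(1)` and `x⃗(i) ≥ m⃗(i)` for all other `i`. -/
def ge1 [NeZero d] (x : Fin d → ℕ) (m : Fin d → ℤ) : Prop :=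
  (x 0 : ℤ) = m 0 ∧ ∀ i : Fin d, i ≠ 0 → m i ≤ (x i : ℤ)

/-- A path from `p` to `q` is feasible if some run takes it. -/
def Feasible [NeZero d] (V : TVASS d Q) (p : Q) (π : List (Trans d Q)) (q : Q) : Prop :=
  ∃ x y, Run V (p, x) π (q, y)

/-- `c →^{A* ∪ T} c'` : there is a run from `c` to `c'` whose path either
    contains no zero-test transition, or is a single zero-test transition. -/
def ReachAT [NeZero d] (V : TVASS d Q) (c c' : Config d Q) : Prop :=
  ∃ π, Run V c π c' ∧ (noTst π ∨ ∃ t : Trans d Q, π = [t] ∧ t.2.1 = none)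

/-- `p ⇝ q` for a 2-TVASS: `p(0, x) →* q(0, y)` for some `x, y ∈ ℕ`. -/
def Leads (V : TVASS 2 Q) (p q : Q) : Prop :=
  ∃ x y : ℕ, Reach V (p, ![0, x]) (q, ![0, y])

/-- The linear path scheme `L` is bounded from the configuration `c`: the set of
    configurations reachable from `c` along a prefix of a path in `L` is finite. -/
def BoundedLPS [NeZero d] (V : TVASS d Q) (L : LPS d Q) (c : Config d Q) : Prop :=
  {c' : Config d Q | ∃ ns ρ, ρ <+: L.word ns ∧ Run V c ρ c'}.Finite

end TVASSpaper

namespace TVASSpaper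

/-- Functions `ℕ → ℕ` bounded by a power of `x + 2`. -/
@[fun_prop]
def Pol (f : ℕ → ℕ) : Prop := ∃ c : ℕ, ∀ x, f x ≤ (x + 2) ^ c

@[fun_prop]
theorem Pol.id' : Pol (fun x => x) := ⟨1, fun x => by simp⟩

@[fun_prop]
theorem Pol.const (n : ℕ) : Pol (fun _ => n) :=
  ⟨n, fun x => (Nat.lt_two_pow_self).le.trans (Nat.pow_le_pow_left (by omega) n)⟩

@[fun_prop]
theorem Pol.add {f g : ℕ → ℕ} (hf : Pol f) (hg : Pol g) : Pol (fun x => f x + g x) := by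
  obtain ⟨a, ha⟩ := hf
  obtain ⟨b, hb⟩ := hg
  refine ⟨a + b + 1, fun x => ?_⟩
  have h1 : (x + 2) ^ a ≤ (x + 2) ^ (a + b) := Nat.pow_le_pow_right (by omega) (by omega)
  have h2 : (x + 2) ^ b ≤ (x + 2) ^ (a + b) := Nat.pow_le_pow_right (by omega) (by omega)
  have := ha x
  have := hb x
  rw [pow_succ]
  nlinarith

@[fun_prop]
theorem Pol.mul {f g : ℕ → ℕ} (hf : Pol f) (hg : Pol g) : Pol (fun x => f x * g x) := by
  obtain ⟨a, ha⟩ := hf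
  obtain ⟨b, hb⟩ := hg
  exact ⟨a + b, fun x => by rw [pow_add]; exact Nat.mul_le_mul (ha x) (hb x)⟩

@[fun_prop]
theorem Pol.pow {f : ℕ → ℕ} (hf : Pol f) (n : ℕ) : Pol (fun x => f x ^ n) := by
  obtain ⟨a, ha⟩ := hf
  exact ⟨a * n, fun x => by rw [pow_mul]; exact Nat.pow_le_pow_left (ha x) n⟩

@[fun_prop]
theorem Pol.comp {f g : ℕ → ℕ} (hf : Pol f) (hg : Pol g) : Pol (fun x => f (g x)) := by
  obtain ⟨a, ha⟩ := hf
  obtain ⟨b, hb⟩ := hg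
  refine ⟨(b + 2) * a, fun x => (ha _).trans ?_⟩
  rw [pow_mul]
  refine Nat.pow_le_pow_left ?_ a
  have := hb x
  have h2 : 1 ≤ (x + 2) ^ b := Nat.one_le_pow _ _ (by omega)
  have h3 : 4 ≤ (x + 2) ^ 2 := Nat.pow_le_pow_left (show 2 ≤ x + 2 by omega) 2
  rw [pow_add]
  nlinarith

section Chains
variable {X Y : Type}

/-- Chains of length `n` for a relation. -/
def Ch (r : X → X → Prop) (n : ℕ) (x y : X) : Prop :=
  ∃ f : ℕ → X, f 0 = x ∧ f n = y ∧ ∀ i < n, r (f i) (f (i + 1))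

/-- Chains of length at most `L`. -/
def Cle (r : X → X → Prop) (L : ℕ) (x y : X) : Prop := ∃ n ≤ L, Ch r n x y

variable {r : X → X → Prop} {m n L : ℕ} {x y z : X}

theorem Ch.nil (x : X) : Ch r 0 x x := ⟨fun _ => x, rfl, rfl, by simp⟩

theorem Ch.single (h : r x y) : Ch r 1 x y :=
  ⟨fun i => if i = 0 then x else y, by simp, by simp, fun i hi => by
    obtain rfl : i = 0 := by omega
    simpa using h⟩

theorem Ch.seg' {f : ℕ → X} {i j : ℕ} (hf : ∀ k, i ≤ k → k < j → r (f k) (f (k + 1)))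
    (hij : i ≤ j) : Ch r (j - i) (f i) (f j) :=
  ⟨fun k => f (i + k), by simp, by simp [Nat.add_sub_cancel' hij],
    fun k hk => hf _ (by omega) (by omega)⟩

theorem Ch.seg {f : ℕ → X} (hf : ∀ i < n, r (f i) (f (i + 1))) {i j : ℕ} (hij : i ≤ j)
    (hj : j ≤ n) : Ch r (j - i) (f i) (f j) :=
  Ch.seg' (fun k _ hk => hf k (by omega)) hij

theorem Ch.append (h1 : Ch r m x y) (h2 : Ch r n y z) : Ch r (m + n) x z := by
  obtain ⟨f, f0, fm, hf⟩ := h1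
  obtain ⟨g, g0, gn, hg⟩ := h2
  refine ⟨fun i => if i ≤ m then f i else g (i - m), by simpa using f0, ?_, fun i hi => ?_⟩
  · rcases Nat.eq_zero_or_pos n with rfl | hn
    · simp only [Nat.add_zero, le_refl, if_true]
      rw [fm, ← g0, gn]
    · simp only [show ¬ m + n ≤ m by omega, if_false, Nat.add_sub_cancel_left, gn]
  · rcases lt_trichotomy i m with h | h | h
    · simp only [h.le, if_true, show i + 1 ≤ m by omega]
      exact hf i h
    · subst h
      simp only [le_refl, if_true, show ¬ i + 1 ≤ i by omega, if_false, Nat.add_sub_cancel_left]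
      rw [fm, ← g0]
      exact hg 0 (by omega)
    · simp only [show ¬ i ≤ m by omega, if_false, show ¬ i + 1 ≤ m by omega,
        show i + 1 - m = i - m + 1 by omega]
      exact hg _ (by omega)

theorem Ch.cons (h1 : r x y) (h2 : Ch r n y z) : Ch r (n + 1) x z := by
  simpa [Nat.add_comm] using (Ch.single h1).append h2

theorem Ch.zero (h : Ch r 0 x y) : x = y := by
  obtain ⟨f, f0, f1, -⟩ := h
  rw [← f0, f1]

theorem Ch.succ (h : Ch r (n + 1) x z) : ∃ y, r x y ∧ Ch r n y z := by
  obtain ⟨f, f0, f1, hf⟩ := h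
  refine ⟨f 1, f0 ▸ hf 0 (by omega), ?_⟩
  simpa [f1] using Ch.seg hf (i := 1) (j := n + 1) (by omega) le_rfl

theorem Ch.map {r' : Y → Y → Prop} (g : X → Y) (hg : ∀ a b, r a b → r' (g a) (g b))
    (h : Ch r n x y) : Ch r' n (g x) (g y) := by
  obtain ⟨f, f0, f1, hf⟩ := h
  exact ⟨fun i => g (f i), by simp [f0], by simp [f1], fun i hi => hg _ _ (hf i hi)⟩

theorem Ch.mono {r' : X → X → Prop} (hg : ∀ a b, r a b → r' a b) (h : Ch r n x y) :
    Ch r' n x y := h.map id hg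

theorem Ch.rev {r' : X → X → Prop} (hg : ∀ a b, r a b → r' b a) (h : Ch r n x y) :
    Ch r' n y x := by
  obtain ⟨f, f0, f1, hf⟩ := h
  refine ⟨fun i => f (n - i), by simp [f1], by simp [f0], fun i hi => ?_⟩
  have := hg _ _ (hf (n - (i + 1)) (by omega))
  rwa [show n - (i + 1) + 1 = n - i by omega] at this

/-- Lifting of chains along a simulation. -/
theorem Ch.lift {r' : Y → Y → Prop} {P : X → Y → Prop}
    (hs : ∀ a b a', r a b → P a a' → ∃ b', r' a' b' ∧ P b b')
    (h : Ch r n x y) {x' : Y} (hx : P x x') : ∃ y', Ch r' n x' y' ∧ P y y' := by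
  induction n generalizing x x' with
  | zero => exact ⟨x', Ch.nil _, h.zero ▸ hx⟩
  | succ n ih =>
    obtain ⟨z, hz, hzy⟩ := h.succ
    obtain ⟨z', hz', hP⟩ := hs _ _ _ hz hx
    obtain ⟨y', hy', hP'⟩ := ih hzy hP
    exact ⟨y', Ch.cons hz' hy', hP'⟩

theorem Ch.inv {P : X → Prop} (hs : ∀ a b, r a b → P a → P b) (h : Ch r n x y) (hx : P x) :
    P y := by
  induction n generalizing x with
  | zero => exact h.zero ▸ hx
  | succ n ih =>
    obtain ⟨z, hz, hzy⟩ := h.succ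
    exact ih hzy (hs _ _ hz hx)

theorem Ch.minimal (h : Ch r n x y) : ∃ k ≤ n, Ch r k x y ∧ ∀ l, Ch r l x y → k ≤ l := by
  classical
  have hex : ∃ k, Ch r k x y := ⟨n, h⟩
  exact ⟨Nat.find hex, Nat.find_min' hex h, Nat.find_spec hex, fun l hl => Nat.find_min' hex hl⟩

theorem Cle.mono {L' : ℕ} (h : Cle r L x y) (hL : L ≤ L') : Cle r L' x y :=
  let ⟨n, hn, h⟩ := h; ⟨n, hn.trans hL, h⟩

theorem Cle.append {L' : ℕ} (h : Cle r L x y) (h' : Cle r L' y z) : Cle r (L + L') x z :=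
  let ⟨n, hn, h⟩ := h; let ⟨n', hn', h'⟩ := h'; ⟨n + n', by omega, h.append h'⟩

theorem Cle.map {r' : Y → Y → Prop} (g : X → Y) (hg : ∀ a b, r a b → r' (g a) (g b))
    (h : Cle r L x y) : Cle r' L (g x) (g y) :=
  let ⟨n, hn, h⟩ := h; ⟨n, hn, h.map g hg⟩

theorem Cle.rev {r' : X → X → Prop} (hg : ∀ a b, r a b → r' b a) (h : Cle r L x y) :
    Cle r' L y x := let ⟨n, hn, h⟩ := h; ⟨n, hn, h.rev hg⟩

theorem Ch.cle (h : Ch r n x y) : Cle r n x y := ⟨n, le_rfl, h⟩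

/-- If all targets of steps lie in a finite set, then chains can be shortened to its
cardinality. -/
theorem Ch.short (s : Finset X) (hs : ∀ a b, r a b → b ∈ s) (h : Ch r n x y) :
    Cle r s.card x y := by
  obtain ⟨k, -, ⟨f, f0, f1, hf⟩, hmin⟩ := h.minimal
  refine ⟨k, ?_, ⟨f, f0, f1, hf⟩⟩
  by_contra! hlt
  obtain ⟨i, hi, j, hj, hij, hfij⟩ := Finset.exists_ne_map_eq_of_card_lt_of_maps_to
    (s := Finset.range k) (t := s) (f := fun i => f (i + 1)) (by simpa using hlt)
    (fun i hi => hs _ _ (hf i (by simpa using hi)))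
  simp only [Finset.mem_range] at hi hj
  wlog hlt : i < j generalizing i j
  · exact this j i hij.symm hfij.symm hj hi (by omega)
  have h1 := Ch.seg hf (i := 0) (j := i + 1) (by omega) (by omega)
  have h2 := Ch.seg hf (i := j + 1) (j := k) (by omega) le_rfl
  rw [show f (j + 1) = f (i + 1) from hfij.symm] at h2
  have := hmin _ (f1 ▸ f0 ▸ h1.append h2)
  omega

/-- If each step is realised by a chain of length at most `L`, flatten. -/
theorem Ch.flatten {r' : X → X → Prop} (hs : ∀ a b, r a b → Cle r' L a b) (h : Ch r n x y) :
    Cle r' (n * L) x y := by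
  induction n generalizing x with
  | zero => exact ⟨0, by simp, h.zero ▸ Ch.nil _⟩
  | succ n ih =>
    obtain ⟨z, hz, hzy⟩ := h.succ
    exact ((hs _ _ hz).append (ih hzy)).mono (by rw [add_mul]; omega)

end Chains

/-- Pigeonhole for a function on an initial segment, returning ordered indices. -/
theorem pigeon {α : Type} (s : Finset α) (f : ℕ → α) (n : ℕ) (hf : ∀ i < n, f i ∈ s)
    (hn : s.card < n) : ∃ i j, i < j ∧ j < n ∧ f i = f j := by
  obtain ⟨i, hi, j, hj, hij, h⟩ := Finset.exists_ne_map_eq_of_card_lt_of_maps_to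
    (s := Finset.range n) (t := s) (f := f) (by simpa using hn)
    (fun i hi => hf i (by simpa using hi))
  simp only [Finset.mem_range] at hi hj
  rcases lt_or_gt_of_ne hij with h' | h'
  · exact ⟨i, j, h', hj, h⟩
  · exact ⟨j, i, h', hi, h.symm⟩

theorem levels_left (h : ℕ → ℤ) {T : ℕ} {M N : ℤ} (h0 : h 0 ≤ M)
    (hs : ∀ i < T, |h (i + 1) - h i| ≤ N) :
    ∃ τ : ℤ → ℕ, (∀ l, M < l → l ≤ h T → τ l ≤ T ∧ l ≤ h (τ l) ∧ h (τ l) ≤ l + N ∧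
      ∀ i, τ l ≤ i → i ≤ T → l ≤ h i) ∧
      ∀ l l', l ≤ l' → l' ≤ h T → τ l ≤ τ l' := by
  classical
  have hne : ∀ l, l ≤ h T → {t | ∀ i, t ≤ i → i ≤ T → l ≤ h i}.Nonempty := fun l hl =>
    ⟨T, fun i h1 h2 => by rwa [le_antisymm h2 h1]⟩
  refine ⟨fun l => sInf {t | ∀ i, t ≤ i → i ≤ T → l ≤ h i}, fun l hM hl => ?_, fun l l' hll hl => ?_⟩
  · have hmem := Nat.sInf_mem (hne l hl)
    have hle : sInf {t | ∀ i, t ≤ i → i ≤ T → l ≤ h i} ≤ T :=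
      Nat.sInf_le (fun i h1 h2 => by rwa [le_antisymm h2 h1])
    have hnot : ∀ t, t < sInf {t | ∀ i, t ≤ i → i ≤ T → l ≤ h i} →
      t ∉ {t | ∀ i, t ≤ i → i ≤ T → l ≤ h i} := fun t ht => Nat.notMem_of_lt_sInf ht
    beta_reduce
    generalize sInf {t | ∀ i, t ≤ i → i ≤ T → l ≤ h i} = t at *
    have ht := hmem t le_rfl hle
    refine ⟨hle, ht, ?_, hmem⟩
    rcases t with _ | t
    · omega
    · have h1 := hnot t (by omega)
      have h2 : h t < l := by
        by_contra! h3
        refine h1 (fun i hi hiT => ?_)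
        rcases hi.eq_or_lt with rfl | hi
        · exact h3
        · exact hmem i hi hiT
      have := abs_le.1 (hs t (by omega))
      omega
  · exact Nat.sInf_le (fun i h1 h2 => hll.trans (Nat.sInf_mem (hne l' hl) i h1 h2))

theorem levels (h : ℕ → ℤ) {T n : ℕ} {M N : ℤ} (hT : T ≤ n) (h0 : h 0 ≤ M) (hn : h n ≤ M)
    (hs : ∀ i < n, |h (i + 1) - h i| ≤ N) :
    ∃ τ σ : ℤ → ℕ, (∀ l, M < l → l ≤ h T → τ l ≤ T ∧ T ≤ σ l ∧ σ l ≤ n ∧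
      l ≤ h (τ l) ∧ h (τ l) ≤ l + N ∧ l ≤ h (σ l) ∧ h (σ l) ≤ l + N ∧
      ∀ i, τ l ≤ i → i ≤ σ l → l ≤ h i) ∧
      ∀ l l', l ≤ l' → l' ≤ h T → τ l ≤ τ l' ∧ σ l' ≤ σ l := by
  obtain ⟨τ, h1, h2⟩ := levels_left h (T := T) h0 (fun i hi => hs i (by omega))
  obtain ⟨σ, h3, h4⟩ := levels_left (fun i => h (n - i)) (T := n - T) (M := M) (N := N) hn
    (fun i hi => by
      have := hs (n - (i + 1)) (by omega)
      rw [show n - (i + 1) + 1 = n - i by omega] at this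
      rwa [abs_sub_comm])
  simp only [Nat.sub_sub_self hT] at h3 h4
  refine ⟨τ, fun l => n - σ l, fun l hM hl => ?_, fun l l' hll hl => ⟨h2 l l' hll hl, ?_⟩⟩
  · beta_reduce
    obtain ⟨a1, a2, a3, a4⟩ := h1 l hM hl
    obtain ⟨b1, b2, b3, b4⟩ := h3 l hM hl
    refine ⟨a1, by omega, by omega, a2, a3, b2, b3, fun i hi1 hi2 => ?_⟩
    rcases le_total i T with h | h
    · exact a4 i hi1 h
    · have := b4 (n - i) (by omega) (by omega)
      rwa [Nat.sub_sub_self (by omega)] at this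
  · have := h4 l l' hll hl
    simp only
    omega

/-- Data attached to two levels `l < l'` of equal type in a sequence of heights. -/
structure LevelPair {α : Type} (h : ℕ → ℤ) (g : ℕ → α) (n : ℕ) (N l l' : ℤ)
    (t₁ t₂ t₃ t₄ : ℕ) : Prop where
  lt : l < l'
  h12 : t₁ < t₂
  h23 : t₂ ≤ t₃
  h34 : t₃ < t₄
  h4 : t₄ ≤ n
  e12 : h t₂ = h t₁ + (l' - l)
  e34 : h t₃ = h t₄ + (l' - l)
  g12 : g t₁ = g t₂
  g34 : g t₃ = g t₄
  ge : ∀ i, t₁ ≤ i → i ≤ t₄ → l ≤ h i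
  ge' : ∀ i, t₂ ≤ i → i ≤ t₃ → l' ≤ h i
  le1 : h t₁ ≤ l + N
  le4 : h t₄ ≤ l + N

theorem levels_fiber {α : Type} (h : ℕ → ℤ) {T n : ℕ} {M : ℤ} {N : ℕ} (hT : T ≤ n)
    (h0 : h 0 ≤ M) (hn : h n ≤ M) (hs : ∀ i < n, |h (i + 1) - h i| ≤ N)
    (g : ℕ → α) (s : Finset α) (hg : ∀ i ≤ n, g i ∈ s) {A B : ℤ} (hA : M ≤ A) (hB : B ≤ h T)
    {K : ℕ} (hK : A + (((s.card * (N + 1)) ^ 2 * K : ℕ) : ℤ) < B) :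
    ∃ (τ σ : ℤ → ℕ) (Lv : Finset ℤ), K < Lv.card ∧ Lv ⊆ Finset.Ioc A B ∧
      (∀ l ∈ Lv, τ l ≤ T ∧ T ≤ σ l ∧ σ l ≤ n) ∧
      ∀ l ∈ Lv, ∀ l' ∈ Lv, l < l' →
        LevelPair h g n N l l' (τ l) (τ l') (σ l') (σ l) := by
  classical
  obtain ⟨τ, σ, h1, h2⟩ := levels h hT h0 hn hs
  let ty : ℤ → (α × ℤ) × (α × ℤ) := fun l => ((g (τ l), h (τ l) - l), (g (σ l), h (σ l) - l))
  let t : Finset ((α × ℤ) × (α × ℤ)) :=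
    (s ×ˢ Finset.Icc (0 : ℤ) N) ×ˢ (s ×ˢ Finset.Icc (0 : ℤ) N)
  have hcard : t.card = (s.card * (N + 1)) ^ 2 := by
    simp [t, Finset.card_product, sq]
  obtain ⟨y, -, hy⟩ := Finset.exists_lt_card_fiber_of_mul_lt_card_of_maps_to
    (s := Finset.Ioc A B) (t := t) (f := ty) (n := K) (fun l hl => by
      rw [Finset.mem_Ioc] at hl
      obtain ⟨a1, a2, a3, a4, a5, a6, a7, a8⟩ := h1 l (by omega) (by omega)
      simp only [t, ty, Finset.mem_product, Finset.mem_Icc]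
      exact ⟨⟨hg _ (by omega), by omega, by omega⟩, ⟨hg _ (by omega), by omega, by omega⟩⟩)
    (by rw [hcard, Int.card_Ioc]; omega)
  refine ⟨τ, σ, _, hy, Finset.filter_subset _ _, fun l hl => ?_, fun l hl l' hl' hlt => ?_⟩
  · rw [Finset.mem_filter, Finset.mem_Ioc] at hl
    obtain ⟨a1, a2, a3, -⟩ := h1 l (by omega) (by omega)
    exact ⟨a1, a2, a3⟩
  · rw [Finset.mem_filter, Finset.mem_Ioc] at hl hl'
    have hty : ty l = ty l' := hl.2.trans hl'.2.symm
    simp only [ty, Prod.mk.injEq] at hty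
    obtain ⟨⟨q1, q2⟩, q3, q4⟩ := hty
    obtain ⟨a1, a2, a3, a4, a5, a6, a7, a8⟩ := h1 l (by omega) (by omega)
    obtain ⟨b1, b2, b3, b4, b5, b6, b7, b8⟩ := h1 l' (by omega) (by omega)
    obtain ⟨c1, c2⟩ := h2 l l' hlt.le (by omega)
    refine ⟨hlt, lt_of_le_of_ne c1 ?_, by omega, lt_of_le_of_ne c2 ?_, a3, by omega, by omega,
      q1, q3.symm, a8, b8, a5, a7⟩
    · intro h
      rw [h] at q2
      omega
    · intro h
      rw [h] at q4
      omega

section OneCounter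
variable {T : Type}

/-- Steps of a one-counter system with heights confined to `I` and zero tests `Z`. -/
def OC (E : T → ℤ → T → Prop) (Z : T → T → Prop) (I : Set ℤ) (c c' : T × ℤ) : Prop :=
  (E c.1 (c'.2 - c.2) c'.1 ∨ (Z c.1 c'.1 ∧ c.2 = 0 ∧ c'.2 = 0)) ∧ c.2 ∈ I ∧ c'.2 ∈ I

/-- The absence of zero tests. -/
def noZ : T → T → Prop := fun _ _ => False

variable {E : T → ℤ → T → Prop} {Z : T → T → Prop} {I : Set ℤ} {N : ℕ}

theorem OC.step_le (hE : ∀ p a q, E p a q → |a| ≤ N) {c c' : T × ℤ} (h : OC E Z I c c') :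
    |c'.2 - c.2| ≤ N := by
  rcases h.1 with h | ⟨-, h1, h2⟩
  · exact hE _ _ _ h
  · simp [h1, h2]

theorem OC.shift [hI : I.OrdConnected] {c c' : T × ℤ} (h : OC E Z I c c') {k l u : ℤ}
    (hl : l ∈ I) (hu : u ∈ I) (h1 : l ≤ c.2 + k) (h2 : l ≤ c'.2 + k) (h3 : c.2 + k ≤ u)
    (h4 : c'.2 + k ≤ u) (hz : c.2 ≠ 0) : OC E Z I (c.1, c.2 + k) (c'.1, c'.2 + k) := by
  refine ⟨Or.inl ?_, hI.out hl hu ⟨h1, h3⟩, hI.out hl hu ⟨h2, h4⟩⟩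
  rcases h.1 with h | ⟨-, h1, h2⟩
  · simpa using h
  · exact absurd h1 hz

/-- In a chain of minimal length the heights do not exceed those of the endpoints by much. -/
theorem OC.peak [Fintype T] [hI : I.OrdConnected] (hE : ∀ p a q, E p a q → |a| ≤ N)
    {f : ℕ → T × ℤ} {n : ℕ} {M : ℤ}
    (hf : ∀ i < n, OC E Z I (f i) (f (i + 1)))
    (hmin : ∀ k, Ch (OC E Z I) k (f 0) (f n) → n ≤ k) (h0 : (f 0).2 ≤ M) (hn : (f n).2 ≤ M)
    (hZ : Z = noZ ∨ 0 ≤ M) {t : ℕ} (ht : t ≤ n) :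
    (f t).2 ≤ M + ((Fintype.card T * (N + 1)) ^ 2 * 1 : ℕ) := by
  by_contra! hlt
  obtain ⟨τ, σ, Lv, hK, hsub, -, hp⟩ := levels_fiber (fun i => (f i).2) (T := t) (N := N) ht h0 hn
    (fun i hi => (hf i hi).step_le hE) (fun i => (f i).1) Finset.univ (by simp) le_rfl le_rfl hlt
  obtain ⟨l, hl, l', hl', hne⟩ := Finset.one_lt_card.1 hK
  wlog hll : l < l' generalizing l l'
  · exact this l' hl' l hl hne.symm (by omega)
  have hpair := hp l hl l' hl' hll
  have hl0 := Finset.mem_Ioc.1 (hsub hl)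
  generalize τ l = t₁ at hpair
  generalize τ l' = t₂ at hpair
  generalize σ l' = t₃ at hpair
  generalize σ l = t₄ at hpair
  obtain ⟨-, h12, h23, h34, h4, e12, e34, g12, g34, ge, ge', -, -⟩ := hpair
  have c1 := Ch.seg hf (i := 0) (j := t₁) (by omega) (by omega)
  have c2 : Ch (OC E Z I) (t₃ - t₂) ((f t₂).1, (f t₂).2 + (l - l'))
      ((f t₃).1, (f t₃).2 + (l - l')) := by
    refine Ch.seg' (f := fun i => ((f i).1, (f i).2 + (l - l'))) (fun k hk1 hk2 => ?_) h23
    have hk := hf k (by omega)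
    have b1 := ge' k hk1 hk2.le
    have b2 := ge' (k + 1) (by omega) hk2
    have hmax : max (f k).2 (f (k + 1)).2 ∈ I := by
      rcases max_choice (f k).2 (f (k + 1)).2 with h | h <;> rw [h]
      exacts [hk.2.1, hk.2.2]
    have h0I : (f 0).2 ∈ I := (hf 0 (by omega)).2.1
    have m1 := le_max_left (f k).2 (f (k + 1)).2
    have m2 := le_max_right (f k).2 (f (k + 1)).2
    rcases hZ with rfl | hZ
    · refine ⟨Or.inl ?_, hI.out h0I hmax ⟨by omega, by omega⟩,
        hI.out h0I hmax ⟨by omega, by omega⟩⟩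
      rcases hk.1 with h | ⟨h, -⟩
      · simpa using h
      · exact h.elim
    · exact hk.shift h0I hmax (by omega) (by omega) (by omega) (by omega) (by omega)
  have c3 := Ch.seg hf (i := t₄) (j := n) (by omega) le_rfl
  have q1 : ((f t₂).1, (f t₂).2 + (l - l')) = f t₁ := by
    ext1
    · exact g12.symm
    · simp only; omega
  have q2 : ((f t₃).1, (f t₃).2 + (l - l')) = f t₄ := by
    ext1
    · exact g34
    · simp only; omega
  rw [q1, q2] at c2
  have := hmin _ ((c1.append c2).append c3)
  omega

theorem OC.neg {c c' : T × ℤ} (h : OC E Z I c c') :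
    OC (fun p a q => E p (-a) q) Z (Neg.neg ⁻¹' I) (c.1, -c.2) (c'.1, -c'.2) := by
  refine ⟨?_, by simpa using h.2.1, by simpa using h.2.2⟩
  rcases h.1 with h | ⟨h1, h2, h3⟩
  · left
    simp only
    rwa [show -(-c'.2 - -c.2) = c'.2 - c.2 by ring]
  · exact Or.inr ⟨h1, by simp [h2], by simp [h3]⟩

theorem Ch.in_box [Fintype T] {r : T × ℤ → T × ℤ → Prop} {f : ℕ → T × ℤ} {n : ℕ}
    (hf : ∀ i < n, r (f i) (f (i + 1))) {a : ℤ} {k : ℕ}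
    (hb : ∀ i ≤ n, a ≤ (f i).2 ∧ (f i).2 ≤ a + k) :
    Cle r (Fintype.card T * (k + 1)) (f 0) (f n) := by
  classical
  have h1 := Ch.short (r := fun c c' => r c c' ∧ a ≤ c'.2 ∧ c'.2 ≤ a + k)
    (Finset.univ ×ˢ Finset.Icc a (a + k)) (fun c c' h => by simp [h.2.1, h.2.2])
    (Ch.seg' (f := f) (i := 0) (j := n) (fun i _ hi => ⟨hf i hi, hb _ hi⟩) (by omega))
  rw [Finset.card_product, Int.card_Icc, Finset.card_univ] at h1
  obtain ⟨m, hm, hc⟩ := h1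
  refine ⟨m, hm.trans (le_of_eq ?_), hc.mono fun _ _ h => h.1⟩
  congr 1
  omega

/-- Chains between low nonnegative configurations, with zero tests. -/
theorem OC.low : ∃ F, Pol F ∧ ∀ (T : Type) [Fintype T] (E : T → ℤ → T → Prop)
    (Z : T → T → Prop) (x n : ℕ) (c c' : T × ℤ), Fintype.card T ≤ x →
    (∀ p a q, E p a q → |a| ≤ x) → c.2 ≤ x → c'.2 ≤ x → Ch (OC E Z (Set.Ici 0)) n c c' →
    Cle (OC E Z (Set.Ici 0)) (F x) c c' := by
  refine ⟨fun x => x * (x + (x * (x + 1)) ^ 2 * 1 + 1), by fun_prop,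
    fun T _ E Z x n c c' hT hE hc hc' h => ?_⟩
  obtain ⟨k, -, ⟨f, rfl, rfl, hf⟩, hmin⟩ := h.minimal
  rcases Nat.eq_zero_or_pos k with rfl | hk
  · exact ⟨0, by omega, Ch.nil _⟩
  have hp := fun t (ht : t ≤ k) => OC.peak hE hf hmin hc hc' (Or.inr (by omega)) ht
  refine (Ch.in_box hf (a := 0) (k := x + (x * (x + 1)) ^ 2 * 1) fun i hi => ⟨?_, ?_⟩).mono ?_
  · rcases hi.lt_or_eq with hi | rfl
    · exact (hf i hi).2.1
    · have := (hf (i - 1) (by omega)).2.2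
      rwa [Nat.sub_add_cancel hk] at this
  · refine (hp i hi).trans ?_
    have : (Fintype.card T * (x + 1)) ^ 2 * 1 ≤ (x * (x + 1)) ^ 2 * 1 := by gcongr
    push_cast at this ⊢
    zify at this
    linarith
  · exact Nat.mul_le_mul_right _ hT

/-- Chains between configurations at similar heights, without zero tests. -/
theorem OC.near : ∃ F, Pol F ∧ ∀ (T : Type) [Fintype T] (E : T → ℤ → T → Prop)
    (I : Set ℤ) [I.OrdConnected]
    (x n : ℕ) (c c' : T × ℤ), Fintype.card T ≤ x →
    (∀ p a q, E p a q → |a| ≤ x) → |c.2 - c'.2| ≤ x → Ch (OC E noZ I) n c c' →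
    Cle (OC E noZ I) (F x) c c' := by
  refine ⟨fun x => x * ((x + 2 * (x * (x + 1)) ^ 2) + 1), by fun_prop,
    fun T _ E I hI x n c c' hT hE hcc h => ?_⟩
  obtain ⟨k, -, ⟨f, rfl, rfl, hf⟩, hmin⟩ := h.minimal
  have hp := fun t (ht : t ≤ k) => OC.peak hE hf hmin (le_max_left _ _) (le_max_right _ _)
    (Or.inl rfl) ht
  have : (Neg.neg ⁻¹' I).OrdConnected := ⟨fun a ha b hb t ht => hI.out hb ha
    ⟨neg_le_neg ht.2, neg_le_neg ht.1⟩⟩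
  have hp' := fun t (ht : t ≤ k) => OC.peak (E := fun p a q => E p (-a) q) (N := x)
    (I := Neg.neg ⁻¹' I) (f := fun i => ((f i).1, -(f i).2))
    (fun p a q h => by rw [← abs_neg]; exact hE _ _ _ h) (fun i hi => (hf i hi).neg)
    (fun m hm => hmin m (by
      have := hm.map (r' := OC E noZ I) (fun c => (c.1, -c.2)) (fun a b h => by
        have := h.neg
        simpa using this)
      simpa using this)) (le_max_left _ _) (le_max_right _ _)
    (Or.inl rfl) ht
  have hle : (((Fintype.card T * (x + 1)) ^ 2 * 1 : ℕ) : ℤ) ≤ (((x * (x + 1)) ^ 2 : ℕ) : ℤ) := by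
    rw [mul_one]
    exact_mod_cast Nat.pow_le_pow_left (Nat.mul_le_mul_right _ hT) 2
  rw [abs_le] at hcc
  refine (Ch.in_box hf (a := min (f 0).2 (f k).2 - (((x * (x + 1)) ^ 2 : ℕ) : ℤ))
    (k := x + 2 * (x * (x + 1)) ^ 2) fun i hi => ?_).mono ?_
  · have h1 := hp i hi
    have h2 := hp' i hi
    simp only at h2
    generalize (((Fintype.card T * (x + 1)) ^ 2 * 1 : ℕ) : ℤ) = y at *
    rw [Nat.cast_add, Nat.cast_mul]
    generalize (((x * (x + 1)) ^ 2 : ℕ) : ℤ) = z at *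
    push_cast
    omega
  · exact Nat.mul_le_mul_right _ hT

end OneCounter

section OneCounter

/-- Forgetting all but the residue of the effect, paths can be shortened. -/
theorem OC.residue {T : Type} [Fintype T] {E : T → ℤ → T → Prop} {n : ℕ} {c c' : T × ℤ}
    (h : Ch (OC E noZ Set.univ) n c c') (g : ℕ) (hg : 0 < g) :
    ∃ b : ℤ, Cle (OC E noZ Set.univ) (Fintype.card T * g) c (c'.1, b) ∧ (g : ℤ) ∣ b - c'.2 := by
  classical
  have : NeZero g := ⟨hg.ne'⟩
  let r : T × ZMod g → T × ZMod g → Prop := fun a b => ∃ z : ℤ, E a.1 z b.1 ∧ b.2 = a.2 + z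
  have h1 : Ch r n (c.1, (c.2 : ZMod g)) (c'.1, (c'.2 : ZMod g)) :=
    h.map (fun c => (c.1, (c.2 : ZMod g))) (fun a b hab => by
      rcases hab.1 with hE | ⟨hE, -⟩
      · exact ⟨_, hE, by push_cast; ring⟩
      · exact hE.elim)
  obtain ⟨m, hm, h2⟩ := h1.short Finset.univ (by simp)
  obtain ⟨y, hy, hP⟩ := h2.lift (r' := OC E noZ Set.univ) (x' := c)
    (P := fun a b => a.1 = b.1 ∧ a.2 = (b.2 : ZMod g)) (by
      rintro a b a' ⟨z, hz, hz'⟩ ⟨hP1, hP2⟩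
      exact ⟨(b.1, a'.2 + z), ⟨Or.inl (by simpa [← hP1] using hz), trivial, trivial⟩, rfl,
        by rw [hz', hP2]; push_cast; rfl⟩) ⟨rfl, rfl⟩
  refine ⟨y.2, ⟨m, hm.trans (by simp [ZMod.card]), ?_⟩, ?_⟩
  · convert hy using 1
    exact Prod.ext hP.1 rfl
  · rw [← ZMod.intCast_zmod_eq_zero_iff_dvd, Int.cast_sub, ← hP.2]
    simp

theorem Ch.oc_bound {T : Type} {E : T → ℤ → T → Prop} {Z : T → T → Prop} {I : Set ℤ} {N : ℕ}
    (hE : ∀ p a q, E p a q → |a| ≤ N) {n : ℕ} {c c' : T × ℤ} (h : Ch (OC E Z I) n c c') :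
    |c'.2 - c.2| ≤ N * n := by
  induction n generalizing c with
  | zero => simp [h.zero]
  | succ n ih =>
    obtain ⟨d, hd, h'⟩ := h.succ
    have h1 := hd.step_le hE
    have h2 := ih h'
    rw [abs_le] at *
    push_cast
    constructor <;> linarith [h1.1, h2.1, h1.2, h2.2]

theorem Ch.oc_shift {T : Type} {E : T → ℤ → T → Prop} {N : ℕ} {I : Set ℤ}
    (hE : ∀ p a q, E p a q → |a| ≤ N) {n : ℕ} {c c' : T × ℤ} (h : Ch (OC E noZ I) n c c')
    (k : ℤ) (hk : N * n ≤ c.2 + k) :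
    Ch (OC E noZ (Set.Ici 0)) n (c.1, c.2 + k) (c'.1, c'.2 + k) := by
  obtain ⟨f, rfl, rfl, hf⟩ := h
  have hb : ∀ i ≤ n, 0 ≤ (f i).2 + k := fun i hi => by
    have := Ch.oc_bound hE (Ch.seg hf (Nat.zero_le i) hi)
    have h2 : (N : ℤ) * ((i - 0 : ℕ) : ℤ) ≤ N * n := by gcongr; omega
    rw [abs_le] at this
    linarith [this.1]
  refine ⟨fun i => ((f i).1, (f i).2 + k), rfl, rfl, fun i hi => ⟨Or.inl ?_, ?_, ?_⟩⟩
  · rcases (hf i hi).1 with h | ⟨h, -⟩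
    · simpa using h
    · exact h.elim
  · exact hb i hi.le
  · exact hb (i + 1) hi

/-- Ascending chains without zero tests are realised with at most one iterated cycle. -/
theorem OC.climb : ∃ F, Pol F ∧ ∀ (T : Type) [Fintype T] (E : T → ℤ → T → Prop)
    (x n : ℕ) (c c' : T × ℤ), Fintype.card T ≤ x →
    (∀ p a q, E p a q → |a| ≤ x) → c.2 ≤ c'.2 → Ch (OC E noZ (Set.Ici 0)) n c c' →
    Cle (OC E noZ (Set.Ici 0)) (F x) c c' ∨ ∃ (s : T) (h δ : ℤ) (m : ℕ), 0 < δ ∧ 0 ≤ h ∧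
      Cle (OC E noZ (Set.Ici 0)) (F x) c (s, h) ∧
      Cle (OC E noZ (Set.Ici 0)) (F x) (s, h) (s, h + δ) ∧
      Cle (OC E noZ (Set.Ici 0)) (F x) (s, h + m * δ) c' := by
  obtain ⟨F, hF, h1⟩ := OC.near
  let K : ℕ → ℕ := fun x => x * (x + 1)
  let B : ℕ → ℕ := fun x => K x + 2 + x + 2 * (x * (x * (K x + 1)))
  have hB : Pol B := by simp only [B, K]; fun_prop
  refine ⟨fun x => F (x + B x) + x * (K x + 1), by simp only [K]; fun_prop,
    fun T _ E x n c c' hT hE hle h => ?_⟩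
  beta_reduce
  by_cases hfar : |c.2 - c'.2| ≤ (x + B x : ℕ)
  · exact Or.inl ((h1 T E _ _ n c c' (hT.trans (by omega))
      (fun p a q h => (hE p a q h).trans (by push_cast; omega)) hfar h).mono (by omega))
  right
  have hfar' : (B x : ℤ) < c'.2 - c.2 := by
    rw [abs_sub_comm, abs_of_nonneg (by omega)] at hfar
    push_cast at hfar
    omega
  obtain ⟨f, rfl, rfl, hf⟩ := h
  have hn : 0 < n := by
    rcases Nat.eq_zero_or_pos n with rfl | h
    · simp at hfar'; omega
    · exact h
  obtain ⟨τ, h2, h3⟩ := levels_left (fun i => (f i).2) (T := n) (N := x) le_rfl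
    (fun i hi => (hf i hi).step_le hE)
  have hBx : B x = K x + 2 + x + 2 * (x * (x * (K x + 1))) := rfl
  have hlev : ∀ i < K x + 1, (f 0).2 < (f 0).2 + 1 + i ∧ (f 0).2 + 1 + i ≤ (f n).2 :=
    fun i hi => ⟨by omega, by
      have : 0 ≤ 2 * (x * (x * (K x + 1))) := Nat.zero_le _
      omega⟩
  obtain ⟨i, j, hij, hj, heq⟩ := pigeon (Finset.univ ×ˢ Finset.Icc (0 : ℤ) x)
    (fun i => ((f (τ ((f 0).2 + 1 + i))).1, (f (τ ((f 0).2 + 1 + i))).2 - ((f 0).2 + 1 + i)))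
    (K x + 1) (fun i hi => by
      obtain ⟨-, h4, h5, -⟩ := h2 _ (hlev i hi).1 (hlev i hi).2
      simp only [Finset.mem_product, Finset.mem_univ, true_and, Finset.mem_Icc]
      constructor <;> linarith) (by
      rw [Finset.card_product, Int.card_Icc, Finset.card_univ]
      have : Fintype.card T * (x + 1) ≤ x * (x + 1) := Nat.mul_le_mul_right _ hT
      have h' : ((x : ℤ) + 1 - 0).toNat = x + 1 := by omega
      rw [h']
      simp only [K]
      omega)
  simp only [Prod.mk.injEq] at heq
  obtain ⟨e1, e2⟩ := heq
  obtain ⟨a1, a2, a3, a4⟩ := h2 _ (hlev i (by omega)).1 (hlev i (by omega)).2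
  obtain ⟨b1, b2, b3, b4⟩ := h2 _ (hlev j hj).1 (hlev j hj).2
  have hτ := h3 ((f 0).2 + 1 + i) ((f 0).2 + 1 + j) (by omega) (hlev j hj).2
  generalize τ ((f 0).2 + 1 + i) = t at *
  generalize τ ((f 0).2 + 1 + j) = u at *
  have h0 : 0 ≤ (f 0).2 := (hf 0 hn).2.1
  set δ : ℕ := j - i with hδ
  have hδK : δ ≤ K x + 1 := by omega
  obtain ⟨b, ⟨m, hm, hc⟩, hdvd⟩ := OC.residue (c := f t) (c' := f n)
    ((Ch.seg hf a1 le_rfl).mono (fun a b h => ⟨h.1, trivial, trivial⟩)) δ (by omega)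
  have hmb : m ≤ x * (K x + 1) := hm.trans (Nat.mul_le_mul hT hδK)
  have hb := Ch.oc_bound hE hc
  have hxm : x * m ≤ x * (x * (K x + 1)) := Nat.mul_le_mul_left _ hmb
  have hxm' : ((x * m : ℕ) : ℤ) ≤ ((x * (x * (K x + 1)) : ℕ) : ℤ) := by exact_mod_cast hxm
  rw [Nat.cast_mul] at hxm'
  have hK0 : (0 : ℤ) ≤ x * m := by positivity
  have hBz : (B x : ℤ) = K x + 2 + x + 2 * ((x * (x * (K x + 1)) : ℕ) : ℤ) := by
    rw [hBx]; push_cast; ring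
  generalize (x : ℤ) * m = y at hxm' hb hK0
  generalize ((x * (x * (K x + 1)) : ℕ) : ℤ) = z at hxm' hBz
  obtain ⟨k, hk⟩ := (dvd_sub_comm.1 hdvd)
  simp only at hk hb
  have hKi : (i : ℤ) ≤ K x := by omega
  have hbb := abs_le.1 hb
  have hk0 : 0 ≤ k := by
    by_contra! hneg
    have : (δ : ℤ) * k ≤ 0 := mul_nonpos_of_nonneg_of_nonpos (by omega) hneg.le
    omega
  obtain ⟨k, rfl⟩ := Int.eq_ofNat_of_zero_le hk0
  refine ⟨(f t).1, (f t).2, δ, k, by omega, by omega, ?_, ?_, ?_⟩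
  · refine (h1 T E (Set.Ici 0) (x + B x) _ _ _ (hT.trans (by omega))
      (fun p a q h => (hE p a q h).trans (by push_cast; omega)) ?_
      (Ch.seg hf (Nat.zero_le t) a1)).mono (by omega)
    rw [abs_le]
    push_cast
    constructor <;> omega
  · have h5 := h1 T E (Set.Ici 0) (x + B x) _ _ _ (hT.trans (by omega))
      (fun p a q h => (hE p a q h).trans (by push_cast; omega)) (by
      rw [abs_le]
      push_cast
      constructor <;> omega)
      (Ch.seg hf hτ b1)
    have h6 : f u = ((f t).1, (f t).2 + δ) := by
      ext1
      · exact e1.symm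
      · simp only; omega
    rw [h6] at h5
    exact h5.mono (by omega)
  · have h5 := hc.oc_shift hE ((k : ℤ) * δ) (by
      rw [mul_comm] at hk
      have : ((x * m : ℕ) : ℤ) ≤ _ := Int.ofNat_le.2 hxm
      push_cast at this hBz ⊢
      rw [hBx] at hfar'
      push_cast at hfar'
      linarith [hbb.1, hbb.2])
    have h6 : (f n) = ((f n).1, b + k * δ) := by
      ext1
      · rfl
      · simp only; rw [mul_comm] at hk; omega
    rw [h6]
    exact ⟨m, by omega, h5⟩

end OneCounter

/-- A two-counter system: `A p a b q` are the additions, `Z p q` the zero tests of the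
first counter. -/
structure Sys (Q : Type) where
  A : Q → ℤ → ℤ → Q → Prop
  Z : Q → Q → Prop

namespace Sys
variable {Q : Type}

/-- The additions change the counters by at most `N`. -/
def Bdd (S : Sys Q) (N : ℕ) : Prop := ∀ p a b q, S.A p a b q → |a| ≤ N ∧ |b| ≤ N

/-- The system without its zero tests. -/
def nt (S : Sys Q) : Sys Q := ⟨S.A, noZ⟩

/-- The reversed system. -/
def rev (S : Sys Q) : Sys Q := ⟨fun p a b q => S.A q (-a) (-b) p, fun p q => S.Z q p⟩

/-- The system with exchanged counters and without zero tests. -/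
def swap (S : Sys Q) : Sys Q := ⟨fun p a b q => S.A p b a q, noZ⟩

/-- Steps between configurations of the region `R`. -/
def St (S : Sys Q) (R : Set (ℤ × ℤ)) (c c' : Q × ℤ × ℤ) : Prop :=
  (S.A c.1 (c'.2.1 - c.2.1) (c'.2.2 - c.2.2) c'.1 ∨
    (S.Z c.1 c'.1 ∧ c.2.1 = 0 ∧ c'.2.1 = 0 ∧ c'.2.2 = c.2.2)) ∧ c.2 ∈ R ∧ c'.2 ∈ R

/-- The nonnegative quadrant. -/
def quad : Set (ℤ × ℤ) := {z | 0 ≤ z.1 ∧ 0 ≤ z.2}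

/-- The right half plane. -/
def half : Set (ℤ × ℤ) := {z | 0 ≤ z.1}

variable {S : Sys Q} {R R' : Set (ℤ × ℤ)} {N : ℕ}

@[simp] theorem nt_nt : S.nt.nt = S.nt := rfl
@[simp] theorem swap_nt : S.swap.nt = S.swap := rfl
@[simp] theorem nt_rev : S.rev.nt = S.nt.rev := rfl
@[simp] theorem rev_rev : S.rev.rev = S := by simp [rev]

theorem Bdd.nt (h : S.Bdd N) : S.nt.Bdd N := h
theorem Bdd.rev (h : S.Bdd N) : S.rev.Bdd N := fun p a b q hA => by
  have := h _ _ _ _ hA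
  simpa using this
theorem Bdd.swap (h : S.Bdd N) : S.swap.Bdd N := fun _ _ _ _ hA => (h _ _ _ _ hA).symm
theorem Bdd.mono {M : ℕ} (h : S.Bdd N) (hM : N ≤ M) : S.Bdd M := fun p a b q hA =>
  ⟨(h _ _ _ _ hA).1.trans (by exact_mod_cast hM), (h _ _ _ _ hA).2.trans (by exact_mod_cast hM)⟩

theorem St.mono {c c' : Q × ℤ × ℤ} (hR : R ⊆ R') (h : S.St R c c') : S.St R' c c' :=
  ⟨h.1, hR h.2.1, hR h.2.2⟩

theorem St.ofNt {c c' : Q × ℤ × ℤ} (h : S.nt.St R c c') : S.St R c c' :=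
  ⟨Or.inl (h.1.resolve_right fun h => h.1.elim), h.2⟩

theorem St.rev {c c' : Q × ℤ × ℤ} (h : S.St R c c') : S.rev.St R c' c := by
  refine ⟨?_, h.2.2, h.2.1⟩
  rcases h.1 with h | ⟨h1, h2, h3, h4⟩
  · left
    simpa [Sys.rev] using h
  · exact Or.inr ⟨h1, h3, h2, h4.symm⟩

theorem St.unrev {c c' : Q × ℤ × ℤ} (h : S.rev.St R c c') : S.St R c' c := by
  simpa using h.rev

/-- Exchange of the counters of a configuration. -/
def flip (c : Q × ℤ × ℤ) : Q × ℤ × ℤ := (c.1, c.2.2, c.2.1)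

theorem St.swap {c c' : Q × ℤ × ℤ} (h : S.nt.St R c c') :
    S.swap.St (Prod.swap ⁻¹' R) (flip c) (flip c') :=
  ⟨Or.inl (h.1.resolve_right fun h => h.1.elim), h.2⟩

theorem St.swap_quad {c c' : Q × ℤ × ℤ} (h : S.nt.St quad c c') :
    S.swap.St quad (flip c) (flip c') :=
  h.swap.mono fun _ h => ⟨h.2, h.1⟩

theorem St.unswap_quad {c c' : Q × ℤ × ℤ} (h : S.swap.St quad c c') :
    S.nt.St quad (flip c) (flip c') :=
  St.swap_quad (S := S.swap) h

theorem St.add_of_nt {c c' : Q × ℤ × ℤ} (h : S.nt.St R c c') :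
    S.A c.1 (c'.2.1 - c.2.1) (c'.2.2 - c.2.2) c'.1 := h.1.resolve_right fun h => h.1.elim

theorem St.bdd {c c' : Q × ℤ × ℤ} (hS : S.Bdd N) (h : S.St R c c') :
    |c'.2.1 - c.2.1| ≤ N ∧ |c'.2.2 - c.2.2| ≤ N := by
  rcases h.1 with h | ⟨-, h1, h2, h3⟩
  · exact hS _ _ _ _ h
  · simp [h1, h2, h3]

theorem St.shift {c c' : Q × ℤ × ℤ} (h : S.nt.St R c c') (k l : ℤ)
    (h1 : (c.2.1 + k, c.2.2 + l) ∈ R') (h2 : (c'.2.1 + k, c'.2.2 + l) ∈ R') :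
    S.nt.St R' (c.1, c.2.1 + k, c.2.2 + l) (c'.1, c'.2.1 + k, c'.2.2 + l) :=
  ⟨Or.inl (by simpa [Sys.nt] using h.add_of_nt), h1, h2⟩

/-- Vertical shifts are compatible with zero tests. -/
theorem St.vshift {c c' : Q × ℤ × ℤ} (h : S.St R c c') (l : ℤ)
    (h1 : (c.2.1, c.2.2 + l) ∈ R') (h2 : (c'.2.1, c'.2.2 + l) ∈ R') :
    S.St R' (c.1, c.2.1, c.2.2 + l) (c'.1, c'.2.1, c'.2.2 + l) := by
  refine ⟨?_, h1, h2⟩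
  rcases h.1 with h | ⟨h1, h2, h3, h4⟩
  · left
    simpa using h
  · exact Or.inr ⟨h1, h2, h3, by simp [h4]⟩

theorem ch_bdd {c c' : Q × ℤ × ℤ} {n : ℕ} (hS : S.Bdd N) (h : Ch (S.St R) n c c') :
    |c'.2.1 - c.2.1| ≤ N * n ∧ |c'.2.2 - c.2.2| ≤ N * n := by
  induction n generalizing c with
  | zero => simp [h.zero]
  | succ n ih =>
    obtain ⟨d, hd, h'⟩ := h.succ
    have h1 := hd.bdd hS
    have h2 := ih h'
    simp only [abs_le] at *
    push_cast
    refine ⟨⟨?_, ?_⟩, ?_, ?_⟩ <;> linarith [h1.1.1, h1.1.2, h1.2.1, h1.2.2, h2.1.1, h2.1.2,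
      h2.2.1, h2.2.2]

theorem ch_rev {c c' : Q × ℤ × ℤ} {n : ℕ} (h : Ch (S.St R) n c c') : Ch (S.rev.St R) n c' c :=
  h.rev fun _ _ h => h.rev

theorem ch_unrev {c c' : Q × ℤ × ℤ} {n : ℕ} (h : Ch (S.rev.St R) n c c') : Ch (S.St R) n c' c :=
  h.rev fun _ _ h => h.unrev

theorem ch_mono {c c' : Q × ℤ × ℤ} {n : ℕ} (hR : R ⊆ R') (h : Ch (S.St R) n c c') :
    Ch (S.St R') n c c' := h.mono fun _ _ h => h.mono hR

theorem ch_ofNt {c c' : Q × ℤ × ℤ} {n : ℕ} (h : Ch (S.nt.St R) n c c') :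
    Ch (S.St R) n c c' := h.mono fun _ _ h => h.ofNt

theorem ch_region {c c' : Q × ℤ × ℤ} {n : ℕ} (h : Ch (S.St R) n c c') (hn : c.2 ∈ R) :
    c'.2 ∈ R := h.inv (P := fun c => c.2 ∈ R) (fun _ _ (h : S.St R _ _) _ => h.2.2) hn

/-- Integer paths shifted far enough into the quadrant are runs. -/
theorem ch_shift {c c' : Q × ℤ × ℤ} {n : ℕ} (hS : S.Bdd N) (h : Ch (S.nt.St R) n c c') (k l : ℤ)
    (hk : N * n ≤ c.2.1 + k) (hl : N * n ≤ c.2.2 + l) :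
    Ch (S.nt.St quad) n (c.1, c.2.1 + k, c.2.2 + l) (c'.1, c'.2.1 + k, c'.2.2 + l) := by
  obtain ⟨f, rfl, rfl, hf⟩ := h
  have hb : ∀ i ≤ n, ((f i).2.1 + k, (f i).2.2 + l) ∈ quad := fun i hi => by
    have := ch_bdd hS.nt (Ch.seg hf (Nat.zero_le i) hi)
    have h2 : (N : ℤ) * ((i - 0 : ℕ) : ℤ) ≤ N * n := by gcongr; omega
    simp only [abs_le] at this
    constructor
    · linarith [this.1.1]
    · linarith [this.2.1]
  exact ⟨fun i => ((f i).1, (f i).2.1 + k, (f i).2.2 + l), rfl, rfl, fun i hi =>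
    (hf i hi).shift k l (hb i hi.le) (hb (i + 1) hi)⟩

/-- Relaxed runs shifted up far enough are runs. -/
theorem ch_vshift {c c' : Q × ℤ × ℤ} {n : ℕ} (hS : S.Bdd N) (h : Ch (S.St half) n c c') (l : ℤ)
    (hl : N * n ≤ c.2.2 + l) :
    Ch (S.St quad) n (c.1, c.2.1, c.2.2 + l) (c'.1, c'.2.1, c'.2.2 + l) := by
  obtain ⟨f, rfl, rfl, hf⟩ := h
  have hb : ∀ i ≤ n, 0 ≤ (f i).2.2 + l := fun i hi => by
    have := ch_bdd hS (Ch.seg hf (Nat.zero_le i) hi)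
    have h2 : (N : ℤ) * ((i - 0 : ℕ) : ℤ) ≤ N * n := by gcongr; omega
    simp only [abs_le] at this
    linarith [this.2.1]
  exact ⟨fun i => ((f i).1, (f i).2.1, (f i).2.2 + l), rfl, rfl, fun i hi =>
    (hf i hi).vshift l ⟨(hf i hi).2.1, hb i hi.le⟩ ⟨(hf i hi).2.2, hb (i + 1) hi⟩⟩

theorem ch_swap_quad {c c' : Q × ℤ × ℤ} {n : ℕ} (h : Ch (S.nt.St quad) n c c') :
    Ch (S.swap.St quad) n (flip c) (flip c') := h.map flip fun _ _ h => h.swap_quad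

/-- Runs of linear path schemes with at most `k` stars and length at most `L`. -/
inductive Flat (S : Sys Q) : ℕ → ℕ → Q × ℤ × ℤ → Q × ℤ × ℤ → Prop
  | path {n c c'} : Ch (S.St quad) n c c' → Flat S 0 n c c'
  | star {n q a b v w} {m : ℕ} {x y : ℤ} : Ch (S.nt.St quad) n (q, a, b) (q, a + v, b + w) →
      (∀ i < m, a ≤ x + i * v ∧ b ≤ y + i * w) → Flat S 1 n (q, x, y) (q, x + m * v, y + m * w)
  | starT {n q b w} {m : ℕ} {y : ℤ} : Ch (S.St quad) n (q, 0, b) (q, 0, b + w) →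
      (∀ i < m, b ≤ y + i * w) → Flat S 1 n (q, 0, y) (q, 0, y + m * w)
  | append {k k' L L' c c' c''} : Flat S k L c c' → Flat S k' L' c' c'' →
      Flat S (k + k') (L + L') c c''
  | mono {k k' L L' c c'} : Flat S k L c c' → k ≤ k' → L ≤ L' → Flat S k' L' c c'

variable {k L : ℕ} {c c' : Q × ℤ × ℤ}

theorem Flat.ofCle (h : Cle (S.St quad) L c c') : Flat S 0 L c c' :=
  let ⟨_, hn, h⟩ := h
  (Flat.path h).mono le_rfl hn

theorem Flat.ofNt (h : S.nt.Flat k L c c') : S.Flat k L c c' := by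
  induction h with
  | path h => exact .path (ch_ofNt h)
  | star h hm => exact .star h hm
  | starT h hm => exact .starT (ch_ofNt h) hm
  | append _ _ h1 h2 => exact .append h1 h2
  | mono _ hk hL h => exact .mono h hk hL

theorem Flat.rev (h : S.Flat k L c c') : S.rev.Flat k L c' c := by
  induction h with
  | path h => exact .path (ch_rev h)
  | @star n q a b v w m x y h hm =>
    have h1 : Ch (S.rev.nt.St quad) n (q, a + v, b + w) (q, a + v + -v, b + w + -w) := by
      simpa using ch_rev h
    have h2 := Flat.star (S := S.rev) (m := m) (x := x + m * v) (y := y + m * w) h1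
      (fun i hi => by
        have := hm (m - 1 - i) (by omega)
        push_cast [show 1 ≤ m by omega, show i ≤ m - 1 by omega] at this
        constructor <;> linarith)
    simpa using h2
  | @starT n q b w m y h hm =>
    have h1 : Ch (S.rev.St quad) n (q, 0, b + w) (q, 0, b + w + -w) := by
      simpa using ch_rev h
    have h2 := Flat.starT (S := S.rev) (m := m) (y := y + m * w) h1
      (fun i hi => by
        have := hm (m - 1 - i) (by omega)
        push_cast [show 1 ≤ m by omega, show i ≤ m - 1 by omega] at this
        linarith)
    simpa using h2
  | append _ _ h1 h2 => exact (h2.append h1).mono (by omega) (by omega)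
  | mono _ hk hL h => exact .mono h hk hL

theorem Flat.unrev (h : S.rev.Flat k L c c') : S.Flat k L c' c := by
  simpa using h.rev

theorem Flat.swap (h : S.nt.Flat k L c c') : S.swap.Flat k L (flip c) (flip c') := by
  induction h with
  | path h => exact .path (ch_swap_quad h)
  | star h hm => exact .star (ch_swap_quad h) fun i hi => (hm i hi).symm
  | @starT n q b w m y h hm =>
    have h1 := Flat.star (S := S.swap) (m := m) (x := y) (y := 0)
      (v := w) (w := 0) (by simpa [flip] using ch_swap_quad h) fun i hi => ⟨hm i hi, by simp⟩
    simpa [flip] using h1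
  | append _ _ h1 h2 => exact .append h1 h2
  | mono _ hk hL h => exact .mono h hk hL

theorem Flat.unswap (h : S.swap.Flat k L (flip c) (flip c')) : S.nt.Flat k L c c' :=
  Flat.swap (S := S.swap) h

theorem Flat.starCle {q : Q} {a b v w x y : ℤ} {m : ℕ}
    (h : Cle (S.nt.St quad) L (q, a, b) (q, a + v, b + w))
    (hm : ∀ i < m, a ≤ x + i * v ∧ b ≤ y + i * w) :
    S.Flat 1 L (q, x, y) (q, x + m * v, y + m * w) :=
  let ⟨_, hn, h⟩ := h
  (Flat.star h hm).mono le_rfl hn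

end Sys

namespace Sys
variable {Q : Type}

/-- The quadrant strip along the second axis. -/
def strip (D : ℕ) : Set (ℤ × ℤ) := {z | (0 ≤ z.1 ∧ z.1 ≤ D) ∧ 0 ≤ z.2}

theorem strip_quad {D : ℕ} : strip D ⊆ quad := fun _ h => ⟨h.1.1, h.2⟩

/-- A strip as a one-counter system. -/
def stripE (S : Sys Q) (D : ℕ) : Q × Fin (D + 1) → ℤ → Q × Fin (D + 1) → Prop :=
  fun p b q => S.A p.1 ((q.2 : ℕ) - (p.2 : ℕ)) b q.1

def toStrip (D : ℕ) (c : Q × ℤ × ℤ) : (Q × Fin (D + 1)) × ℤ :=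
  ((c.1, Fin.ofNat (D + 1) c.2.1.toNat), c.2.2)

def ofStrip (D : ℕ) (c : (Q × Fin (D + 1)) × ℤ) : Q × ℤ × ℤ := (c.1.1, ((c.1.2 : ℕ) : ℤ), c.2)

variable {S : Sys Q} {D : ℕ}

theorem toStrip_val {c : Q × ℤ × ℤ} (h : c.2 ∈ strip D) : ((toStrip D c).1.2 : ℤ) = c.2.1 := by
  obtain ⟨⟨h1, h2⟩, -⟩ := h
  simp only [toStrip, Fin.ofNat]
  rw [Nat.mod_eq_of_lt (by omega)]
  omega

theorem of_toStrip {c : Q × ℤ × ℤ} (h : c.2 ∈ strip D) : ofStrip D (toStrip D c) = c := by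
  have := toStrip_val h
  ext1
  · rfl
  · ext1
    · exact this
    · rfl

theorem St.strip {c c' : Q × ℤ × ℤ} (h : S.nt.St (strip D) c c') :
    OC (S.stripE D) noZ (Set.Ici 0) (toStrip D c) (toStrip D c') := by
  refine ⟨Or.inl ?_, h.2.1.2, h.2.2.2⟩
  have := h.add_of_nt
  rw [← toStrip_val h.2.1, ← toStrip_val h.2.2] at this
  exact this

theorem St.unstrip {c c' : (Q × Fin (D + 1)) × ℤ}
    (h : OC (S.stripE D) noZ (Set.Ici 0) c c') : S.nt.St (Sys.strip D) (ofStrip D c) (ofStrip D c') := by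
  refine ⟨Or.inl (h.1.resolve_right fun h => h.1), ⟨⟨?_, ?_⟩, h.2.1⟩, ⟨⟨?_, ?_⟩, h.2.2⟩⟩ <;>
    simp only [ofStrip] <;> omega

theorem stripE_bdd {N : ℕ} (hS : S.Bdd N) : ∀ p a q, S.stripE D p a q → |a| ≤ N :=
  fun _ _ _ h => (hS _ _ _ _ h).2

theorem cle_unstrip {L : ℕ} {c c' : (Q × Fin (D + 1)) × ℤ}
    (h : Cle (OC (S.stripE D) noZ (Set.Ici 0)) L c c') :
    Cle (S.nt.St (Sys.strip D)) L (ofStrip D c) (ofStrip D c') := h.map _ fun _ _ h => St.unstrip h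

theorem strip_low : ∃ F, Pol F ∧ ∀ (Q : Type) [Fintype Q] (S : Sys Q) (x D n : ℕ)
    (c c' : Q × ℤ × ℤ), Fintype.card Q ≤ x → S.Bdd x → D ≤ x → c.2.2 ≤ x → c'.2.2 ≤ x →
    Ch (S.nt.St (strip D)) n c c' → Cle (S.nt.St (strip D)) (F x) c c' := by
  obtain ⟨F, hF, h1⟩ := OC.low
  refine ⟨fun x => F (x * (x + 1) + x), by fun_prop,
    fun Q _ S x D n c c' hQ hS hD hc hc' h => ?_⟩
  rcases Nat.eq_zero_or_pos n with rfl | hn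
  · exact ⟨0, by simp, h.zero ▸ Ch.nil _⟩
  obtain ⟨f, rfl, rfl, hf⟩ := h
  have hm : (f 0).2 ∈ strip D := (hf 0 hn).2.1
  have hm' : (f n).2 ∈ strip D := ch_region ⟨f, rfl, rfl, hf⟩ hm
  have h2 := cle_unstrip (h1 (Q × Fin (D + 1)) (S.stripE D) noZ (x * (x + 1) + x) n
    (toStrip D (f 0)) (toStrip D (f n)) (by
      rw [Fintype.card_prod, Fintype.card_fin]
      have : Fintype.card Q * (D + 1) ≤ x * (x + 1) := by gcongr
      omega)
    (stripE_bdd (hS.mono (by omega)))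
    (hc.trans (by push_cast; nlinarith)) (hc'.trans (by push_cast; nlinarith))
    (Ch.map (toStrip D) (fun _ _ h => h.strip) ⟨f, rfl, rfl, hf⟩))
  rwa [of_toStrip hm, of_toStrip hm'] at h2

theorem strip_flat_asc : ∃ F, Pol F ∧ ∀ (Q : Type) [Fintype Q] (S : Sys Q) (x D n : ℕ)
    (c c' : Q × ℤ × ℤ), Fintype.card Q ≤ x → S.Bdd x → D ≤ x → c.2.2 ≤ c'.2.2 →
    Ch (S.nt.St (strip D)) n c c' → S.nt.Flat 1 (F x) c c' := by
  obtain ⟨F, hF, h1⟩ := OC.climb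
  refine ⟨fun x => 3 * F (x * (x + 1) + x), by fun_prop,
    fun Q _ S x D n c c' hQ hS hD hc h => ?_⟩
  beta_reduce
  rcases Nat.eq_zero_or_pos n with rfl | hn
  · exact (Flat.path (h.zero ▸ Ch.nil _)).mono (by omega) (Nat.zero_le _)
  obtain ⟨f, rfl, rfl, hf⟩ := h
  have hm : (f 0).2 ∈ strip D := (hf 0 hn).2.1
  have hm' : (f n).2 ∈ strip D := ch_region ⟨f, rfl, rfl, hf⟩ hm
  have hcl : ∀ {c c'}, Cle (S.nt.St (strip D)) (F (x * (x + 1) + x)) c c' →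
      Cle (S.nt.St quad) (F (x * (x + 1) + x)) c c' :=
    fun h => h.map id fun _ _ h => h.mono strip_quad
  rcases h1 (Q × Fin (D + 1)) (S.stripE D) (x * (x + 1) + x) n
    (toStrip D (f 0)) (toStrip D (f n)) (by
      rw [Fintype.card_prod, Fintype.card_fin]
      have : Fintype.card Q * (D + 1) ≤ x * (x + 1) := by gcongr
      omega)
    (stripE_bdd (hS.mono (by omega))) hc
    (Ch.map (toStrip D) (fun _ _ h => h.strip) ⟨f, rfl, rfl, hf⟩) with h2 | h2
  · have h2 := cle_unstrip h2
    rw [of_toStrip hm, of_toStrip hm'] at h2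
    exact (Flat.ofCle (hcl h2)).mono (by omega) (by omega)
  · obtain ⟨s, h, δ, m, hδ, hh, a1, a2, a3⟩ := h2
    have a1 := hcl (cle_unstrip a1)
    have a2 := hcl (cle_unstrip a2)
    have a3 := hcl (cle_unstrip a3)
    rw [of_toStrip hm] at a1
    rw [of_toStrip hm'] at a3
    simp only [ofStrip] at a1 a2 a3
    have b := Flat.starCle (S := S.nt) (m := m) (x := (s.2 : ℕ)) (y := h) (v := 0) (w := δ)
      (by simpa using a2) fun i hi => ⟨by simp, by simp; positivity⟩
    simp only [mul_zero, add_zero] at b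
    exact (((Flat.ofCle a1).append b).append (Flat.ofCle a3)).mono (by omega) (by omega)

/-- Runs within a strip are realised with at most one star. -/
theorem strip_flat : ∃ F, Pol F ∧ ∀ (Q : Type) [Fintype Q] (S : Sys Q) (x D n : ℕ)
    (c c' : Q × ℤ × ℤ), Fintype.card Q ≤ x → S.Bdd x → D ≤ x →
    Ch (S.nt.St (strip D)) n c c' → S.nt.Flat 1 (F x) c c' := by
  obtain ⟨F, hF, h1⟩ := strip_flat_asc
  refine ⟨F, hF, fun Q _ S x D n c c' hQ hS hD h => ?_⟩
  rcases le_total c.2.2 c'.2.2 with hle | hle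
  · exact h1 Q S x D n c c' hQ hS hD hle h
  · exact Flat.unrev (S := S.nt) (h1 Q S.rev x D n c' c hQ hS.rev hD hle (ch_rev h))

end Sys

namespace Sys
variable {Q : Type} {S : Sys Q}

/-- Test-free integer walks of length `n` with effect `w` from `p` to `q` visiting the
states of `V`. -/
def Wk (S : Sys Q) (n : ℕ) (V : Set Q) (p : Q) (w : ℤ × ℤ) (q : Q) : Prop :=
  ∃ f : ℕ → Q × ℤ × ℤ, (f 0).1 = p ∧ (f n).1 = q ∧ (f n).2 = (f 0).2 + w ∧
    (∀ i < n, S.nt.St Set.univ (f i) (f (i + 1))) ∧ ∀ s ∈ V, ∃ t ≤ n, (f t).1 = s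

variable {n m : ℕ} {V V' : Set Q} {p q r s : Q} {w w' z : ℤ × ℤ}

theorem Wk.mono (h : S.Wk n V p w q) (hV : V' ⊆ V) : S.Wk n V' p w q :=
  let ⟨f, h1, h2, h3, h4, h5⟩ := h
  ⟨f, h1, h2, h3, h4, fun s hs => h5 s (hV hs)⟩

theorem Wk.ofFun {f : ℕ → Q × ℤ × ℤ} {i j : ℕ} (hij : i ≤ j)
    (hf : ∀ k, i ≤ k → k < j → S.nt.St Set.univ (f k) (f (k + 1)))
    (hV : ∀ s ∈ V, ∃ t, i ≤ t ∧ t ≤ j ∧ (f t).1 = s) :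
    S.Wk (j - i) V (f i).1 ((f j).2 - (f i).2) (f j).1 := by
  refine ⟨fun k => f (i + k), rfl, ?_, ?_, fun k hk => hf _ (by omega) (by omega), fun s hs => ?_⟩
  · simp [Nat.add_sub_cancel' hij]
  · simp [Nat.add_sub_cancel' hij]
  · obtain ⟨t, h1, h2, h3⟩ := hV s hs
    exact ⟨t - i, by omega, by simpa [Nat.add_sub_cancel' h1] using h3⟩

theorem Wk.ofCh {R : Set (ℤ × ℤ)} {c c' : Q × ℤ × ℤ} (h : Ch (S.nt.St R) n c c') :
    S.Wk n {c.1, c'.1} c.1 (c'.2 - c.2) c'.1 := by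
  obtain ⟨f, rfl, rfl, hf⟩ := h
  simpa using Wk.ofFun (f := f) (i := 0) (j := n) (V := {(f 0).1, (f n).1}) (by omega)
    (fun k _ hk => (hf k hk).mono (Set.subset_univ _)) (by
      rintro s (rfl | rfl)
      · exact ⟨0, by omega, by omega, rfl⟩
      · exact ⟨n, by omega, by omega, rfl⟩)

theorem Wk.ofCh' {R : Set (ℤ × ℤ)} {c c' : Q × ℤ × ℤ} (h : Ch (S.nt.St R) n c c') :
    S.Wk n ∅ c.1 (c'.2 - c.2) c'.1 := (Wk.ofCh h).mono (Set.empty_subset _)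

theorem Wk.nil (p : Q) : S.Wk 0 {p} p 0 p :=
  ⟨fun _ => (p, 0), rfl, rfl, by simp, by simp, by simp⟩

theorem Wk.toCh (h : S.Wk n V p w q) (z : ℤ × ℤ) :
    Ch (S.nt.St Set.univ) n (p, z) (q, z + w) := by
  obtain ⟨f, rfl, rfl, h3, h4, -⟩ := h
  refine ⟨fun i => ((f i).1, (f i).2.1 + (z.1 - (f 0).2.1), (f i).2.2 + (z.2 - (f 0).2.2)), ?_, ?_,
    fun i hi => (h4 i hi).shift _ _ trivial trivial⟩
  · simp
  · simp only [h3, Prod.mk.injEq, true_and]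
    ext <;> simp <;> ring

theorem Wk.toCh_quad {N : ℕ} (hS : S.Bdd N) (h : S.Wk n V p w q) (h1 : N * n ≤ z.1)
    (h2 : N * n ≤ z.2) : Ch (S.nt.St quad) n (p, z) (q, z + w) := by
  have := ch_shift hS (h.toCh z) 0 0 (by simpa using h1) (by simpa using h2)
  simpa [Prod.add_def] using this

theorem Wk.bdd {N : ℕ} (hS : S.Bdd N) (h : S.Wk n V p w q) : |w.1| ≤ N * n ∧ |w.2| ≤ N * n := by
  have := ch_bdd hS.nt (h.toCh 0)
  simpa using this

theorem Wk.append (h : S.Wk n V p w q) (h' : S.Wk m V' q w' r) :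
    S.Wk (n + m) (V ∪ V') p (w + w') r := by
  obtain ⟨f, f0, fn, fw, hf, hV⟩ := h
  obtain ⟨g, g0, gm, gw, hg, hV'⟩ := h'
  let F : ℕ → Q × ℤ × ℤ := fun i => if i ≤ n then f i else
    ((g (i - n)).1, (g (i - n)).2.1 + ((f n).2.1 - (g 0).2.1),
      (g (i - n)).2.2 + ((f n).2.2 - (g 0).2.2))
  have hF1 : ∀ i ≤ n, F i = f i := fun i hi => by simp [F, hi]
  have hF2 : ∀ i, F (n + i) = ((g i).1, (g i).2.1 + ((f n).2.1 - (g 0).2.1),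
      (g i).2.2 + ((f n).2.2 - (g 0).2.2)) := fun i => by
    rcases Nat.eq_zero_or_pos i with rfl | hi
    · rw [Nat.add_zero, hF1 n le_rfl]
      ext <;> simp [fn, g0]
    · simp [F, show ¬ n + i ≤ n by omega]
  refine ⟨F, ?_, ?_, ?_, fun i hi => ?_, ?_⟩
  · rw [hF1 0 (by omega), f0]
  · rw [hF2, gm]
  · rw [hF2, hF1 0 (by omega)]
    have e1 := congrArg Prod.fst fw
    have e2 := congrArg Prod.snd fw
    have e3 := congrArg Prod.fst gw
    have e4 := congrArg Prod.snd gw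
    simp only [Prod.fst_add, Prod.snd_add] at e1 e2 e3 e4
    ext <;> simp only [Prod.fst_add, Prod.snd_add] <;> linarith
  · rcases lt_or_ge i n with h | h
    · rw [hF1 i h.le, hF1 (i + 1) h]
      exact hf i h
    · obtain ⟨j, rfl⟩ := Nat.exists_eq_add_of_le h
      rw [hF2, show n + j + 1 = n + (j + 1) by ring, hF2]
      exact (hg j (by omega)).shift _ _ trivial trivial
  · rintro s (hs | hs)
    · obtain ⟨t, ht, rfl⟩ := hV s hs
      exact ⟨t, by omega, by rw [hF1 t ht]⟩
    · obtain ⟨t, ht, rfl⟩ := hV' s hs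
      exact ⟨n + t, by omega, by rw [hF2]⟩

theorem Wk.split (h : S.Wk n V p w q) (hs : s ∈ V) : ∃ n₁ n₂ V₁ V₂ u, S.Wk n₁ V₁ p u s ∧
    S.Wk n₂ V₂ s (w - u) q ∧ n₁ + n₂ = n ∧ V ⊆ V₁ ∪ V₂ := by
  obtain ⟨f, rfl, rfl, fw, hf, hV⟩ := h
  obtain ⟨t, ht, rfl⟩ := hV s hs
  refine ⟨t - 0, n - t, {s | ∃ i, 0 ≤ i ∧ i ≤ t ∧ (f i).1 = s},
    {s | ∃ i, t ≤ i ∧ i ≤ n ∧ (f i).1 = s}, (f t).2 - (f 0).2,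
    Wk.ofFun (by omega) (fun k _ hk => hf k (by omega)) (fun s h => h), ?_, by omega,
    fun s hs => ?_⟩
  · rw [show w - ((f t).2 - (f 0).2) = (f n).2 - (f t).2 by rw [fw]; abel]
    exact Wk.ofFun ht (fun k _ hk => hf k hk) (fun s h => h)
  · obtain ⟨i, hi, rfl⟩ := hV s hs
    rcases le_total i t with h | h
    · exact Or.inl ⟨i, by omega, h, rfl⟩
    · exact Or.inr ⟨i, h, hi, rfl⟩

theorem Wk.iterate (h : S.Wk n V p w p) (k : ℕ) : S.Wk (k * n) ∅ p (k • w) p := by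
  induction k with
  | zero => simpa using (Wk.nil (S := S) p).mono (Set.empty_subset _)
  | succ k ih =>
    have := ih.append h
    rw [add_mul, one_mul, add_smul, one_smul]
    exact this.mono (Set.empty_subset _)

/-- Insertion of cycles at a visited state. -/
theorem Wk.insert (h : S.Wk n V p w q) (hs : s ∈ V) (h' : S.Wk m V' s z s) (k : ℕ) :
    S.Wk (n + k * m) V p (w + k • z) q := by
  obtain ⟨n₁, n₂, V₁, V₂, u, h1, h2, hn, hV⟩ := h.split hs
  have := (h1.append (h'.iterate k)).append h2
  rw [show u + k • z + (w - u) = w + k • z by abel] at this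
  rw [show n + k * m = n₁ + k * m + n₂ by omega]
  exact this.mono (by simpa using hV)

/-- Iterating a cycle between two high configurations. -/
theorem Flat.starWalk {N L B : ℕ} (hS : S.Bdd N) (h : S.Wk n V s w s) (hn : n ≤ L) (hB : N * L ≤ B)
    (m : ℕ) (h1 : (B : ℤ) ≤ z.1 ∧ (B : ℤ) ≤ z.2)
    (h2 : (B : ℤ) ≤ (z + m • w).1 ∧ (B : ℤ) ≤ (z + m • w).2) :
    S.nt.Flat 1 L (s, z) (s, z + m • w) := by
  have hB' : (N : ℤ) * n ≤ B := by exact_mod_cast (Nat.mul_le_mul_left N hn).trans hB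
  have h3 := h.toCh_quad hS (z := (B, B)) hB' hB'
  have key : ∀ (a v : ℤ) (i : ℕ), i < m → (B : ℤ) ≤ a → (B : ℤ) ≤ a + m * v → (B : ℤ) ≤ a + i * v := by
    intro a v i hi ha hb
    rcases le_total 0 v with hv | hv
    · have : 0 ≤ (i : ℤ) * v := by positivity
      linarith
    · have : (m : ℤ) * v ≤ i * v := mul_le_mul_of_nonpos_right (by omega) hv
      linarith
  have h4 := Flat.starCle (S := S.nt) (m := m) (x := z.1) (y := z.2) (v := w.1) (w := w.2)
    (a := B) (b := B) ⟨n, hn, h3⟩ (fun i hi => ⟨key _ _ i hi h1.1 (by simpa using h2.1),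
      key _ _ i hi h1.2 (by simpa using h2.2)⟩)
  convert h4 using 2
  ext <;> simp

theorem Flat.walk {N L B : ℕ} (hS : S.Bdd N) (h : S.Wk n V p w q) (hn : n ≤ L) (hB : N * L ≤ B)
    (h1 : (B : ℤ) ≤ z.1 ∧ (B : ℤ) ≤ z.2) : S.nt.Flat 0 L (p, z) (q, z + w) := by
  have hB' : (N : ℤ) * n ≤ B := by exact_mod_cast (Nat.mul_le_mul_left N hn).trans hB
  exact (Flat.path (h.toCh_quad hS (by linarith [h1.1]) (by linarith [h1.2]))).mono le_rfl hn

end Sys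

namespace Sys
variable {Q : Type} {S : Sys Q}

/-- The system restricted to the states of `V`. -/
def res (S : Sys Q) (V : Set Q) : Sys Q := ⟨fun p a b q => S.A p a b q ∧ p ∈ V ∧ q ∈ V, S.Z⟩

variable {n m : ℕ} {V V' : Set Q} {p q r s : Q} {w w' z : ℤ × ℤ}

theorem Wk.ofRes (h : (S.res V').Wk n V p w q) : S.Wk n V p w q :=
  let ⟨f, h1, h2, h3, h4, h5⟩ := h
  ⟨f, h1, h2, h3, fun i hi => ⟨Or.inl (h4 i hi).add_of_nt.1, trivial, trivial⟩, h5⟩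

/-- A walk is a walk in the system restricted to the set of visited states. -/
theorem Wk.toRes (h : S.Wk n V p w q) :
    ∃ V', V ⊆ V' ∧ p ∈ V' ∧ (S.res V').Wk n V' p w q := by
  obtain ⟨f, rfl, h2, h3, h4, h5⟩ := h
  exact ⟨{s | ∃ t ≤ n, (f t).1 = s}, h5, ⟨0, by omega, rfl⟩, f, rfl, h2, h3, fun i hi =>
    ⟨Or.inl ⟨(h4 i hi).add_of_nt, ⟨i, hi.le, rfl⟩, ⟨i + 1, hi, rfl⟩⟩, trivial, trivial⟩,
    fun s hs => hs⟩

theorem Wk.removeCycle [Fintype Q] (h : S.Wk n V p w q) (hn : (Fintype.card Q + 1) ^ 2 ≤ n) :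
    ∃ s k d, 0 < k ∧ k ≤ Fintype.card Q ∧ S.Wk k {s} s d s ∧ k ≤ n ∧
      S.Wk (n - k) V p (w - d) q := by
  classical
  obtain ⟨f, rfl, rfl, fw, hf, hV⟩ := h
  set K := Fintype.card Q with hK
  choose! T hT1 hT2 using hV
  obtain ⟨j, hj, hblock⟩ : ∃ j < K + 1, ∀ s ∈ V, ¬ (j * (K + 1) ≤ T s ∧ T s ≤ j * (K + 1) + K) := by
    by_contra! hcon
    have : Nonempty Q := ⟨(f 0).1⟩
    choose! g hg1 hg2 hg3 using hcon
    obtain ⟨i, j, hij, hj, heq⟩ := pigeon Finset.univ g (K + 1) (by simp) (by simp [hK])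
    have h1 := hg3 i (by omega)
    have h2 := hg2 j hj
    rw [heq] at h1
    have : (i + 1) * (K + 1) ≤ j * (K + 1) := Nat.mul_le_mul_right _ hij
    rw [add_mul] at this
    omega
  obtain ⟨i, i', hii, hi', heq⟩ := pigeon Finset.univ (fun i => (f (j * (K + 1) + i)).1) (K + 1)
    (by simp) (by simp [hK])
  have hjn : j * (K + 1) + K < n := by
    have : j * (K + 1) ≤ K * (K + 1) := Nat.mul_le_mul_right _ (by omega)
    nlinarith
  set a := j * (K + 1) + i with ha
  set a' := j * (K + 1) + i' with ha'
  refine ⟨(f a).1, a' - a, (f a').2 - (f a).2, by omega, by omega, ?_, by omega, ?_⟩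
  · have := Wk.ofFun (f := f) (i := a) (j := a') (V := {(f a).1}) (by omega)
      (fun k _ hk => hf k (by omega)) (by
        rintro s rfl
        exact ⟨a, le_rfl, by omega, rfl⟩)
    rwa [← heq] at this
  · have h1 := Wk.ofFun (f := f) (i := 0) (j := a) (V := {s | s ∈ V ∧ T s ≤ a}) (by omega)
      (fun k _ hk => hf k (by omega)) (fun s hs => ⟨T s, by omega, hs.2, hT2 s hs.1⟩)
    have h2 := Wk.ofFun (f := f) (i := a') (j := n) (V := {s | s ∈ V ∧ a' ≤ T s}) (by omega)
      (fun k _ hk => hf k (by omega)) (fun s hs => ⟨T s, hs.2, hT1 s hs.1, hT2 s hs.1⟩)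
    rw [← heq] at h2
    have h3 := h1.append h2
    rw [show n - (a' - a) = a - 0 + (n - a') by omega,
      show w - ((f a').2 - (f a).2) = (f a).2 - (f 0).2 + ((f n).2 - (f a').2) by rw [fw]; abel]
    refine h3.mono fun s hs => ?_
    have := hblock s hs
    rcases le_or_gt (T s) a with h | h
    · exact Or.inl ⟨hs, h⟩
    · exact Or.inr ⟨hs, by omega⟩

/-- Every walk is a short walk through the same states together with short cycles. -/
theorem Wk.decompose [Fintype Q] (h : (S.res V).Wk n V p w q) :
    ∃ m ≤ (Fintype.card Q + 1) ^ 2, ∃ (b : ℤ × ℤ) (D : Multiset (ℤ × ℤ)), S.Wk m V p b q ∧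
      (∀ d ∈ D, ∃ s ∈ V, ∃ k ≤ Fintype.card Q, S.Wk k ∅ s d s) ∧ w = b + D.sum := by
  induction n using Nat.strong_induction_on generalizing w with
  | _ n ih =>
    rcases lt_or_ge n ((Fintype.card Q + 1) ^ 2) with hn | hn
    · exact ⟨n, hn.le, w, 0, h.ofRes, by simp, by simp⟩
    · obtain ⟨s, k, d, hk, hkK, hc, hkn, hr⟩ := h.removeCycle hn
      obtain ⟨m, hm, b, D, h1, h2, h3⟩ := ih (n - k) (by omega) hr
      refine ⟨m, hm, b, d ::ₘ D, h1, fun d' hd' => ?_, ?_⟩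
      · rcases Multiset.mem_cons.1 hd' with rfl | hd'
        · have hs : s ∈ V := by
            obtain ⟨f, f0, -, -, hf, -⟩ := hc
            have := (hf 0 hk).add_of_nt.2.1
            rwa [f0] at this
          exact ⟨s, hs, k, hkK, hc.ofRes.mono (Set.empty_subset _)⟩
        · exact h2 d' hd'
      · rw [Multiset.sum_cons, show b + (d + D.sum) = b + D.sum + d by abel, ← h3]
        abel

end Sys

/-- The determinant of two integer vectors. -/
def det (d e : ℤ × ℤ) : ℤ := d.1 * e.2 - d.2 * e.1

theorem det_le {d e : ℤ × ℤ} {A B : ℤ} (h1 : |d.1| ≤ A) (h2 : |d.2| ≤ A) (h3 : |e.1| ≤ B)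
    (h4 : |e.2| ≤ B) : |det d e| ≤ 2 * (A * B) := by
  have hA : 0 ≤ A := (abs_nonneg _).trans h1
  calc |det d e| ≤ |d.1 * e.2| + |d.2 * e.1| := abs_sub _ _
    _ = |d.1| * |e.2| + |d.2| * |e.1| := by rw [abs_mul, abs_mul]
    _ ≤ A * B + A * B := by gcongr
    _ = _ := by ring

/-- A linear relation among the vectors with large multiplicities allows to lower the number
of large multiplicities. -/
theorem exchange_step {s : Finset (ℤ × ℤ)} {B : ℕ} (c : ℤ × ℤ → ℕ) (a : ℤ × ℤ → ℤ)
    (ha : ∀ d, |a d| ≤ B) (hsupp : ∀ d, a d ≠ 0 → d ∈ s ∧ B ≤ c d) (hne : ∃ d, a d ≠ 0)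
    (hsum : ∑ d ∈ s, a d • d = 0) :
    ∃ c' : ℤ × ℤ → ℕ, ∑ d ∈ s, c' d • d = ∑ d ∈ s, c d • d ∧
      (s.filter fun d => B ≤ c' d).card < (s.filter fun d => B ≤ c d).card := by
  classical
  wlog hpos : ∃ d, 0 < a d generalizing a
  · push Not at hpos
    obtain ⟨d, hd⟩ := hne
    exact this (fun d => -a d) (fun d => by rw [abs_neg]; exact ha d)
      (fun d hd => hsupp d (by simpa using hd)) ⟨d, by simpa using hd⟩
      (by simpa only [neg_smul, Finset.sum_neg_distrib, neg_eq_zero] using hsum)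
      ⟨d, by have := hpos d; omega⟩
  obtain ⟨d₀, hd₀⟩ := hpos
  have hex : ∃ k : ℕ, ∃ d, a d ≠ 0 ∧ (c d : ℤ) - k * a d < B := by
    refine ⟨c d₀ + 1, d₀, hd₀.ne', ?_⟩
    push_cast
    nlinarith
  obtain ⟨d₁, hd₁, hlt⟩ := Nat.find_spec hex
  have hmin := fun k (hk : k < Nat.find hex) => Nat.find_min hex hk
  generalize Nat.find hex = k at hlt hmin
  have hk : 0 < k := by
    rcases Nat.eq_zero_or_pos k with rfl | h
    · have := (hsupp d₁ hd₁).2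
      simp at hlt
      omega
    · exact h
  have hnn : ∀ d, 0 ≤ (c d : ℤ) - k * a d := by
    intro d
    by_cases h0 : a d = 0
    · simp [h0]
    · have h1 := hmin (k - 1) (by omega)
      push Not at h1
      have h1 := h1 d h0
      have h2 := abs_le.1 (ha d)
      push_cast [show 1 ≤ k by omega] at h1
      linarith
  refine ⟨fun d => ((c d : ℤ) - k * a d).toNat, ?_, ?_⟩
  · have : ∀ d ∈ s, ((c d : ℤ) - k * a d).toNat • d = c d • d - k • (a d • d) := fun d _ => by
      rw [← natCast_zsmul, Int.toNat_of_nonneg (hnn d), sub_smul, mul_smul, natCast_zsmul,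
        natCast_zsmul]
    rw [Finset.sum_congr rfl this, Finset.sum_sub_distrib, ← Finset.smul_sum, hsum]
    simp
  · refine Finset.card_lt_card ⟨fun d hd => ?_, fun hsub => ?_⟩
    · rw [Finset.mem_filter] at hd ⊢
      refine ⟨hd.1, ?_⟩
      by_cases h0 : a d = 0
      · simpa [h0] using hd.2
      · exact (hsupp d h0).2
    · have h1 := hsub (Finset.mem_filter.2 (hsupp d₁ hd₁))
      rw [Finset.mem_filter] at h1
      have h2 := h1.2
      have := hnn d₁
      beta_reduce at h2
      omega

theorem exchange {s : Finset (ℤ × ℤ)} {E B : ℕ} (hs : ∀ d ∈ s, |d.1| ≤ E ∧ |d.2| ≤ E)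
    (hB : 6 * (E * E) + E + 1 ≤ B) (c : ℤ × ℤ → ℕ) :
    ∃ (c' : ℤ × ℤ → ℕ) (d₁ d₂ : ℤ × ℤ) (n₁ n₂ : ℕ),
      ∑ d ∈ s, c d • d = ∑ d ∈ s, c' d • d + n₁ • d₁ + n₂ • d₂ ∧ (∀ d ∈ s, c' d ≤ B) ∧
      (n₁ = 0 ∨ d₁ ∈ s) ∧ (n₂ = 0 ∨ d₂ ∈ s ∧ d₁ ∈ s ∧ det d₁ d₂ ≠ 0) := by
  classical
  obtain ⟨k, hk⟩ : ∃ k, (s.filter fun d => B ≤ c d).card = k := ⟨_, rfl⟩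
  induction k using Nat.strong_induction_on generalizing c with
  | _ k ih =>
    have red : ∀ a : ℤ × ℤ → ℤ, (∀ d, |a d| ≤ B) → (∀ d, a d ≠ 0 → d ∈ s ∧ B ≤ c d) →
        (∃ d, a d ≠ 0) → ∑ d ∈ s, a d • d = 0 → ∃ (c' : ℤ × ℤ → ℕ) (d₁ d₂ : ℤ × ℤ) (n₁ n₂ : ℕ),
      ∑ d ∈ s, c d • d = ∑ d ∈ s, c' d • d + n₁ • d₁ + n₂ • d₂ ∧ (∀ d ∈ s, c' d ≤ B) ∧
      (n₁ = 0 ∨ d₁ ∈ s) ∧ (n₂ = 0 ∨ d₂ ∈ s ∧ d₁ ∈ s ∧ det d₁ d₂ ≠ 0) := by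
      intro a h1 h2 h3 h4
      obtain ⟨c', e1, e2⟩ := exchange_step c a h1 h2 h3 h4
      have := ih _ (hk ▸ e2) c' rfl
      rwa [e1] at this
    -- three-term relations
    have rel : ∀ d e f : ℤ × ℤ, d ∈ s → e ∈ s → f ∈ s → B ≤ c d → B ≤ c e → B ≤ c f →
        ∀ x y z : ℤ, |x| + |y| + |z| ≤ B → d ≠ e → (x ≠ 0 ∨ y ≠ 0) → (z = 0 ∨ f ≠ d ∧ f ≠ e) →
        x • d + y • e + z • f = 0 → ∃ (c' : ℤ × ℤ → ℕ) (d₁ d₂ : ℤ × ℤ) (n₁ n₂ : ℕ),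
      ∑ d ∈ s, c d • d = ∑ d ∈ s, c' d • d + n₁ • d₁ + n₂ • d₂ ∧ (∀ d ∈ s, c' d ≤ B) ∧
      (n₁ = 0 ∨ d₁ ∈ s) ∧ (n₂ = 0 ∨ d₂ ∈ s ∧ d₁ ∈ s ∧ det d₁ d₂ ≠ 0) := by
      intro d e f hd he hf hcd hce hcf x y z hxyz hde hne hz hrel
      have hx := abs_nonneg x
      have hy := abs_nonneg y
      have hz' := abs_nonneg z
      refine red (fun g => (if g = d then x else 0) + (if g = e then y else 0) +
        (if g = f then z else 0)) (fun g => ?_) (fun g hg => ?_) ?_ ?_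
      · refine (abs_add_three _ _ _).trans (le_trans ?_ hxyz)
        have hite : ∀ (P : Prop) [Decidable P] (x : ℤ), |if P then x else 0| ≤ |x| := by
          intro P _ x
          split_ifs <;> simp
        exact add_le_add (add_le_add (hite _ _) (hite _ _)) (hite _ _)
      · by_cases g1 : g = d
        · exact g1 ▸ ⟨hd, hcd⟩
        by_cases g2 : g = e
        · exact g2 ▸ ⟨he, hce⟩
        by_cases g3 : g = f
        · exact g3 ▸ ⟨hf, hcf⟩
        · simp [g1, g2, g3] at hg
      · rcases hne with h | h
        · refine ⟨d, ?_⟩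
          rcases hz with rfl | ⟨hz1, -⟩
          · simpa [hde] using h
          · simpa [hde, Ne.symm hz1] using h
        · refine ⟨e, ?_⟩
          rcases hz with rfl | ⟨-, hz1⟩
          · simpa [Ne.symm hde] using h
          · simpa [Ne.symm hde, Ne.symm hz1] using h
      · simp only [add_smul, ite_smul, zero_smul, Finset.sum_add_distrib, Finset.sum_ite_eq', hd,
          he, hf, if_true]
        exact hrel
    have two : ∀ d e : ℤ × ℤ, d ∈ s → e ∈ s → B ≤ c d → B ≤ c e → d ≠ e → det d e = 0 →
        ∃ (c' : ℤ × ℤ → ℕ) (d₁ d₂ : ℤ × ℤ) (n₁ n₂ : ℕ),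
      ∑ d ∈ s, c d • d = ∑ d ∈ s, c' d • d + n₁ • d₁ + n₂ • d₂ ∧ (∀ d ∈ s, c' d ≤ B) ∧
      (n₁ = 0 ∨ d₁ ∈ s) ∧ (n₂ = 0 ∨ d₂ ∈ s ∧ d₁ ∈ s ∧ det d₁ d₂ ≠ 0) := by
      intro d e hd he hcd hce hde hdet
      have hEE : (6 * (E * E) + E + 1 : ℤ) ≤ B := by exact_mod_cast hB
      have hE2 : (E : ℤ) ≤ E * E := by
        have : E ≤ E * E := Nat.le_mul_self E
        exact_mod_cast this
      have b1 := hs d hd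
      have b2 := hs e he
      by_cases h : d.2 = 0 ∧ e.2 = 0
      · refine rel d e d hd he hd hcd hce hcd e.1 (-d.1) 0 ?_ hde ?_ (Or.inl rfl) ?_
        · rw [abs_neg, abs_zero]
          linarith [b1.1, b2.1]
        · by_contra! hcon
          exact hde (Prod.ext (by omega) (by omega))
        · ext
          · simp; ring
          · simp [h.1, h.2]
      · refine rel d e d hd he hd hcd hce hcd e.2 (-d.2) 0 ?_ hde ?_ (Or.inl rfl) ?_
        · rw [abs_neg, abs_zero]
          linarith [b1.2, b2.2]
        · omega
        · unfold det at hdet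
          ext
          · simp; linarith
          · simp; ring
    by_cases h3 : 2 < (s.filter fun d => B ≤ c d).card
    · obtain ⟨d, hd, e, he, f, hf, hde, hdf, hef⟩ := Finset.two_lt_card.1 h3
      rw [Finset.mem_filter] at hd he hf
      by_cases hdet : det d e = 0
      · exact two d e hd.1 he.1 hd.2 he.2 hde hdet
      by_cases hdet' : det e f = 0
      · exact two e f he.1 hf.1 he.2 hf.2 hef hdet'
      by_cases hdet'' : det d f = 0
      · exact two d f hd.1 hf.1 hd.2 hf.2 hdf hdet''
      refine rel d e f hd.1 he.1 hf.1 hd.2 he.2 hf.2 (det e f) (-det d f) (det d e) ?_ hde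
        (Or.inl hdet') (Or.inr ⟨hdf.symm, hef.symm⟩) ?_
      · rw [abs_neg]
        have := det_le (hs e he.1).1 (hs e he.1).2 (hs f hf.1).1 (hs f hf.1).2
        have := det_le (hs d hd.1).1 (hs d hd.1).2 (hs f hf.1).1 (hs f hf.1).2
        have := det_le (hs d hd.1).1 (hs d hd.1).2 (hs e he.1).1 (hs e he.1).2
        have : (6 * (E * E) + E + 1 : ℤ) ≤ B := by exact_mod_cast hB
        linarith
      · unfold det
        ext <;> simp <;> ring
    · have fin : ∀ d e : ℤ × ℤ, (∀ g ∈ s, B ≤ c g → g = d ∨ g = e) → (d ∈ s ∨ c d = 0) →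
          (e = d ∨ c e = 0 ∨ e ∈ s ∧ d ∈ s ∧ det d e ≠ 0) →
          ∃ (c' : ℤ × ℤ → ℕ) (d₁ d₂ : ℤ × ℤ) (n₁ n₂ : ℕ),
      ∑ d ∈ s, c d • d = ∑ d ∈ s, c' d • d + n₁ • d₁ + n₂ • d₂ ∧ (∀ d ∈ s, c' d ≤ B) ∧
      (n₁ = 0 ∨ d₁ ∈ s) ∧ (n₂ = 0 ∨ d₂ ∈ s ∧ d₁ ∈ s ∧ det d₁ d₂ ≠ 0) := by
        intro d e hall hd he
        refine ⟨fun g => if g = d ∨ g = e then 0 else c g, d, e, if d ∈ s then c d else 0,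
          if e ≠ d ∧ e ∈ s then c e else 0, ?_, fun g hg => ?_, ?_, ?_⟩
        · have : ∀ g ∈ s, c g • g = (if g = d ∨ g = e then 0 else c g) • g +
              (if g = d then c d • d else 0) + (if g = e then (if e ≠ d then c e else 0) • e
                else 0) := by
            intro g _
            by_cases g1 : g = d
            · subst g1
              by_cases g2 : g = e <;> simp [g2]
            · by_cases g2 : g = e
              · subst g2
                simp [g1]
              · simp [g1, g2]
          rw [Finset.sum_congr rfl this, Finset.sum_add_distrib, Finset.sum_add_distrib,
            Finset.sum_ite_eq', Finset.sum_ite_eq']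
          congr 1
          · congr 1
            split_ifs <;> simp
          · by_cases g1 : e = d <;> by_cases g2 : e ∈ s <;> simp [g1, g2]
        · beta_reduce
          split_ifs with h
          · omega
          · by_contra hcon
            exact h (hall g hg (by omega))
        · split_ifs with h
          · exact Or.inr h
          · exact Or.inl rfl
        · split_ifs with h
          · rcases he with he | he | he
            · exact absurd he h.1
            · exact Or.inl he
            · exact Or.inr he
          · exact Or.inl rfl
      have h3 : (s.filter fun d => B ≤ c d).card = 0 ∨ (s.filter fun d => B ≤ c d).card = 1 ∨
        (s.filter fun d => B ≤ c d).card = 2 := by omega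
      have hmem : ∀ {F : Finset (ℤ × ℤ)}, (s.filter fun d => B ≤ c d) = F →
          ∀ g, g ∈ F ↔ g ∈ s ∧ B ≤ c g := fun h g => by rw [← h, Finset.mem_filter]
      rcases h3 with h3 | h3 | h3
      · refine ⟨c, 0, 0, 0, 0, by simp, fun g hg => ?_, Or.inl rfl, Or.inl rfl⟩
        have := hmem (Finset.card_eq_zero.1 h3) g
        simp at this
        have := this hg
        omega
      · obtain ⟨d, hd⟩ := Finset.card_eq_one.1 h3
        have hd := hmem hd
        exact fin d d (fun g h1 h2 => Or.inl (by simpa using (hd g).2 ⟨h1, h2⟩))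
          (Or.inl ((hd d).1 (by simp)).1) (Or.inl rfl)
      · obtain ⟨d, e, hde, hd⟩ := Finset.card_eq_two.1 h3
        have hd := hmem hd
        have h1 := (hd d).1 (by simp)
        have h2 := (hd e).1 (by simp)
        by_cases hdet : det d e = 0
        · exact two d e h1.1 h2.1 h1.2 h2.2 hde hdet
        · exact fin d e (fun g h1 h2 => by simpa using (hd g).2 ⟨h1, h2⟩)
            (Or.inl h1.1) (Or.inr (Or.inr ⟨h2.1, h1.1, hdet⟩))

namespace Sys
variable {Q : Type} {S : Sys Q} {n m : ℕ} {V V' : Set Q} {p q r s : Q} {w w' z : ℤ × ℤ}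

theorem Wk.insertAll (h : S.Wk m V p w q) (t : Finset (ℤ × ℤ)) (c : ℤ × ℤ → ℕ) {x B : ℕ}
    (ht : ∀ d ∈ t, c d ≤ B ∧ ∃ s ∈ V, ∃ k ≤ x, S.Wk k ∅ s d s) :
    ∃ n ≤ m + t.card * (B * x), S.Wk n V p (w + ∑ d ∈ t, c d • d) q := by
  classical
  induction t using Finset.induction_on with
  | empty => exact ⟨m, by simp, by simpa using h⟩
  | insert d t hd ih =>
    obtain ⟨n, hn, h1⟩ := ih fun d hd => ht d (Finset.mem_insert_of_mem hd)
    obtain ⟨hc, s, hs, k, hk, h2⟩ := ht d (Finset.mem_insert_self d t)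
    refine ⟨n + c d * k, ?_, ?_⟩
    · rw [Finset.card_insert_of_notMem hd, add_mul]
      have := Nat.mul_le_mul hc hk
      omega
    · rw [Finset.sum_insert hd, add_comm (c d • d), ← add_assoc]
      exact h1.insert hs h2 (c d)

/-- Every walk has the same effect as a short walk together with repetitions of at most two
short cycles. -/
theorem Wk.two_cycles : ∃ F, Pol F ∧ ∀ (Q : Type) [Fintype Q] (S : Sys Q) (x n : ℕ) (V : Set Q)
    (p q : Q) (w : ℤ × ℤ), Fintype.card Q ≤ x → S.Bdd x → S.Wk n V p w q →
    ∃ (m : ℕ) (b : ℤ × ℤ) (s₁ s₂ : Q) (k₁ k₂ : ℕ) (d₁ d₂ : ℤ × ℤ) (n₁ n₂ : ℕ), m ≤ F x ∧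
      S.Wk m (V ∪ {s₁, s₂}) p b q ∧ k₁ ≤ x ∧ k₂ ≤ x ∧ S.Wk k₁ ∅ s₁ d₁ s₁ ∧ S.Wk k₂ ∅ s₂ d₂ s₂ ∧
      w = b + n₁ • d₁ + n₂ • d₂ ∧ (n₂ = 0 ∨ det d₁ d₂ ≠ 0) := by
  classical
  refine ⟨fun x => (x + 1) ^ 2 + (2 * (x * x) + 1) ^ 2 *
    ((6 * ((x * x) * (x * x)) + (x * x) + 1) * x), by fun_prop,
    fun Q _ S x n V p q w hQ hS h => ?_⟩
  beta_reduce
  obtain ⟨V', hV, hp, h⟩ := h.toRes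
  obtain ⟨m, hm, b, D, hb, hD, hw⟩ := h.decompose
  have hE : ∀ d ∈ D.toFinset, |d.1| ≤ ((x * x : ℕ) : ℤ) ∧ |d.2| ≤ ((x * x : ℕ) : ℤ) := by
    intro d hd
    obtain ⟨s, hs, k, hk, hwk⟩ := hD d (Multiset.mem_toFinset.1 hd)
    have h1 := hwk.bdd hS
    have h2 : (x : ℤ) * k ≤ ((x * x : ℕ) : ℤ) := by
      push_cast
      gcongr
      omega
    exact ⟨h1.1.trans h2, h1.2.trans h2⟩
  obtain ⟨c', d₁, d₂, n₁, n₂, hsum, hc', h₁, h₂⟩ :=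
    exchange hE (B := 6 * ((x * x) * (x * x)) + (x * x) + 1) le_rfl fun d => D.count d
  rw [← Finset.sum_multiset_count] at hsum
  obtain ⟨m', hm', hwk⟩ := hb.insertAll D.toFinset c' fun d hd => by
    obtain ⟨s, hs, k, hk, hwk⟩ := hD d (Multiset.mem_toFinset.1 hd)
    exact ⟨hc' d hd, s, hs, k, hk.trans hQ, hwk⟩
  have hcard : D.toFinset.card ≤ (2 * (x * x) + 1) ^ 2 := by
    have hsub : D.toFinset ⊆ Finset.Icc (-((x * x : ℕ) : ℤ)) ((x * x : ℕ) : ℤ) ×ˢ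
        Finset.Icc (-((x * x : ℕ) : ℤ)) ((x * x : ℕ) : ℤ) := fun d hd => by
      have := hE d hd
      simp only [Finset.mem_product, Finset.mem_Icc]
      exact ⟨abs_le.1 this.1, abs_le.1 this.2⟩
    refine (Finset.card_le_card hsub).trans ?_
    rw [Finset.card_product, Int.card_Icc, sq]
    generalize x * x = y
    have : ((y : ℤ) + 1 - -(y : ℤ)).toNat = 2 * y + 1 := by omega
    rw [this]
  have hlen : m' ≤ (x + 1) ^ 2 + (2 * (x * x) + 1) ^ 2 *
    ((6 * ((x * x) * (x * x)) + (x * x) + 1) * x) := by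
    refine hm'.trans (Nat.add_le_add (hm.trans (Nat.pow_le_pow_left (by omega) 2)) ?_)
    exact Nat.mul_le_mul_right _ hcard
  have hcyc : ∀ d : ℤ × ℤ, ∃ s ∈ V', ∃ k ≤ x, ∃ d', S.Wk k ∅ s d' s ∧ (d ∈ D.toFinset → d' = d) := by
    intro d
    by_cases hd : d ∈ D.toFinset
    · obtain ⟨s, hs, k, hk, hwk⟩ := hD d (Multiset.mem_toFinset.1 hd)
      exact ⟨s, hs, k, hk.trans hQ, d, hwk, fun _ => rfl⟩
    · exact ⟨p, hp, 0, by omega, 0, (Wk.nil p).mono (Set.empty_subset _), fun h => absurd h hd⟩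
  obtain ⟨s₁, hs₁, k₁, hk₁, e₁, hw₁, he₁⟩ := hcyc d₁
  obtain ⟨s₂, hs₂, k₂, hk₂, e₂, hw₂, he₂⟩ := hcyc d₂
  refine ⟨m', b + ∑ d ∈ D.toFinset, c' d • d, s₁, s₂, k₁, k₂, e₁, e₂, n₁, n₂, hlen,
    hwk.mono ?_, hk₁, hk₂, hw₁, hw₂, ?_, ?_⟩
  · refine Set.union_subset hV ?_
    rintro _ (rfl | rfl)
    · exact hs₁
    · exact hs₂
  · rw [hw, hsum]
    have e1 : n₁ • e₁ = n₁ • d₁ := by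
      rcases h₁ with rfl | h
      · simp
      · rw [he₁ h]
    have e2 : n₂ • e₂ = n₂ • d₂ := by
      rcases h₂ with rfl | h
      · simp
      · rw [he₂ h.1]
    rw [e1, e2]
    abel
  · rcases h₂ with h | ⟨h, h', hdet⟩
    · exact Or.inl h
    · rw [he₁ h', he₂ h]
      exact Or.inr hdet

end Sys

theorem pos_combination {d₁ d₂ : ℤ × ℤ} {n₁ n₂ : ℤ} {E : ℕ} (hn₁ : 0 ≤ n₁) (hn₂ : 0 ≤ n₂)
    (h₁ : |d₁.1| ≤ E ∧ |d₁.2| ≤ E) (h₂ : |d₂.1| ≤ E ∧ |d₂.2| ≤ E)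
    (h : 0 < n₁ * d₁.1 + n₂ * d₂.1) (h' : 0 < n₁ * d₁.2 + n₂ * d₂.2) :
    ∃ a₁ a₂ : ℕ, a₁ ≤ 2 * E + 1 ∧ a₂ ≤ 2 * E + 1 ∧ (0 : ℤ) < a₁ * d₁.1 + a₂ * d₂.1 ∧
      (0 : ℤ) < a₁ * d₁.2 + a₂ * d₂.2 := by
  obtain ⟨p, q⟩ := d₁
  obtain ⟨r, t⟩ := d₂
  simp only [abs_le] at *
  by_cases c1 : 0 < p ∧ 0 < q
  · exact ⟨1, 0, by omega, by omega, by simpa using c1.1, by simpa using c1.2⟩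
  by_cases c2 : 0 < r ∧ 0 < t
  · exact ⟨0, 1, by omega, by omega, by simpa using c2.1, by simpa using c2.2⟩
  have key : ∀ p q r t : ℤ, 0 < n₁ * p + n₂ * r → 0 < n₁ * q + n₂ * t → 0 < p →
      ¬ (0 < p ∧ 0 < q) → ¬ (0 < r ∧ 0 < t) → q ≤ 0 ∧ 0 < t ∧ r ≤ 0 ∧ 0 < p * t - q * r := by
    intro p q r t h h' hp c1 c2
    have hq : q ≤ 0 := by
      by_contra!
      exact c1 ⟨hp, this⟩
    have ht : 0 < t := by
      by_contra!
      nlinarith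
    have hr : r ≤ 0 := by
      by_contra!
      exact c2 ⟨this, ht⟩
    refine ⟨hq, ht, hr, ?_⟩
    have : 0 < n₁ * (p * t - q * r) := by nlinarith
    exact pos_of_mul_pos_right this hn₁
  by_cases hp : 0 < p
  · obtain ⟨hq, ht, hr, hdet⟩ := key p q r t h h' hp c1 c2
    refine ⟨(t - r).toNat, (p - q).toNat, by omega, by omega, ?_, ?_⟩ <;>
      rw [Int.toNat_of_nonneg (by omega), Int.toNat_of_nonneg (by omega)] <;> linarith
  · have hr : 0 < r := by
      by_contra!
      nlinarith
    obtain ⟨ht, hq, hp, hdet⟩ : t ≤ 0 ∧ 0 < q ∧ p ≤ 0 ∧ 0 < r * q - t * p := by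
      have ht : t ≤ 0 := by
        by_contra!
        exact c2 ⟨hr, this⟩
      have hq : 0 < q := by
        by_contra!
        nlinarith
      have : 0 < n₂ * (r * q - t * p) := by nlinarith
      exact ⟨ht, hq, by omega, pos_of_mul_pos_right this hn₂⟩
    refine ⟨(r - t).toNat, (q - p).toNat, by omega, by omega, ?_, ?_⟩ <;>
      rw [Int.toNat_of_nonneg (by omega), Int.toNat_of_nonneg (by omega)] <;> linarith

namespace Sys
variable {Q : Type} {S : Sys Q} {n m : ℕ} {V V' : Set Q} {p q r s : Q} {w w' z : ℤ × ℤ}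

theorem abs_form_le {α β a b : ℤ} {x y : ℕ} (h₁ : |α| ≤ x) (h₂ : |β| ≤ x) (ha : |a| ≤ y)
    (hb : |b| ≤ y) : |α * a + β * b| ≤ ((2 * (x * y) : ℕ) : ℤ) := by
  calc |α * a + β * b| ≤ |α * a| + |β * b| := abs_add_le _ _
    _ = |α| * |a| + |β| * |b| := by rw [abs_mul, abs_mul]
    _ ≤ x * y + x * y := by gcongr
    _ = _ := by push_cast; ring

/-- A cycle on which two linear forms are positive can be replaced by a short one. -/
theorem Wk.posCycle : ∃ F, Pol F ∧ ∀ (Q : Type) [Fintype Q] (S : Sys Q) (x n : ℕ) (V : Set Q)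
    (q : Q) (w : ℤ × ℤ) (α β γ δ : ℤ), Fintype.card Q ≤ x → S.Bdd x → |α| ≤ x → |β| ≤ x →
    |γ| ≤ x → |δ| ≤ x → S.Wk n V q w q → 0 < α * w.1 + β * w.2 → 0 < γ * w.1 + δ * w.2 →
    ∃ (m : ℕ) (u : ℤ × ℤ), m ≤ F x ∧ S.Wk m {q} q u q ∧ 0 < α * u.1 + β * u.2 ∧
      0 < γ * u.1 + δ * u.2 := by
  obtain ⟨F, hF, h1⟩ := Wk.two_cycles
  let A : ℕ → ℕ := fun x => 2 * (x * (x * F x)) + 1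
  let C : ℕ → ℕ := fun x => 2 * (2 * (x * (x * x))) + 1
  refine ⟨fun x => F x + A x * C x * x + A x * C x * x, by simp only [A, C]; fun_prop,
    fun Q _ S x n V q w α β γ δ hQ hS hα hβ hγ hδ h hpos hpos' => ?_⟩
  beta_reduce
  have hit : S.Wk (0 + A x * n) ({q} ∪ ∅) q (0 + A x • w) q := (Wk.nil q).append (h.iterate _)
  obtain ⟨m, b, s₁, s₂, k₁, k₂, d₁, d₂, n₁, n₂, hm, hb, hk₁, hk₂, hw₁, hw₂, hw, -⟩ :=
    h1 Q S x _ _ q q _ hQ hS hit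
  have bb := hb.bdd hS
  have hbnd : ∀ {k : ℕ} {s d}, k ≤ x → S.Wk k ∅ s d s →
      |d.1| ≤ ((x * x : ℕ) : ℤ) ∧ |d.2| ≤ ((x * x : ℕ) : ℤ) := fun {k s d} hk hd => by
    have h1 := hd.bdd hS
    have h2 : (x : ℤ) * k ≤ ((x * x : ℕ) : ℤ) := by push_cast; gcongr
    exact ⟨h1.1.trans h2, h1.2.trans h2⟩
  have hbb : (x : ℤ) * m ≤ ((x * F x : ℕ) : ℤ) := by push_cast; gcongr
  have l₁ := abs_form_le hα hβ (bb.1.trans hbb) (bb.2.trans hbb)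
  have l₂ := abs_form_le hγ hδ (bb.1.trans hbb) (bb.2.trans hbb)
  have hA : ((A x : ℕ) : ℤ) = ((2 * (x * (x * F x)) : ℕ) : ℤ) + 1 := by simp [A]
  have b₁ := hbnd hk₁ hw₁
  have b₂ := hbnd hk₂ hw₂
  have hw1 := congrArg Prod.fst hw
  have hw2 := congrArg Prod.snd hw
  simp only [Prod.fst_add, Prod.snd_add, Prod.smul_fst, Prod.smul_snd,
    zero_add] at hw1 hw2
  simp only [nsmul_eq_mul] at hw1 hw2
  have hAA : ∀ y : ℤ, 0 < y → (A x : ℤ) ≤ A x * y := fun y hy => le_mul_of_one_le_right (by omega) hy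
  have g₁ := hAA _ hpos
  have g₂ := hAA _ hpos'
  obtain ⟨a₁, a₂, ha₁, ha₂, e₁, e₂⟩ := pos_combination (d₁ := (α * d₁.1 + β * d₁.2, γ * d₁.1 + δ * d₁.2))
    (d₂ := (α * d₂.1 + β * d₂.2, γ * d₂.1 + δ * d₂.2)) (n₁ := n₁) (n₂ := n₂)
    (E := 2 * (x * (x * x))) (by omega) (by omega)
    ⟨abs_form_le hα hβ b₁.1 b₁.2, abs_form_le hγ hδ b₁.1 b₁.2⟩
    ⟨abs_form_le hα hβ b₂.1 b₂.2, abs_form_le hγ hδ b₂.1 b₂.2⟩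
    (by
      have : α * (A x * w.1) + β * (A x * w.2) = α * b.1 + β * b.2 +
        (n₁ * (α * d₁.1 + β * d₁.2) + n₂ * (α * d₂.1 + β * d₂.2)) := by rw [hw1, hw2]; ring
      have := (abs_le.1 l₁).2
      simp only
      linarith)
    (by
      have : γ * (A x * w.1) + δ * (A x * w.2) = γ * b.1 + δ * b.2 +
        (n₁ * (γ * d₁.1 + δ * d₁.2) + n₂ * (γ * d₂.1 + δ * d₂.2)) := by rw [hw1, hw2]; ring
      have := (abs_le.1 l₂).2
      simp only
      linarith)
  simp only at e₁ e₂
  have f₁ := hAA _ e₁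
  have f₂ := hAA _ e₂
  have h3 := (hb.insert (s := s₁) (by simp) hw₁ (A x * a₁)).insert (s := s₂) (by simp) hw₂ (A x * a₂)
  refine ⟨_, _, ?_, h3.mono (by simp), ?_, ?_⟩
  · gcongr
  · simp only [Prod.fst_add, Prod.snd_add, Prod.smul_fst, Prod.smul_snd]
    simp only [nsmul_eq_mul]
    push_cast
    have := (abs_le.1 l₁).1
    linarith
  · simp only [Prod.fst_add, Prod.snd_add, Prod.smul_fst, Prod.smul_snd]
    simp only [nsmul_eq_mul]
    push_cast
    have := (abs_le.1 l₂).1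
    linarith

end Sys

namespace Sys
variable {Q : Type} {S : Sys Q} {n m : ℕ} {V V' : Set Q} {p q r s s₁ s₂ : Q} {w w' z u v : ℤ × ℤ}

theorem Wk.congr (h : S.Wk n V p w q) (hw : w = w') : S.Wk n V p w' q := hw ▸ h

/-- Both components are at least `B`. -/
def High (B : ℕ) (z : ℤ × ℤ) : Prop := (B : ℤ) ≤ z.1 ∧ (B : ℤ) ≤ z.2

theorem High.add {B C : ℕ} (h : High B z) {b : ℤ × ℤ} {W : ℕ} (hb : |b.1| ≤ W ∧ |b.2| ≤ W)
    (hC : C + W ≤ B) : High C (z + b) := by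
  simp only [abs_le] at hb
  obtain ⟨h1, h2⟩ := h
  constructor
  · rw [Prod.fst_add]; omega
  · rw [Prod.snd_add]; omega

theorem Flat.leg {N L B m k : ℕ} {b d : ℤ × ℤ} (hS : S.Bdd N) (h : S.Wk m V q b q) (hs : s ∈ V)
    (h' : S.Wk k V' s d s) (hm : m ≤ L) (hk : k ≤ L) (hB : 2 * (N * L) ≤ B) (hz : High B z) (j : ℕ)
    (hz' : High B (z + b + j • d)) : S.nt.Flat 1 (3 * L) (q, z) (q, z + b + j • d) := by
  obtain ⟨n₁, n₂, V₁, V₂, u, h1, h2, hn, -⟩ := h.split hs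
  have hle : ∀ {k}, k ≤ L → ((N : ℤ) * k) ≤ ((N * L : ℕ) : ℤ) := fun h => by push_cast; gcongr
  have b1 := h1.bdd hS
  have b2 := h2.bdd hS
  have c1 : High (N * L) (z + u) := hz.add
    ⟨b1.1.trans (hle (by omega)), b1.2.trans (hle (by omega))⟩ (by omega)
  have c2 : High (N * L) (z + u + j • d) := by
    have := hz'.add (b := -(b - u)) (W := N * L) (C := N * L)
      ⟨by simpa only [Prod.fst_neg, abs_neg] using b2.1.trans (hle (by omega)),
        by simpa only [Prod.snd_neg, abs_neg] using b2.2.trans (hle (by omega))⟩ (by omega)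
    rwa [show z + b + j • d + -(b - u) = z + u + j • d by abel] at this
  have f1 := Flat.walk hS h1 (L := L) (by omega) le_rfl (z := z)
    ⟨le_trans (by omega) hz.1, le_trans (by omega) hz.2⟩
  have f2 := Flat.starWalk hS h' hk le_rfl j c1 c2
  have f3 := Flat.walk hS h2 (L := L) (by omega) le_rfl c2
  rw [show z + u + j • d + (b - u) = z + b + j • d by abel] at f3
  exact (f1.append (f2.append f3)).mono (by omega) (by omega)

theorem Flat.cross {N L B E R W Δ m k₁ k₂ n₁ n₂ x : ℕ} {b d₁ d₂ : ℤ × ℤ} {r₁ r₂ : ℤ}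
    (hS : S.Bdd N) (hb : S.Wk m V q b q) (hs₁ : s₁ ∈ V) (hs₂ : s₂ ∈ V)
    (h₁ : S.Wk k₁ ∅ s₁ d₁ s₁) (h₂ : S.Wk k₂ ∅ s₂ d₂ s₂) (hk₁ : k₁ ≤ x) (hk₂ : k₂ ≤ x)
    (e₁ : |d₁.1| ≤ E ∧ |d₁.2| ≤ E) (e₂ : |d₂.1| ≤ E ∧ |d₂.2| ≤ E)
    (p₁ : d₁.1 < 0 ∧ 0 < d₁.2) (p₂ : 0 < d₂.1 ∧ d₂.2 < 0) (hdet : det d₁ d₂ ≠ 0)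
    (hΔ : 0 < Δ) (hR : 0 < R) (hr₁ : |r₁| ≤ R) (hr₂ : |r₂| ≤ R)
    (hbr : Δ • b = r₁ • d₁ + r₂ • d₂) (hΔW : N * (Δ * m) ≤ W)
    (hL : (Δ + 1) * m + 2 * (R * (2 * E + 1) * x) + x ≤ L) (hB : 2 * (N * L) ≤ B)
    (hu : High (B + W) u) (hv : High (B + W) v)
    (huv : v = u + b + Δ • b + n₁ • d₁ + n₂ • d₂) : S.nt.Flat 2 (5 * L) (q, u) (q, v) := by
  obtain ⟨P₁, Q₁⟩ := d₁
  obtain ⟨P₂, Q₂⟩ := d₂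
  simp only [abs_le] at *
  obtain ⟨g₁, hg₁⟩ : ∃ g : ℕ, (g : ℤ) = R * (P₂ - Q₂) := ⟨(R * (P₂ - Q₂)).toNat,
    Int.toNat_of_nonneg (mul_nonneg (by omega) (by omega))⟩
  obtain ⟨g₂, hg₂⟩ : ∃ g : ℕ, (g : ℤ) = R * (Q₁ - P₁) := ⟨(R * (Q₁ - P₁)).toNat,
    Int.toNat_of_nonneg (mul_nonneg (by omega) (by omega))⟩
  have G₁ : (R : ℤ) ≤ g₁ := hg₁ ▸ le_mul_of_one_le_right (by omega) (by omega)
  have G₂ : (R : ℤ) ≤ g₂ := hg₂ ▸ le_mul_of_one_le_right (by omega) (by omega)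
  have G₁' : (g₁ : ℤ) ≤ (R * (2 * E) : ℕ) := by
    rw [hg₁]
    push_cast
    exact mul_le_mul_of_nonneg_left (by omega) (by omega)
  have G₂' : (g₂ : ℤ) ≤ (R * (2 * E) : ℕ) := by
    rw [hg₂]
    push_cast
    exact mul_le_mul_of_nonneg_left (by omega) (by omega)
  obtain ⟨a₁, ha₁⟩ : ∃ a : ℕ, (a : ℤ) = g₁ - r₁ := ⟨(g₁ - r₁).toNat, by omega⟩
  obtain ⟨a₂, ha₂⟩ : ∃ a : ℕ, (a : ℤ) = g₂ - r₂ := ⟨(g₂ - r₂).toNat, by omega⟩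
  have hRE : R * (2 * E + 1) = R * (2 * E) + R := by ring
  have hlen : ∀ {a k}, a ≤ R * (2 * E + 1) → k ≤ x → a * k ≤ R * (2 * E + 1) * x :=
    fun h h' => Nat.mul_le_mul h h'
  have hm : (Δ + 1) * m = Δ * m + m := by ring
  -- the diagonal cycle
  obtain ⟨ℓ, hℓ, hc⟩ : ∃ ℓ ≤ L, S.Wk ℓ V q (-(R * (P₁ * Q₂ - Q₁ * P₂)), -(R * (P₁ * Q₂ - Q₁ * P₂))) q := by
    have h := ((hb.append (hb.iterate (Δ - 1))).insert (s := s₁) (Or.inl hs₁) h₁ a₁).insert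
      (s := s₂) (Or.inl hs₂) h₂ a₂
    refine ⟨_, ?_, (h.mono Set.subset_union_left).congr ?_⟩
    · have := hlen (a := a₁) (k := k₁) (by omega) hk₁
      have := hlen (a := a₂) (k := k₂) (by omega) hk₂
      have : m + (Δ - 1) * m = Δ * m := by
        obtain ⟨y, rfl⟩ : ∃ y, Δ = y + 1 := ⟨Δ - 1, by omega⟩
        simp only [Nat.add_sub_cancel]
        ring
      omega
    · have : b + (Δ - 1) • b = Δ • b := by
        obtain ⟨y, rfl⟩ : ∃ y, Δ = y + 1 := ⟨Δ - 1, by omega⟩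
        simp only [Nat.add_sub_cancel]
        rw [add_comm, succ_nsmul]
      rw [this, hbr]
      have ha₁' : (a₁ : ℤ) = R * (P₂ - Q₂) - r₁ := by rw [ha₁, hg₁]
      have ha₂' : (a₂ : ℤ) = R * (Q₁ - P₁) - r₂ := by rw [ha₂, hg₂]
      ext
      · simp [ha₁', ha₂']; ring
      · simp [ha₁', ha₂']; ring
  have hg₁0 : 0 < g₁ := by omega
  have hg₂0 : 0 < g₂ := by omega
  set M := min (n₁ / g₁) (n₂ / g₂) with hM
  obtain ⟨f₁, hf₁⟩ := Nat.exists_eq_add_of_le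
    ((Nat.le_div_iff_mul_le hg₁0).1 (min_le_left (n₁ / g₁) (n₂ / g₂)))
  obtain ⟨f₂, hf₂⟩ := Nat.exists_eq_add_of_le
    ((Nat.le_div_iff_mul_le hg₂0).1 (min_le_right (n₁ / g₁) (n₂ / g₂)))
  rw [← hM] at hf₁ hf₂
  have hsmall : f₁ ≤ g₁ ∨ f₂ ≤ g₂ := by
    rcases le_total (n₁ / g₁) (n₂ / g₂) with h | h
    · left
      rw [min_eq_left h] at hM
      have := Nat.mod_lt n₁ hg₁0
      have := Nat.div_add_mod' n₁ g₁
      rw [hM] at hf₁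
      omega
    · right
      rw [min_eq_right h] at hM
      have := Nat.mod_lt n₂ hg₂0
      have := Nat.div_add_mod' n₂ g₂
      rw [hM] at hf₂
      omega
  set κ : ℤ × ℤ := (-(R * (P₁ * Q₂ - Q₁ * P₂)), -(R * (P₁ * Q₂ - Q₁ * P₂))) with hκ
  have huv' : v = u + b + Δ • b + f₁ • (P₁, Q₁) + f₂ • (P₂, Q₂) + M • κ := by
    rw [huv, hf₁, hf₂]
    ext
    · simp [hκ, hg₁, hg₂]; ring
    · simp [hκ, hg₁, hg₂]; ring
  have hNΔ : |(Δ • b).1| ≤ W ∧ |(Δ • b).2| ≤ W := by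
    have := (hb.iterate Δ).bdd hS
    have h' : (N : ℤ) * (Δ * m : ℕ) ≤ W := by exact_mod_cast hΔW
    exact ⟨this.1.trans h', this.2.trans h'⟩
  have hNΔ' : |(-(Δ • b)).1| ≤ W ∧ |(-(Δ • b)).2| ≤ W := by
    simpa only [Prod.fst_neg, Prod.snd_neg, abs_neg] using hNΔ
  have hNL : N * L ≤ B := by omega
  -- the leg followed by the compensation
  have leg : ∀ z : ℤ × ℤ, High (B + W) z →
      High (B + W) (z + b + Δ • b + f₁ • (P₁, Q₁) + f₂ • (P₂, Q₂)) →
      S.nt.Flat 1 (4 * L) (q, z) (q, z + b + Δ • b + f₁ • (P₁, Q₁) + f₂ • (P₂, Q₂)) := by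
    intro z hz hz'
    have hz₁ : High B z := ⟨le_trans (by omega) hz.1, le_trans (by omega) hz.2⟩
    have hw := hz'.add hNΔ' le_rfl
    have fin : ∀ w, w + Δ • b = z + b + Δ • b + f₁ • (P₁, Q₁) + f₂ • (P₂, Q₂) → High B w →
        S.nt.Flat 1 (3 * L) (q, z) (q, w) →
        S.nt.Flat 1 (4 * L) (q, z) (q, z + b + Δ • b + f₁ • (P₁, Q₁) + f₂ • (P₂, Q₂)) := by
      intro w hw hw' h
      have := Flat.walk hS (hb.iterate Δ) (L := L) (by omega) hNL hw'
      rw [hw] at this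
      exact (h.append this).mono le_rfl (by omega)
    rcases hsmall with h | h
    · have e : z + b + Δ • b + f₁ • (P₁, Q₁) + f₂ • (P₂, Q₂) + -(Δ • b) =
        z + (b + f₁ • (P₁, Q₁)) + f₂ • (P₂, Q₂) := by abel
      rw [e] at hw
      have := hlen (a := f₁) (k := k₁) (by omega) hk₁
      exact fin _ (by abel) hw
        (Flat.leg hS (hb.insert hs₁ h₁ f₁) hs₂ h₂ (by omega) (by omega) hB hz₁ f₂ hw)
    · have e : z + b + Δ • b + f₁ • (P₁, Q₁) + f₂ • (P₂, Q₂) + -(Δ • b) =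
        z + (b + f₂ • (P₂, Q₂)) + f₁ • (P₁, Q₁) := by abel
      rw [e] at hw
      have := hlen (a := f₂) (k := k₂) (by omega) hk₂
      exact fin _ (by abel) hw
        (Flat.leg hS (hb.insert hs₂ h₂ f₂) hs₁ h₁ (by omega) (by omega) hB hz₁ f₁ hw)
  have starκ : ∀ z, High B z → High B (z + M • κ) → S.nt.Flat 1 L (q, z) (q, z + M • κ) :=
    fun z h h' => Flat.starWalk hS hc hℓ hNL M h h'
  rcases le_total 0 (-(R * (P₁ * Q₂ - Q₁ * P₂))) with h | h
  · have h0 : 0 ≤ (M : ℤ) * -(R * (P₁ * Q₂ - Q₁ * P₂)) := mul_nonneg (Int.natCast_nonneg _) h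
    have hz : High (B + W) (u + M • κ) := by
      have := hu.1
      have := hu.2
      constructor <;> simp [hκ] at h0 ⊢ <;> omega
    have e : u + M • κ + b + Δ • b + f₁ • (P₁, Q₁) + f₂ • (P₂, Q₂) = v := by rw [huv']; abel
    have h2 := leg _ hz (by rw [e]; exact hv)
    rw [e] at h2
    exact ((starκ u ⟨le_trans (by omega) hu.1, le_trans (by omega) hu.2⟩
      ⟨le_trans (by omega) hz.1, le_trans (by omega) hz.2⟩).append h2).mono le_rfl (by omega)
  · have h0 : (M : ℤ) * -(R * (P₁ * Q₂ - Q₁ * P₂)) ≤ 0 := 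
      mul_nonpos_of_nonneg_of_nonpos (Int.natCast_nonneg _) h
    have hz : High (B + W) (u + b + Δ • b + f₁ • (P₁, Q₁) + f₂ • (P₂, Q₂)) := by
      have h1 := hv.1
      have h2 := hv.2
      rw [huv'] at h1 h2
      rw [Prod.fst_add _ (M • κ)] at h1
      rw [Prod.snd_add _ (M • κ)] at h2
      have h3 : (M • κ).1 = (M : ℤ) * -(R * (P₁ * Q₂ - Q₁ * P₂)) := by simp [hκ]
      have h4 : (M • κ).2 = (M : ℤ) * -(R * (P₁ * Q₂ - Q₁ * P₂)) := by simp [hκ]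
      constructor <;> omega
    have h2 := leg u hu hz
    have h3 := starκ _ ⟨le_trans (by omega) hz.1, le_trans (by omega) hz.2⟩ (by
      rw [← huv']
      exact ⟨le_trans (by omega) hv.1, le_trans (by omega) hv.2⟩)
    rw [← huv'] at h3
    exact (h2.append h3).mono le_rfl (by omega)

end Sys

namespace Sys
variable {Q : Type} {S : Sys Q} {n m : ℕ} {V V' : Set Q} {p q r s s₁ s₂ : Q} {w w' z u v : ℤ × ℤ}

theorem High.mono {B C : ℕ} (h : High B z) (hC : C ≤ B) : High C z :=
  ⟨le_trans (by exact_mod_cast hC) h.1, le_trans (by exact_mod_cast hC) h.2⟩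

theorem Flat.order {N L B W Δ m k₁ k₂ n₁ n₂ : ℕ} {b d₁ d₂ : ℤ × ℤ}
    (hS : S.Bdd N) (hb : S.Wk m V q b q) (hs₁ : s₁ ∈ V) (hs₂ : s₂ ∈ V)
    (h₁ : S.Wk k₁ ∅ s₁ d₁ s₁) (h₂ : S.Wk k₂ ∅ s₂ d₂ s₂) (hk₁ : k₁ ≤ L) (hk₂ : k₂ ≤ L)
    (hΔ : 0 < Δ) (hΔW : N * (Δ * m) ≤ W) (hL : Δ * m ≤ L) (hB : 2 * (N * L) ≤ B)
    (hu : High (B + W) u) (hv : High (B + W) v) (hu₁ : High (B + W) (u + n₁ • d₁))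
    (huv : v = u + b + Δ • b + n₁ • d₁ + n₂ • d₂) : S.nt.Flat 2 (7 * L) (q, u) (q, v) := by
  obtain ⟨Δ, rfl⟩ : ∃ y, Δ = y + 1 := ⟨Δ - 1, by omega⟩
  have hm : (Δ + 1) * m = Δ * m + m := by ring
  have hbd : ∀ {k e} {V : Set Q}, S.Wk k V q e q → k ≤ (Δ + 1) * m →
      (|e.1| ≤ W ∧ |e.2| ≤ W) ∧ (|(-e).1| ≤ W ∧ |(-e).2| ≤ W) := fun h hk => by
    have := h.bdd hS
    have h1 := (Nat.mul_le_mul_left N hk).trans hΔW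
    zify at h1
    simp only [Prod.fst_neg, Prod.snd_neg, abs_neg]
    exact ⟨⟨this.1.trans h1, this.2.trans h1⟩, ⟨this.1.trans h1, this.2.trans h1⟩⟩
  have z₁ := hu₁.add (hbd hb (by omega)).1 le_rfl
  rw [show u + n₁ • d₁ + b = u + b + n₁ • d₁ by abel] at z₁
  have z₂ := hv.add (hbd (hb.iterate Δ) (by omega)).2 le_rfl
  rw [huv, show u + b + (Δ + 1) • b + n₁ • d₁ + n₂ • d₂ + -(Δ • b) =
    u + b + n₁ • d₁ + b + n₂ • d₂ by rw [succ_nsmul]; abel] at z₂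
  have f₁ := Flat.leg hS hb hs₁ h₁ (by omega) hk₁ hB (hu.mono (by omega)) n₁ z₁
  have f₂ := Flat.leg hS hb hs₂ h₂ (by omega) hk₂ hB z₁ n₂ z₂
  have f₃ := Flat.walk hS (hb.iterate Δ) (L := L) (by omega) (show N * L ≤ B by omega) z₂
  rw [show u + b + n₁ • d₁ + b + n₂ • d₂ + Δ • b = v by rw [huv, succ_nsmul]; abel] at f₃
  exact (f₁.append (f₂.append f₃)).mono le_rfl (by omega)

/-- High configurations in the same state connected by an integer walk are connected by a short
linear path scheme. -/
theorem Flat.big : ∃ D F, Pol D ∧ Pol F ∧ ∀ (Q : Type) [Fintype Q] (S : Sys Q) (x n : ℕ)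
    (V : Set Q) (q : Q) (u v : ℤ × ℤ), Fintype.card Q ≤ x → S.Bdd x → High (D x) u →
    High (D x) v → S.Wk n V q (v - u) q → S.nt.Flat 2 (F x) (q, u) (q, v) := by
  obtain ⟨F, hF, h1⟩ := Wk.two_cycles
  let E : ℕ → ℕ := fun x => x * x
  let R : ℕ → ℕ := fun x => 2 * (x * F x * E x) + 1
  let W : ℕ → ℕ := fun x => x * ((2 * (E x * E x) + 1) * F x)
  let L : ℕ → ℕ := fun x => (2 * (E x * E x) + 1) * F x + 2 * (R x * (2 * E x + 1) * x) + x
  let B : ℕ → ℕ := fun x => 2 * (x * L x)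
  refine ⟨fun x => B x + 4 * W x, fun x => 7 * L x, by simp only [B, W, L, R, E]; fun_prop,
    by simp only [L, R, E]; fun_prop, fun Q _ S x n V q u v hQ hS hu hv h => ?_⟩
  beta_reduce at *
  obtain ⟨m, b, s₁, s₂, k₁, k₂, d₁, d₂, n₁, n₂, hm, hb, hk₁, hk₂, hw₁, hw₂, hw, hdet⟩ :=
    h1 Q S x n ∅ q q _ hQ hS (h.mono (Set.empty_subset V))
  have hs₁ : s₁ ∈ (∅ ∪ {s₁, s₂} : Set Q) := by simp
  have hs₂ : s₂ ∈ (∅ ∪ {s₁, s₂} : Set Q) := by simp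
  have huv : v = u + b + n₁ • d₁ + n₂ • d₂ := by
    rw [show v = u + (v - u) by abel, hw]
    abel
  have bb := hb.bdd hS
  have hbb : (x : ℤ) * m ≤ ((x * F x : ℕ) : ℤ) := by push_cast; gcongr
  have hbE : ∀ {k : ℕ} {s d}, k ≤ x → S.Wk k ∅ s d s → |d.1| ≤ (E x : ℤ) ∧ |d.2| ≤ (E x : ℤ) :=
    fun {k s d} hk hd => by
      have h1 := hd.bdd hS
      have h2 : (x : ℤ) * k ≤ (E x : ℤ) := by simp only [E]; push_cast; gcongr
      exact ⟨h1.1.trans h2, h1.2.trans h2⟩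
  have e₁ := hbE hk₁ hw₁
  have e₂ := hbE hk₂ hw₂
  have hlen : ∀ {a k}, a ≤ R x → k ≤ x → a * k ≤ R x * (2 * E x + 1) * x := fun {a k} h h' => by
    refine (Nat.mul_le_mul h h').trans (Nat.mul_le_mul_right _ ?_)
    exact Nat.le_mul_of_pos_right _ (by omega)
  have hLL : (2 * (E x * E x) + 1) * F x = 2 * (E x * E x) * F x + F x := by ring
  have hLx : L x = (2 * (E x * E x) + 1) * F x + 2 * (R x * (2 * E x + 1) * x) + x := rfl
  -- folding a cycle with few repetitions
  have fold : ∀ (s₁ s₂ : Q) (k₁ k₂ : ℕ) (d₁ d₂ : ℤ × ℤ) (n₁ n₂ : ℕ) (V : Set Q), S.Wk m V q b q →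
      s₁ ∈ V → s₂ ∈ V → k₁ ≤ x → k₂ ≤ x → S.Wk k₁ ∅ s₁ d₁ s₁ → S.Wk k₂ ∅ s₂ d₂ s₂ → n₁ ≤ R x →
      v = u + b + n₁ • d₁ + n₂ • d₂ → S.nt.Flat 2 (7 * L x) (q, u) (q, v) := by
    intro s₁ s₂ k₁ k₂ d₁ d₂ n₁ n₂ V hb hs₁ hs₂ hk₁ hk₂ hw₁ hw₂ hn huv
    have := hlen hn hk₁
    rw [add_assoc u] at huv
    subst huv
    exact (Flat.leg hS (hb.insert hs₁ hw₁ n₁) hs₂ hw₂ (by omega) (by omega) (B := B x) (L := L x)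
      le_rfl (hu.mono (by omega)) n₂ (hv.mono (by omega))).mono (by omega) (by omega)
  rcases hdet with rfl | hdet
  · exact fold s₂ s₁ k₂ k₁ d₂ d₁ 0 n₁ _ hb hs₂ hs₁ hk₂ hk₁ hw₂ hw₁ (by omega) (by rw [huv]; abel)
  -- compensation of the additional rounds
  obtain ⟨Δ, r₁, r₂, hΔ, hΔE, hr₁, hr₂, hbr⟩ : ∃ (Δ : ℕ) (r₁ r₂ : ℤ), 0 < Δ ∧ Δ ≤ 2 * (E x * E x) ∧
      |r₁| ≤ R x ∧ |r₂| ≤ R x ∧ Δ • b = r₁ • d₁ + r₂ • d₂ := by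
    have c₁ := det_le (bb.1.trans hbb) (bb.2.trans hbb) e₂.1 e₂.2
    have c₂ := det_le e₁.1 e₁.2 (bb.1.trans hbb) (bb.2.trans hbb)
    have c₃ := det_le e₁.1 e₁.2 e₂.1 e₂.2
    have c₄ : ((R x : ℕ) : ℤ) = 2 * (((x * F x : ℕ) : ℤ) * E x) + 1 := by simp only [R]; push_cast; ring
    have cram : det d₁ d₂ • b = det b d₂ • d₁ + det d₁ b • d₂ := by
      unfold det
      ext <;> simp <;> ring
    refine ⟨(det d₁ d₂).natAbs, (det d₁ d₂).sign * det b d₂, (det d₁ d₂).sign * det d₁ b,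
      Int.natAbs_pos.2 hdet, ?_, ?_, ?_, ?_⟩
    · zify
      linarith
    · rw [abs_mul, Int.abs_sign_of_ne_zero hdet]
      linarith
    · rw [abs_mul, Int.abs_sign_of_ne_zero hdet]
      linarith
    · rw [mul_smul, mul_smul, ← smul_add, ← cram, ← mul_smul, Int.sign_mul_self_eq_abs,
        ← natCast_zsmul, Int.natCast_natAbs]
  have hΔm : Δ * m ≤ 2 * (E x * E x) * F x := Nat.mul_le_mul hΔE hm
  have hmΔ : (Δ + 1) * m ≤ (2 * (E x * E x) + 1) * F x := Nat.mul_le_mul (by omega) hm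
  have hΔW : x * (Δ * m) ≤ W x := Nat.mul_le_mul_left x (by omega)
  have hm1 : m ≤ Δ * m := Nat.le_mul_of_pos_left _ hΔ
  have hb1 : |b.1| ≤ W x ∧ |b.2| ≤ W x := by
    have : (x : ℤ) * m ≤ W x := by exact_mod_cast (Nat.mul_le_mul_left x hm1).trans hΔW
    exact ⟨bb.1.trans this, bb.2.trans this⟩
  have hb2 : |(Δ • b).1| ≤ W x ∧ |(Δ • b).2| ≤ W x := by
    have := (hb.iterate Δ).bdd hS
    have h' : (x : ℤ) * (Δ * m : ℕ) ≤ W x := by exact_mod_cast hΔW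
    exact ⟨this.1.trans h', this.2.trans h'⟩
  rcases lt_or_ge (n₁ : ℤ) r₁ with h₁ | h₁
  · exact fold s₁ s₂ k₁ k₂ d₁ d₂ n₁ n₂ _ hb hs₁ hs₂ hk₁ hk₂ hw₁ hw₂
      (by have := (abs_le.1 hr₁).2; omega) huv
  rcases lt_or_ge (n₂ : ℤ) r₂ with h₂ | h₂
  · exact fold s₂ s₁ k₂ k₁ d₂ d₁ n₂ n₁ _ hb hs₂ hs₁ hk₂ hk₁ hw₂ hw₁
      (by have := (abs_le.1 hr₂).2; omega) (by rw [huv]; abel)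
  obtain ⟨l₁, hl₁⟩ : ∃ l : ℕ, (l : ℤ) = n₁ - r₁ := ⟨(n₁ - r₁).toNat, by omega⟩
  obtain ⟨l₂, hl₂⟩ : ∃ l : ℕ, (l : ℤ) = n₂ - r₂ := ⟨(n₂ - r₂).toNat, by omega⟩
  have huv' : v = u + b + Δ • b + l₁ • d₁ + l₂ • d₂ := by
    have e₁ : l₁ • d₁ = n₁ • d₁ - r₁ • d₁ := by
      rw [← natCast_zsmul d₁ l₁, hl₁, sub_smul, natCast_zsmul]
    have e₂ : l₂ • d₂ = n₂ • d₂ - r₂ • d₂ := by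
      rw [← natCast_zsmul d₂ l₂, hl₂, sub_smul, natCast_zsmul]
    rw [huv, hbr, e₁, e₂]
    abel
  have huv'' : v = u + b + Δ • b + l₂ • d₂ + l₁ • d₁ := by rw [huv']; abel
  have hu' : High (B x + W x) u := hu.mono (by omega)
  have hv' : High (B x + W x) v := hv.mono (by omega)
  by_cases o₁ : High (B x + W x) (u + l₁ • d₁)
  · exact Flat.order hS hb hs₁ hs₂ hw₁ hw₂ (by omega) (by omega) hΔ hΔW (by omega) le_rfl hu' hv' o₁
      huv'
  by_cases o₂ : High (B x + W x) (u + l₂ • d₂)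
  · exact Flat.order hS hb hs₂ hs₁ hw₂ hw₁ (by omega) (by omega) hΔ hΔW (by omega) le_rfl hu' hv' o₂
      huv''
  have sgn : ∀ (l : ℕ) (y : ℤ), (l : ℤ) * y < 0 → y < 0 := fun l y h => by
    by_contra! hy
    have : 0 ≤ (l : ℤ) * y := by positivity
    omega
  have sgn' : ∀ (l : ℕ) (y : ℤ), 0 < (l : ℤ) * y → 0 < y := fun l y h => by
    by_contra! hy
    have : (l : ℤ) * y ≤ 0 := mul_nonpos_of_nonneg_of_nonpos (by omega) hy
    omega
  have hv1 := congrArg Prod.fst huv'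
  have hv2 := congrArg Prod.snd huv'
  have sm : ∀ (l : ℕ) (d : ℤ × ℤ), (l • d).1 = l * d.1 ∧ (l • d).2 = l * d.2 := fun l d => by simp
  simp only [Prod.fst_add, Prod.snd_add, (sm l₁ d₁).1, (sm l₁ d₁).2, (sm l₂ d₂).1,
    (sm l₂ d₂).2] at hv1 hv2
  simp only [High, Prod.fst_add, Prod.snd_add, (sm l₁ d₁).1, (sm l₁ d₁).2, (sm l₂ d₂).1,
    (sm l₂ d₂).2] at o₁ o₂
  simp only [abs_le] at hb1 hb2
  have hu1 := hu.1
  have hu2 := hu.2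
  have hvv1 := hv.1
  have hvv2 := hv.2
  have hLm : (Δ + 1) * m + 2 * (R x * (2 * E x + 1) * x) + x ≤ L x := by omega
  by_cases c : u.1 + l₁ * d₁.1 < (B x + W x : ℕ)
  · have a1 := sgn l₁ d₁.1 (by omega)
    have a2 := sgn' l₂ d₂.1 (by omega)
    have a3 := sgn l₂ d₂.2 (by omega)
    have a4 := sgn' l₁ d₁.2 (by omega)
    exact (Flat.cross hS hb hs₁ hs₂ hw₁ hw₂ hk₁ hk₂ e₁ e₂ ⟨a1, a4⟩ ⟨a2, a3⟩ hdet hΔ (Nat.succ_pos _)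
      hr₁ hr₂ hbr hΔW hLm le_rfl hu' hv' huv').mono le_rfl (by omega)
  · have a1 := sgn l₁ d₁.2 (by omega)
    have a2 := sgn' l₂ d₂.2 (by omega)
    have a3 := sgn l₂ d₂.1 (by omega)
    have a4 := sgn' l₁ d₁.1 (by omega)
    exact (Flat.cross hS hb hs₂ hs₁ hw₂ hw₁ hk₂ hk₁ e₂ e₁ ⟨a3, a2⟩ ⟨a4, a1⟩
      (by unfold det at hdet ⊢; intro h; apply hdet; linarith) hΔ (Nat.succ_pos _)
      hr₂ hr₁ (by rw [hbr]; abel) hΔW hLm le_rfl hu' hv' huv'').mono le_rfl (by omega)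

end Sys

section
variable {X : Type} {r : X → X → Prop} {P : X → Prop} {n : ℕ} {x y : X}

/-- The steps that avoid `P`. -/
def Off (r : X → X → Prop) (P : X → Prop) (x y : X) : Prop := r x y ∧ ¬ P x ∧ ¬ P y

/-- `u` is the first element of `P` on a chain of length `k` from `x`. -/
def Ent (r : X → X → Prop) (P : X → Prop) (k : ℕ) (x u : X) : Prop :=
  (k = 0 ∧ x = u) ∨ ∃ j b, k = j + 1 ∧ ¬ P x ∧ ¬ P b ∧ Ch (Off r P) j x b ∧ r b u

/-- A chain between elements of `P` without inner elements of `P`. -/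
def Hop (r : X → X → Prop) (P : X → Prop) (x y : X) : Prop :=
  P x ∧ P y ∧ ∃ z k, r x z ∧ Ent r P k z y

theorem Ch.first (h : Ch r n x y) : (Ch (Off r P) n x y ∧ ¬ P x ∧ ¬ P y) ∨
    ∃ k l u, k + l = n ∧ P u ∧ Ent r P k x u ∧ Ch r l u y := by
  induction n generalizing x with
  | zero =>
    obtain rfl := h.zero
    by_cases hx : P x
    · exact Or.inr ⟨0, 0, x, rfl, hx, Or.inl ⟨rfl, rfl⟩, Ch.nil _⟩
    · exact Or.inl ⟨Ch.nil _, hx, hx⟩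
  | succ n ih =>
    by_cases hx : P x
    · exact Or.inr ⟨0, n + 1, x, by omega, hx, Or.inl ⟨rfl, rfl⟩, h⟩
    obtain ⟨z, hz, h⟩ := h.succ
    rcases ih h with ⟨h1, h2, h3⟩ | ⟨k, l, u, hkl, hu, he, h1⟩
    · exact Or.inl ⟨Ch.cons ⟨hz, hx, h2⟩ h1, hx, h3⟩
    · refine Or.inr ⟨k + 1, l, u, by omega, hu, Or.inr ?_, h1⟩
      rcases he with ⟨rfl, rfl⟩ | ⟨j, b, rfl, h2, h3, h4, h5⟩
      · exact ⟨0, x, rfl, hx, hx, Ch.nil _, hz⟩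
      · exact ⟨j + 1, b, rfl, hx, h3, Ch.cons ⟨hz, hx, h2⟩ h4, h5⟩

theorem Ch.last (h : Ch r n x y) : (Ch (Off r P) n x y ∧ ¬ P x ∧ ¬ P y) ∨
    ∃ k l u, k + l = n ∧ P u ∧ Ch r k x u ∧
      ((l = 0 ∧ u = y) ∨ ∃ j b, l = j + 1 ∧ ¬ P b ∧ ¬ P y ∧ r u b ∧ Ch (Off r P) j b y) := by
  rcases Ch.first (P := P) (h.rev (r' := fun a b => r b a) fun _ _ h => h) with
    ⟨h1, h2, h3⟩ | ⟨k, l, u, hkl, hu, he, h1⟩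
  · exact Or.inl ⟨h1.rev fun _ _ h => ⟨h.1, h.2.2, h.2.1⟩, h3, h2⟩
  · refine Or.inr ⟨l, k, u, by omega, hu, h1.rev fun _ _ h => h, ?_⟩
    rcases he with ⟨rfl, rfl⟩ | ⟨j, b, rfl, h2, h3, h4, h5⟩
    · exact Or.inl ⟨rfl, rfl⟩
    · exact Or.inr ⟨j, b, rfl, h3, h2, h5, h4.rev fun _ _ h => ⟨h.1, h.2.2, h.2.1⟩⟩

theorem Ch.hops (hx : P x) (hy : P y) (h : Ch r n x y) : ∃ m, Ch (Hop r P) m x y := by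
  induction n using Nat.strong_induction_on generalizing x with
  | _ n ih =>
    rcases n with - | n
    · exact ⟨0, h.zero ▸ Ch.nil _⟩
    obtain ⟨z, hz, h⟩ := h.succ
    rcases Ch.first (P := P) h with ⟨-, -, h3⟩ | ⟨k, l, u, hkl, hu, he, h1⟩
    · exact absurd hy h3
    · obtain ⟨m, hm⟩ := ih l (by omega) hu h1
      exact ⟨m + 1, Ch.cons ⟨hx, hu, z, k, hz, he⟩ hm⟩

end
namespace Sys
variable {Q : Type} {S : Sys Q} {N D n : ℕ}

/-- The configurations of the quadrant with at least one small counter. -/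
def band (D : ℕ) : Set (ℤ × ℤ) := {z | z ∈ quad ∧ (z.1 ≤ D ∨ z.2 ≤ D)}

def InSquare (M : ℕ) (c : Q × ℤ × ℤ) : Prop := c.2.1 ≤ M ∧ c.2.2 ≤ M

/-- Runs in the band outside a large square stay in one of the two arms. -/
theorem ch_arm {c c' : Q × ℤ × ℤ} (hS : S.Bdd N)
    (h : Ch (Off (S.nt.St (band D)) (InSquare (D + N))) n c c') :
    Ch (S.nt.St (strip D)) n c c' ∨ Ch (S.swap.St (strip D)) n (flip c) (flip c') := by
  rcases n with - | n
  · exact Or.inl (h.zero ▸ Ch.nil _)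
  obtain ⟨f, rfl, rfl, hf⟩ := h
  have key : ∀ i < n + 1, ∀ a b : ℤ × ℤ, (a = (f i).2 ∧ b = (f (i + 1)).2 ∨
      a = Prod.swap (f i).2 ∧ b = Prod.swap (f (i + 1)).2) → a.1 ≤ D → b.1 ≤ D := by
    intro i hi a b hab h1
    obtain ⟨h2, h3, h4⟩ := hf i hi
    have h5 := h2.bdd hS.nt
    obtain ⟨-, h6, h7⟩ := h2
    simp only [abs_le, InSquare, band, Set.mem_ofPred_eq, not_and_or, not_le] at *
    push_cast at h3 h4
    rcases hab with ⟨rfl, rfl⟩ | ⟨rfl, rfl⟩ <;> (try simp only [Prod.fst_swap] at *) <;>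
      omega
  have main : ∀ g : ℤ × ℤ → ℤ × ℤ, (g = id ∨ g = Prod.swap) → (g (f 0).2).1 ≤ D →
      ∀ i ≤ n + 1, (g (f i).2).1 ≤ D := fun g hg h0 i hi => by
    induction i with
    | zero => exact h0
    | succ i ih =>
      refine key i hi _ _ ?_ (ih (by omega))
      rcases hg with rfl | rfl
      · exact Or.inl ⟨rfl, rfl⟩
      · exact Or.inr ⟨rfl, rfl⟩
  have hq : ∀ i ≤ n + 1, (f i).2 ∈ quad := fun i hi => by
    rcases Nat.lt_or_ge i (n + 1) with h | h
    · exact (hf i h).1.2.1.1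
    · obtain rfl : i = n + 1 := by omega
      exact (hf n (by omega)).1.2.2.1
  rcases (hf 0 (by omega)).1.2.1.2 with h0 | h0
  · left
    have := main id (Or.inl rfl) h0
    exact ⟨f, rfl, rfl, fun i hi => ⟨(hf i hi).1.1,
      ⟨⟨(hq i hi.le).1, this i hi.le⟩, (hq i hi.le).2⟩,
      ⟨⟨(hq _ hi).1, this _ hi⟩, (hq _ hi).2⟩⟩⟩
  · right
    have := main Prod.swap (Or.inr rfl) h0
    exact ⟨fun i => flip (f i), rfl, rfl, fun i hi => ⟨(hf i hi).1.swap.1,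
      ⟨⟨(hq i hi.le).2, this i hi.le⟩, (hq i hi.le).1⟩,
      ⟨⟨(hq _ hi).2, this _ hi⟩, (hq _ hi).1⟩⟩⟩

theorem band_quad : band D ⊆ quad := fun _ h => h.1

theorem band_flat : ∃ F, Pol F ∧ ∀ (Q : Type) [Fintype Q] (S : Sys Q) (x D n : ℕ)
    (c c' : Q × ℤ × ℤ), Fintype.card Q ≤ x → S.Bdd x → D ≤ x →
    Ch (S.nt.St (band D)) n c c' → S.nt.Flat 2 (F x) c c' := by
  classical
  obtain ⟨F₁, hF₁, flat₁⟩ := strip_flat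
  obtain ⟨F₂, hF₂, low₁⟩ := strip_low
  let G : ℕ → ℕ := fun x => x * ((2 * x + 1) * (2 * x + 1)) * (F₂ (3 * x) + 2)
  refine ⟨fun x => 2 * (F₁ x + 1) + G x, by simp only [G]; fun_prop,
    fun Q _ S x D n c c' hQ hS hD h => ?_⟩
  beta_reduce
  have arm : ∀ {n c c'}, Ch (Off (S.nt.St (band D)) (InSquare (D + x))) n c c' →
      S.nt.Flat 1 (F₁ x) c c' := fun {n c c'} h => by
    rcases ch_arm hS h with h | h
    · exact flat₁ Q S x D n _ _ hQ hS hD h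
    · exact Flat.unswap (flat₁ Q S.swap x D n _ _ hQ hS.swap hD h)
  have armlow : ∀ {n c c'}, Ch (Off (S.nt.St (band D)) (InSquare (D + x))) n c c' →
      (c.2.1 ≤ (3 * x : ℕ) ∧ c.2.2 ≤ (3 * x : ℕ)) → (c'.2.1 ≤ (3 * x : ℕ) ∧ c'.2.2 ≤ (3 * x : ℕ)) →
      Cle (S.nt.St quad) (F₂ (3 * x)) c c' := fun {n c c'} h hc hc' => by
    rcases ch_arm hS h with h | h
    · exact (low₁ Q S (3 * x) D n _ _ (by omega) (hS.mono (by omega)) (by omega) hc.2 hc'.2 h).map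
        id fun _ _ h => h.mono strip_quad
    · exact (low₁ Q S.swap (3 * x) D n _ _ (by omega) (hS.swap.mono (by omega)) (by omega)
        hc.1 hc'.1 h).map flip fun _ _ h => (h.mono strip_quad).unswap_quad
  have step : ∀ {c c'}, S.nt.St (band D) c c' → S.nt.St quad c c' := fun h => h.mono band_quad
  have mid : ∀ {n c c'}, InSquare (D + x) c → InSquare (D + x) c' →
      Ch (S.nt.St (band D)) n c c' → Cle (S.nt.St quad) (G x) c c' := fun {n c c'} hc hc' h => by
    obtain ⟨m, h⟩ := Ch.hops hc hc' h
    obtain ⟨k, hk, h⟩ := h.short (Finset.univ ×ˢ Finset.Icc (0 : ℤ) (2 * x) ×ˢ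
        Finset.Icc (0 : ℤ) (2 * x)) (by
      rintro a b ⟨h1, h2, z, k, h3, h4⟩
      have hb : b.2 ∈ quad := by
        rcases h4 with ⟨-, rfl⟩ | ⟨j, b', -, -, -, -, h⟩
        · exact h3.2.2.1
        · exact h.2.2.1
      obtain ⟨hb1, hb2⟩ := hb
      obtain ⟨h2, h2'⟩ := h2
      simp only [Finset.mem_product, Finset.mem_univ, Finset.mem_Icc, true_and]
      push_cast at h2 h2'
      omega)
    refine (h.flatten (L := F₂ (3 * x) + 2) ?_).mono ?_
    · rintro a b ⟨h1, h2, z, k, h3, h4⟩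
      rcases h4 with ⟨-, rfl⟩ | ⟨j, b', -, h5, h6, h7, h8⟩
      · exact (Ch.single (step h3)).cle.mono (by omega)
      · have b1 := h3.bdd hS.nt
        have b2 := h8.bdd hS.nt
        obtain ⟨h1, h1'⟩ := h1
        obtain ⟨h2, h2'⟩ := h2
        simp only [abs_le] at b1 b2
        push_cast at h1 h1' h2 h2'
        have := armlow h7 (by constructor <;> push_cast <;> omega)
          (by constructor <;> push_cast <;> omega)
        exact ((Ch.single (step h3)).cle.append (this.append (Ch.single (step h8)).cle)).mono
          (by omega)
    · simp only [G]
      gcongr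
      refine hk.trans ?_
      simp only [Finset.card_product, Finset.card_univ, Int.card_Icc]
      gcongr <;> omega
  rcases Ch.first (P := InSquare (D + x)) h with ⟨h, -, -⟩ | ⟨k, l, u, -, hu, he, h⟩
  · exact (arm h).mono (by omega) (by omega)
  rcases Ch.last (P := InSquare (D + x)) h with ⟨-, h, -⟩ | ⟨k', l', v, -, hv, h, he'⟩
  · exact absurd hu h
  have f₁ : S.nt.Flat 1 (F₁ x + 1) c u := by
    rcases he with ⟨-, rfl⟩ | ⟨j, b, -, -, -, h1, h2⟩
    · exact (Flat.path (Ch.nil _)).mono (by omega) (by omega)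
    · exact (arm h1).append (.path (Ch.single (step h2)))
  have f₂ : S.nt.Flat 1 (1 + F₁ x) v c' := by
    rcases he' with ⟨-, rfl⟩ | ⟨j, b, -, -, -, h1, h2⟩
    · exact (Flat.path (Ch.nil _)).mono (by omega) (by omega)
    · exact (Flat.path (Ch.single (step h1))).append (arm h2)
  exact (f₁.append ((Flat.ofCle (mid hu hv h)).append f₂)).mono (by omega) (by omega)

/-- Runs without zero tests are captured by short linear path schemes. -/
theorem nt_flat : ∃ F, Pol F ∧ ∀ (Q : Type) [Fintype Q] (S : Sys Q) (x n : ℕ)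
    (c c' : Q × ℤ × ℤ), Fintype.card Q ≤ x → S.Bdd x →
    Ch (S.nt.St quad) n c c' → S.nt.Flat (4 * Fintype.card Q + 2) (F x) c c' := by
  classical
  obtain ⟨D, F₁, hD, hF₁, big⟩ := Flat.big
  obtain ⟨F₂, hF₂, bnd⟩ := band_flat
  refine ⟨fun x => (F₁ x + F₂ (x + D x) + 2) * x + F₂ (x + D x), by fun_prop,
    fun Q _ S x n c c' hQ hS h => ?_⟩
  let r : Finset Q → Q × ℤ × ℤ → Q × ℤ × ℤ → Prop := fun T c c' =>
    S.nt.St quad c c' ∧ (High (D x) c.2 → c.1 ∈ T) ∧ (High (D x) c'.2 → c'.1 ∈ T)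
  have bnd' : ∀ {n c c'}, Ch (Off (S.nt.St quad) fun c => High (D x) c.2) n c c' →
      S.nt.Flat 2 (F₂ (x + D x)) c c' := fun {n c c'} h =>
    bnd Q S (x + D x) (D x) n c c' (by omega) (hS.mono (by omega)) (by omega) (h.mono fun a b h => by
      obtain ⟨h1, h2, h3⟩ := h
      simp only [High, not_and_or, not_le] at h2 h3
      refine ⟨h1.1, ⟨h1.2.1, ?_⟩, h1.2.2, ?_⟩
      · exact h2.imp le_of_lt le_of_lt
      · exact h3.imp le_of_lt le_of_lt)
  have main : ∀ k (T : Finset Q), T.card = k → ∀ n c c', Ch (r T) n c c' →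
      S.nt.Flat (4 * k + 2) ((F₁ x + F₂ (x + D x) + 2) * k + F₂ (x + D x)) c c' := by
    intro k
    induction k with
    | zero =>
      intro T hT n c c' h
      obtain rfl := Finset.card_eq_zero.1 hT
      refine (bnd' (h.mono fun a b h => ⟨h.1, fun h' => ?_, fun h' => ?_⟩)).mono (by omega) (by omega)
      · exact absurd (h.2.1 h') (by simp)
      · exact absurd (h.2.2 h') (by simp)
    | succ k ih =>
      intro T hT n c c' h
      rcases Ch.first (P := fun c => High (D x) c.2) h with ⟨h, -, -⟩ | ⟨a, l, u, -, hu, he, h⟩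
      · exact (bnd' (h.mono fun a b h => ⟨h.1.1, h.2⟩)).mono (by omega) (by nlinarith)
      have f₁ : S.nt.Flat 2 (F₂ (x + D x) + 1) c u := by
        rcases he with ⟨-, rfl⟩ | ⟨j, b, -, -, -, h1, h2⟩
        · exact (Flat.path (Ch.nil _)).mono (by omega) (by omega)
        · exact (bnd' (h1.mono fun a b h => ⟨h.1.1, h.2⟩)).append (.path (Ch.single h2.1))
      rcases Ch.last (P := fun c => High (D x) c.2 ∧ c.1 = u.1) h with
        ⟨-, h, -⟩ | ⟨b, l', v, -, ⟨hv, hvu⟩, h, he'⟩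
      · exact absurd ⟨hu, rfl⟩ h
      have f₂ : S.nt.Flat 2 (F₁ x) u v := by
        have := Wk.ofCh' (S := S) (h.mono fun a b h => h.1)
        rw [hvu] at this
        have := big Q S x b ∅ u.1 u.2 v.2 hQ hS hu hv this
        rwa [← hvu, Prod.mk.eta, hvu, Prod.mk.eta] at this
      rcases he' with ⟨-, rfl⟩ | ⟨j, w, -, -, -, h1, h2⟩
      · exact (f₁.append f₂).mono (by omega) (by nlinarith)
      · have huT : u.1 ∈ T := hvu ▸ h1.2.1 hv
        have f₃ := ih (T.erase u.1) (by rw [Finset.card_erase_of_mem huT]; omega) j w c'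
          (h2.mono fun a b h => ⟨h.1.1, fun h' => Finset.mem_erase.2 ⟨fun e => h.2.1 ⟨h', e⟩,
            h.1.2.1 h'⟩, fun h' => Finset.mem_erase.2 ⟨fun e => h.2.2 ⟨h', e⟩, h.1.2.2 h'⟩⟩)
        exact (f₁.append (f₂.append ((Flat.path (Ch.single h1.1)).append f₃))).mono (by omega)
          (by nlinarith)
  have h1 := main _ Finset.univ rfl n c c' (h.mono fun a b h => ⟨h, fun _ => Finset.mem_univ _,
    fun _ => Finset.mem_univ _⟩)
  rw [Finset.card_univ] at h1
  exact h1.mono le_rfl (Nat.add_le_add_right (Nat.mul_le_mul_left _ hQ) _)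

end Sys

theorem LevelPair.congr {α β : Type} {h : ℕ → ℤ} {g : ℕ → α} {g' : ℕ → β} {n : ℕ} {N l l' : ℤ}
    {t₁ t₂ t₃ t₄ : ℕ} (H : LevelPair h g n N l l' t₁ t₂ t₃ t₄)
    (hg : ∀ i j, g i = g j → g' i = g' j) : LevelPair h g' n N l l' t₁ t₂ t₃ t₄ :=
  { H with g12 := hg _ _ H.g12, g34 := hg _ _ H.g34 }

namespace Sys
variable {Q : Type} {S : Sys Q} {R : Set (ℤ × ℤ)} {N n m : ℕ} {c c' : Q × ℤ × ℤ}
variable {V V' : Set Q} {p q s s' : Q} {w z u v : ℤ × ℤ}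

/-- The behaviour of the first counter. -/
def hE (S : Sys Q) : Q → ℤ → Q → Prop := fun p a q => ∃ b, S.A p a b q

theorem hE_bdd (hS : S.Bdd N) : ∀ p a q, S.hE p a q → |a| ≤ N := fun _ _ _ ⟨_, h⟩ => (hS _ _ _ _ h).1

theorem St.toOC {I : Set ℤ} (h : S.St {z | z.1 ∈ I} c c') :
    OC S.hE S.Z I (c.1, c.2.1) (c'.1, c'.2.1) :=
  ⟨h.1.imp (fun h => ⟨_, h⟩) fun h => ⟨h.1, h.2.1, h.2.2.1⟩, h.2.1, h.2.2⟩

theorem ch_ofOC {I : Set ℤ} {d d' : Q × ℤ} (h : Ch (OC S.hE S.Z I) n d d') (y : ℤ) :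
    ∃ y', Ch (S.St {z | z.1 ∈ I}) n (d.1, d.2, y) (d'.1, d'.2, y') := by
  obtain ⟨c', h1, h2, h3⟩ := Ch.lift (r' := S.St {z | z.1 ∈ I})
    (P := fun (d : Q × ℤ) (c : Q × ℤ × ℤ) => c.1 = d.1 ∧ c.2.1 = d.2) (fun a b a' h hP => by
      obtain ⟨s, x, y⟩ := a'
      obtain ⟨rfl, rfl⟩ := hP
      obtain ⟨h, h1, h2⟩ := h
      rcases h with ⟨b', h⟩ | ⟨h, h3, h4⟩
      · refine ⟨(b.1, b.2, y + b'), ⟨Or.inl ?_, h1, h2⟩, rfl, rfl⟩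
        simpa using h
      · exact ⟨(b.1, b.2, y), ⟨Or.inr ⟨h, h3, h4, rfl⟩, h1, h2⟩, rfl, rfl⟩)
    h (x' := (d.1, d.2, y)) ⟨rfl, rfl⟩
  refine ⟨c'.2.2, ?_⟩
  rwa [← h2, ← h3]

theorem rlx_low : ∃ F, Pol F ∧ ∀ (Q : Type) [Fintype Q] (S : Sys Q) (x n : ℕ) (c c' : Q × ℤ × ℤ),
    Fintype.card Q ≤ x → S.Bdd x → c.2.1 ≤ x → c'.2.1 ≤ x → Ch (S.St half) n c c' →
    ∃ y, Cle (S.St half) (F x) c (c'.1, c'.2.1, y) := by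
  obtain ⟨F, hF, h1⟩ := OC.low
  refine ⟨F, hF, fun Q _ S x n c c' hQ hS hc hc' h => ?_⟩
  obtain ⟨k, hk, h2⟩ := h1 Q S.hE S.Z x n (c.1, c.2.1) (c'.1, c'.2.1) hQ (hE_bdd hS) hc hc'
    (h.map _ fun _ _ h => St.toOC (I := Set.Ici 0) h)
  obtain ⟨y, h3⟩ := ch_ofOC h2 c.2.2
  exact ⟨y, k, hk, h3⟩

/-- The effect on the first counter is achieved by short walks. -/
theorem Wk.near : ∃ F, Pol F ∧ ∀ (Q : Type) [Fintype Q] (S : Sys Q) (x n : ℕ) (V : Set Q)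
    (p q : Q) (w : ℤ × ℤ), Fintype.card Q ≤ x → S.Bdd x → |w.1| ≤ x → S.Wk n V p w q →
    ∃ m y, m ≤ F x ∧ S.Wk m ∅ p (w.1, y) q := by
  obtain ⟨F, hF, h1⟩ := OC.near
  refine ⟨F, hF, fun Q _ S x n V p q w hQ hS hw h => ?_⟩
  have h2 : Ch (OC S.nt.hE S.nt.Z Set.univ) n (p, 0) (q, w.1) := by
    simpa using (h.toCh 0).map _ fun _ _ h => St.toOC (I := Set.univ) (h.mono fun _ _ => trivial)
  obtain ⟨m, hm, h3⟩ := h1 Q S.hE Set.univ x n (p, 0) (q, w.1) hQ (hE_bdd hS) (by simpa using hw) h2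
  obtain ⟨y, h4⟩ := ch_ofOC (S := S.nt) h3 0
  exact ⟨m, y, hm, by simpa using Wk.ofCh' h4⟩

theorem Wk.toHalf (hS : S.Bdd N) (h : S.Wk n V p w q) (h1 : N * n ≤ z.1) :
    Ch (S.nt.St half) n (p, z) (q, z + w) := by
  have h2 := h.toCh_quad hS (z := (z.1, ((N * n : ℕ) : ℤ))) h1 (by simp)
  have h3 := h2.map (fun c : Q × ℤ × ℤ => (c.1, c.2.1, c.2.2 + (z.2 - ((N * n : ℕ) : ℤ))))
    fun a b h => h.vshift (R' := half) _ h.2.1.1 h.2.2.1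
  have e : ∀ a : ℤ, ((N * n : ℕ) : ℤ) + a + (z.2 - ((N * n : ℕ) : ℤ)) = z.2 + a := fun a => by ring
  simp only [Prod.fst_add, Prod.snd_add, e, add_sub_cancel] at h3
  exact h3

theorem Wk.iterHalf (hS : S.Bdd N) (h : S.Wk n V s w s) (k : ℕ) (h1 : N * n ≤ z.1)
    (h2 : N * n ≤ z.1 + k * w.1) : Ch (S.nt.St half) (k * n) (s, z) (s, z + k • w) := by
  have key : ∀ i ≤ k, (N : ℤ) * n ≤ z.1 + i * w.1 := fun i hi => by
    rcases le_total 0 w.1 with h0 | h0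
    · have : 0 ≤ (i : ℤ) * w.1 := by positivity
      linarith
    · have : (k : ℤ) * w.1 ≤ i * w.1 :=
        mul_le_mul_of_nonpos_right (by exact_mod_cast hi) h0
      linarith
  clear h2
  induction k with
  | zero => simpa using Ch.nil _
  | succ k ih =>
    have := h.toHalf hS (z := z + k • w) (by simpa using key k (by omega))
    rw [add_mul, one_mul, succ_nsmul, ← add_assoc]
    exact (ih fun i hi => key i (by omega)).append this

theorem seg_nt {f : ℕ → Q × ℤ × ℤ} (hf : ∀ k < n, S.St R (f k) (f (k + 1))) {i j : ℕ} {l : ℤ}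
    (hij : i ≤ j) (hj : j ≤ n) (hl : 1 ≤ l) (ge : ∀ k, i ≤ k → k ≤ j → l ≤ (f k).2.1) :
    Ch (S.nt.St {z | l ≤ z.1 ∧ z ∈ R}) (j - i) (f i) (f j) :=
  Ch.seg' (fun k hk hk' => ⟨Or.inl ((hf k (by omega)).1.resolve_right fun h => by
    have := ge k hk hk'.le
    omega), ⟨ge k hk hk'.le, (hf k (by omega)).2.1⟩,
      ⟨ge _ (by omega) (by omega), (hf k (by omega)).2.2⟩⟩) hij

theorem ch_shift_half {l : ℤ} (h : Ch (S.nt.St {z | l ≤ z.1 ∧ z ∈ R}) n c c') (k e : ℤ)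
    (hk : 0 ≤ l + k) :
    Ch (S.nt.St half) n (c.1, c.2.1 + k, c.2.2 + e) (c'.1, c'.2.1 + k, c'.2.2 + e) :=
  h.map (fun c : Q × ℤ × ℤ => (c.1, c.2.1 + k, c.2.2 + e)) fun a b h => h.shift _ _
    (show 0 ≤ a.2.1 + k by linarith [h.2.1.1]) (show 0 ≤ b.2.1 + k by linarith [h.2.2.1])

theorem ch_vshift_half (h : Ch (S.St half) n c c') (e : ℤ) :
    Ch (S.St half) n (c.1, c.2.1, c.2.2 + e) (c'.1, c'.2.1, c'.2.2 + e) :=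
  h.map (fun c : Q × ℤ × ℤ => (c.1, c.2.1, c.2.2 + e)) fun _ _ h => h.vshift _ h.2.1 h.2.2

/-- The two segments of a pair of levels can be repeated simultaneously. -/
theorem pair_repeat {f : ℕ → Q × ℤ × ℤ} (hf : ∀ k < n, S.St half (f k) (f (k + 1))) {M l l' : ℤ}
    {t₁ t₂ t₃ t₄ : ℕ} (H : LevelPair (fun i => (f i).2.1) (fun i => (f i).1) n M l l' t₁ t₂ t₃ t₄)
    (hl : 1 ≤ l) (k : ℕ) :
    Ch (S.St half) (t₁ + k * (t₂ - t₁) + (t₃ - t₂) + k * (t₄ - t₃) + (n - t₄)) (f 0)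
      ((f n).1, (f n).2.1, (f n).2.2 +
        (k - 1) * ((f t₂).2.2 - (f t₁).2.2 + ((f t₄).2.2 - (f t₃).2.2))) := by
  obtain ⟨lt, h12, h23, h34, h4, e12, e34, g12, g34, ge, ge', -, -⟩ := H
  have s₁ := Ch.seg hf (Nat.zero_le t₁) (by omega)
  have s₂ := seg_nt hf h12.le (by omega) hl fun k h1 h2 => ge k h1 (by omega)
  have s₃ := seg_nt hf h23 (by omega) (by omega) ge'
  have s₄ := seg_nt hf h34.le (by omega) hl fun k h1 h2 => ge k (by omega) h2
  have s₅ := Ch.seg hf h4 le_rfl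
  have up : ∀ k : ℕ, Ch (S.St half) (k * (t₂ - t₁)) (f t₁) ((f t₁).1, (f t₁).2.1 + k * (l' - l),
      (f t₁).2.2 + k * ((f t₂).2.2 - (f t₁).2.2)) := fun k => by
    induction k with
    | zero => simpa using Ch.nil _
    | succ k ih =>
      have h1 := ch_shift_half s₂ (k * (l' - l)) (k * ((f t₂).2.2 - (f t₁).2.2))
        (by have : 0 ≤ k * (l' - l) := mul_nonneg (by omega) (by omega)
            omega)
      rw [← g12, e12] at h1
      have h2 := ih.append (ch_ofNt h1)
      convert h2 using 3
      · ring
      · push_cast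
        ring
      · push_cast
        ring
  have down : ∀ (k : ℕ) (y : ℤ), Ch (S.St half) (k * (t₄ - t₃)) ((f t₄).1,
      (f t₄).2.1 + k * (l' - l), y) ((f t₄).1, (f t₄).2.1, y + k * ((f t₄).2.2 - (f t₃).2.2)) :=
    fun k => by
    induction k with
    | zero => exact fun y => by simpa using Ch.nil _
    | succ k ih =>
      intro y
      have h1 := ch_shift_half s₄ (k * (l' - l)) (y - (f t₃).2.2)
        (by have : 0 ≤ k * (l' - l) := mul_nonneg (by omega) (by omega)
            omega)
      rw [g34, e34] at h1
      have h2 := (ch_ofNt h1).append (ih _)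
      convert h2 using 3
      · ring
      · push_cast
        ring
      · ring
      · push_cast
        ring
  have s₃' := ch_shift_half s₃ ((k - 1) * (l' - l)) ((k - 1) * ((f t₂).2.2 - (f t₁).2.2))
    (by have : 0 ≤ k * (l' - l) := mul_nonneg (by omega) (by omega)
        linarith)
  have s₅' := ch_vshift_half s₅ ((k - 1) * ((f t₂).2.2 - (f t₁).2.2 + ((f t₄).2.2 - (f t₃).2.2)))
  rw [Nat.sub_zero] at s₁
  rw [← g12, e12, g34, e34] at s₃'
  have a₁ := up k
  have a₂ := down k ((f t₃).2.2 + (k - 1) * ((f t₂).2.2 - (f t₁).2.2))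
  have r₁ : (f t₁).2.1 + (l' - l) + (k - 1) * (l' - l) = (f t₁).2.1 + k * (l' - l) := by ring
  have r₂ : (f t₂).2.2 + (k - 1) * ((f t₂).2.2 - (f t₁).2.2) =
    (f t₁).2.2 + k * ((f t₂).2.2 - (f t₁).2.2) := by ring
  have r₃ : (f t₄).2.1 + (l' - l) + (k - 1) * (l' - l) = (f t₄).2.1 + k * (l' - l) := by ring
  rw [r₁, r₂, r₃] at s₃'
  have r₄ : (f t₃).2.2 + (k - 1) * ((f t₂).2.2 - (f t₁).2.2) + k * ((f t₄).2.2 - (f t₃).2.2) =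
    (f t₄).2.2 + (k - 1) * ((f t₂).2.2 - (f t₁).2.2 + ((f t₄).2.2 - (f t₃).2.2)) := by ring
  rw [r₄] at a₂
  exact (((s₁.append a₁).append (ch_ofNt s₃')).append a₂).append s₅'

/-- A pair of cycles with opposite effects on the first counter and positive total effect on
the second counter yields short such cycles. -/
theorem Wk.pumpPair : ∃ F, Pol F ∧ ∀ (Q : Type) [Fintype Q] (S : Sys Q) (x n m : ℕ)
    (V V' : Set Q) (s s' : Q) (u v : ℤ × ℤ), Fintype.card Q ≤ x → S.Bdd x → S.Wk n V s u s →
    S.Wk m V' s' v s' → 0 < u.1 → u.1 ≤ x → v.1 = - u.1 → 0 < u.2 + v.2 →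
    ∃ n' m' u' v', n' ≤ F x ∧ m' ≤ F x ∧ S.Wk n' ∅ s u' s ∧ S.Wk m' ∅ s' v' s' ∧ 0 < u'.1 ∧
      v'.1 < 0 ∧ 0 < u'.1 * v'.2 - u'.2 * v'.1 := by
  obtain ⟨F₁, hF₁, near⟩ := Wk.near
  obtain ⟨F₂, hF₂, pos⟩ := Wk.posCycle
  refine ⟨fun x => F₂ (2 * (x * F₁ x) + 2 * x + 1), by fun_prop,
    fun Q _ S x n m V V' s s' u v hQ hS hu hv hu1 hux hvu huv => ?_⟩
  beta_reduce
  set B := x * F₁ x with hB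
  have low : ∀ {n V s u}, S.Wk n V s u s → |u.1| ≤ x →
      ∃ n' y, S.Wk n' ∅ s (u.1, y) s ∧ u.2 ≤ y ∧ -(B : ℤ) ≤ y := fun {n V s u} h hux => by
    rcases lt_or_ge u.2 (-(B : ℤ)) with h1 | h1
    · obtain ⟨m, y, hm, h2⟩ := near Q S x n V s s u hQ hS hux h
      have h3 := (h2.bdd hS).2
      have h4 : (x : ℤ) * m ≤ B := by rw [hB]; push_cast; gcongr
      simp only [abs_le] at h3
      exact ⟨m, y, h2, by linarith [h3.1], by linarith [h3.1]⟩
    · exact ⟨n, u.2, h.mono (Set.empty_subset _), le_rfl, h1⟩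
  obtain ⟨n₁, d, hd, hd1, hd2⟩ := low hu (by rw [abs_of_pos hu1]; exact hux)
  obtain ⟨n₂, f, hf, hf1, hf2⟩ := low hv (by rw [hvu, abs_neg, abs_of_pos hu1]; exact hux)
  obtain ⟨μ, hμ, hμ1, hμ2⟩ : ∃ μ : ℤ, |μ| ≤ 2 * B + 1 ∧ 0 < 2 * d - μ ∧ 0 < 2 * f + μ := by
    rcases le_total (-2 * f + 1) (-(2 * B + 1)) with h | h
    · exact ⟨-(2 * B + 1), by rw [abs_le]; constructor <;> omega, by omega, by omega⟩
    · exact ⟨-2 * f + 1, by rw [abs_le]; constructor <;> omega, by omega, by omega⟩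
  obtain ⟨y, hy⟩ : ∃ y, y = 2 * B + 2 * x + 1 := ⟨_, rfl⟩
  have hx1 : 1 ≤ x := by omega
  obtain ⟨m₁, u', hm₁, hu', hu'1, hu'2⟩ := pos Q S y n₁ ∅ s (u.1, d) 1 0 (-μ) (2 * u.1) (by omega)
    (hS.mono (by omega)) (by rw [abs_one]; omega) (by rw [abs_zero]; omega)
    (by rw [abs_neg]; push_cast [hy]; omega) (by rw [abs_of_pos (by omega)]; push_cast [hy]; omega)
    hd (by simpa using hu1) (by
      have : 0 < u.1 * (2 * d - μ) := mul_pos hu1 hμ1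
      simp only
      linarith)
  obtain ⟨m₂, v', hm₂, hv', hv'1, hv'2⟩ := pos Q S y n₂ ∅ s' (v.1, f) (-1) 0 (-μ) (2 * u.1)
    (by omega) (hS.mono (by omega)) (by rw [abs_neg, abs_one]; omega) (by rw [abs_zero]; omega)
    (by rw [abs_neg]; push_cast [hy]; omega) (by rw [abs_of_pos (by omega)]; push_cast [hy]; omega)
    hf (by simp only; omega) (by
      have : 0 < u.1 * (2 * f + μ) := mul_pos hu1 hμ2
      simp only [hvu]
      linarith)
  rw [hy] at hm₁ hm₂
  refine ⟨m₁, m₂, u', v', hm₁, hm₂, hu'.mono (Set.empty_subset _), hv'.mono (Set.empty_subset _),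
    by omega, by omega, ?_⟩
  have h1 : 0 < -v'.1 * (-μ * u'.1 + 2 * u.1 * u'.2) := mul_pos (by omega) hu'2
  have h2 : 0 < u'.1 * (-μ * v'.1 + 2 * u.1 * v'.2) := mul_pos (by omega) hv'2
  have h3 : 0 < 2 * u.1 * (u'.1 * v'.2 - u'.2 * v'.1) := by linarith
  exact pos_of_mul_pos_right h3 (by omega)

end Sys

namespace Sys
variable {Q : Type} {S : Sys Q} {n : ℕ}

theorem ch_loop {q : Q} {a b e : ℤ} (h : Ch (S.St half) n (q, a, b) (q, a, b + e)) (k : ℕ) :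
    Ch (S.St half) (k * n) (q, a, b) (q, a, b + k * e) := by
  induction k with
  | zero => simpa using Ch.nil _
  | succ k ih =>
    have := ih.append (ch_vshift_half h (k * e))
    convert this using 3
    · ring
    · push_cast
      ring

/-- Removing a loop. -/
theorem ch_cut {f : ℕ → Q × ℤ × ℤ} (hf : ∀ k < n, S.St half (f k) (f (k + 1))) {i j : ℕ}
    (hij : i < j) (hj : j ≤ n) (h1 : (f i).1 = (f j).1) (h2 : (f i).2.1 = (f j).2.1) :
    Ch (S.St half) (i + (n - j)) (f 0)
      ((f n).1, (f n).2.1, (f n).2.2 - ((f j).2.2 - (f i).2.2)) := by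
  have a₁ := Ch.seg hf (Nat.zero_le i) (by omega)
  have a₂ := ch_vshift_half (Ch.seg hf hj le_rfl) (-((f j).2.2 - (f i).2.2))
  rw [← h1, ← h2, show (f j).2.2 + -((f j).2.2 - (f i).2.2) = (f i).2.2 by ring] at a₂
  exact a₁.append a₂

/-- Repeating a loop. -/
theorem ch_pump {f : ℕ → Q × ℤ × ℤ} (hf : ∀ k < n, S.St half (f k) (f (k + 1))) {i j : ℕ}
    (hij : i < j) (hj : j ≤ n) (h1 : (f i).1 = (f j).1) (h2 : (f i).2.1 = (f j).2.1) (k : ℕ) :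
    Ch (S.St half) (i + k * (j - i) + (n - i)) (f 0)
      ((f n).1, (f n).2.1, (f n).2.2 + k * ((f j).2.2 - (f i).2.2)) := by
  have a₁ := Ch.seg hf (Nat.zero_le i) (by omega)
  have a₂ := Ch.seg hf hij.le hj
  have a₃ := ch_vshift_half (Ch.seg hf (show i ≤ n by omega) le_rfl)
    (k * ((f j).2.2 - (f i).2.2))
  have a₄ := ch_loop (q := (f i).1) (a := (f i).2.1) (b := (f i).2.2)
    (e := (f j).2.2 - (f i).2.2) (by rw [add_sub_cancel]; nth_rw 2 [h1, h2]; exact a₂) k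
  exact (a₁.append a₄).append a₃

/-- Closed runs with positive effect on the second counter yield short ones. -/
theorem posLoop : ∃ F, Pol F ∧ ∀ (Q : Type) [Fintype Q] (S : Sys Q) (x n : ℕ) (p : Q) (ℓ : ℤ),
    Fintype.card Q ≤ x → S.Bdd x → 0 < ℓ → Ch (S.St half) n (p, 0, 0) (p, 0, ℓ) →
    ∃ ℓ', 0 < ℓ' ∧ Cle (S.St half) (F x) (p, 0, 0) (p, 0, ℓ') := by
  classical
  obtain ⟨Fp, hFp, pump⟩ := Wk.pumpPair
  obtain ⟨Fn, hFn, near⟩ := Wk.near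
  obtain ⟨Fl, hFl, low⟩ := rlx_low
  let W : ℕ → ℕ := fun x => (x * (x + 1)) ^ 2 * 1 + 1
  let A : ℕ → ℕ := fun x => x * Fp (x + W x) + x * Fn x + 1
  let B : ℕ → ℕ := fun x => A x + W x
  let G : ℕ → ℕ := fun x => Fl (B x + x)
  let k₁ : ℕ → ℕ := fun x => x * (2 * G x + Fn x) + 1
  let Kc : ℕ → ℕ := fun x => x * (B x + 1)
  let k₂ : ℕ → ℕ := fun x => x * G x + x * Kc x + 1
  let E : ℕ → ℕ := fun x => k₁ x * (x * Fp (x + W x)) * Fp (x + W x)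
  refine ⟨fun x => (2 * G x + Fn x + 2 * E x) + (Kc x + k₂ x * Kc x + G x), by
    simp only [E, k₂, Kc, k₁, G, B, A, W]; fun_prop, fun Q _ S x n p ℓ hQ hS hℓ h => ?_⟩
  beta_reduce
  have hex : ∃ n, ∃ ℓ : ℤ, 0 < ℓ ∧ Ch (S.St half) n (p, 0, 0) (p, 0, ℓ) := ⟨n, ℓ, hℓ, h⟩
  clear h hℓ
  obtain ⟨n, ⟨ℓ, hℓ, f, f0, fn, hf⟩, hmin⟩ : ∃ n, (∃ ℓ : ℤ, 0 < ℓ ∧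
      Ch (S.St half) n (p, 0, 0) (p, 0, ℓ)) ∧ ∀ m ℓ, 0 < ℓ →
      Ch (S.St half) m (p, 0, 0) (p, 0, ℓ) → n ≤ m :=
    ⟨Nat.find hex, Nat.find_spec hex, fun m ℓ hℓ h => Nat.find_min' hex ⟨ℓ, hℓ, h⟩⟩
  have bd : ∀ {m c c'} {L : ℕ}, m ≤ L → Ch (S.St half) m c c' → |c'.2.2 - c.2.2| ≤ (x * L : ℕ) :=
    fun {m c c' L} hm h => by
    have h1 := (ch_bdd hS h).2
    have h2 : (x : ℤ) * m ≤ x * L := by gcongr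
    push_cast
    omega
  by_cases hT : ∃ T ≤ n, (B x : ℤ) ≤ (f T).2.1
  · obtain ⟨T, hTn, hT⟩ := hT
    have hW : ((A x : ℕ) : ℤ) + ((((Finset.univ : Finset Q).card * (x + 1)) ^ 2 * 1 : ℕ) : ℤ) < B x := by
      have : ((Finset.univ : Finset Q).card * (x + 1)) ^ 2 * 1 < W x := by
        simp only [W]
        rw [Nat.lt_succ_iff, Finset.card_univ]
        gcongr
      simp only [B]
      push_cast at this ⊢
      zify at this
      omega
    obtain ⟨τ, σ, Lv, hLv, hsub, -, hpair⟩ := levels_fiber (fun i => (f i).2.1) (M := 0) (N := x) hTn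
      (by simp [f0]) (by simp [fn]) (fun i hi => ((hf i hi).bdd hS).1) (fun i => (f i).1)
      Finset.univ (fun _ _ => Finset.mem_univ _) (A := A x) (B := B x) (by positivity) hT (K := 1) hW
    obtain ⟨a, ha, b, hb, hab⟩ := Finset.one_lt_card.1 hLv
    obtain ⟨l, l', t₁, t₂, t₃, t₄, hl, hl', H⟩ : ∃ l l' t₁ t₂ t₃ t₄, (l ∈ Lv) ∧ (l' ∈ Lv) ∧
        LevelPair (fun i => (f i).2.1) (fun i => (f i).1) n x l l' t₁ t₂ t₃ t₄ := by
      rcases lt_or_gt_of_ne hab with h | h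
      · exact ⟨a, b, _, _, _, _, ha, hb, hpair a ha b hb h⟩
      · exact ⟨b, a, _, _, _, _, hb, ha, hpair b hb a ha h⟩
    have hl := Finset.mem_Ioc.1 (hsub hl)
    have hl' := Finset.mem_Ioc.1 (hsub hl')
    have he : 0 < (f t₂).2.2 - (f t₁).2.2 + ((f t₄).2.2 - (f t₃).2.2) := by
      by_contra! he
      have h1 := pair_repeat hf H (by omega) 0
      rw [f0, fn] at h1
      have h2 := hmin _ _ (by push_cast; omega) h1
      have := H.h12; have := H.h23; have := H.h34; have := H.h4
      omega
    obtain ⟨lt, h12, h23, h34, h4, e12, e34, g12, g34, ge, ge', le1, le4⟩ := H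
    have hA : ((A x : ℕ) : ℤ) = x * Fp (x + W x) + x * Fn x + 1 := by simp [A]
    have hBA : ((B x : ℕ) : ℤ) = A x + W x := by simp [B]
    have hp1 : (0 : ℤ) ≤ x * Fp (x + W x) := by positivity
    have hp2 : (0 : ℤ) ≤ x * Fn x := by positivity
    have w₁ := Wk.ofCh' (seg_nt hf h12.le (by omega) (show 1 ≤ l by omega)
      fun k h1 h2 => ge k h1 (by omega))
    have w₂ := Wk.ofCh' (seg_nt hf h23 (by omega) (show 1 ≤ l by omega)
      fun k h1 h2 => ge k (by omega) (by omega))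
    have w₃ := Wk.ofCh' (seg_nt hf h34.le (by omega) (show 1 ≤ l by omega)
      fun k h1 h2 => ge k (by omega) (by omega))
    rw [← g12] at w₁ w₂
    rw [g34] at w₂ w₃
    obtain ⟨n₁, n₃, u, v, hn₁, hn₃, hu, hv, hu1, hv1, huv⟩ := pump Q S (x + W x) _ _ _ _ _ _ _ _
      (by omega) (hS.mono (by omega)) w₁ w₃ (by simp only [Prod.fst_sub]; omega)
      (by simp only [Prod.fst_sub]; push_cast; omega) (by simp only [Prod.fst_sub]; omega) he
    obtain ⟨n₂, y, hn₂, hw⟩ := near Q S x _ _ _ _ _ hQ hS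
      (by
        have := ge t₁ le_rfl (by omega)
        have := ge t₄ (by omega) le_rfl
        simp only [Prod.fst_sub, abs_le]
        constructor <;> omega) w₂
    obtain ⟨y₁, n₀, hn₀, h₀⟩ := low Q S (B x + x) _ _ _ (by omega) (hS.mono (by omega))
      (by rw [f0]; positivity) (by push_cast; omega) (Ch.seg hf (Nat.zero_le t₁) (by omega))
    obtain ⟨y₂, n₄, hn₄, h₄⟩ := low Q S (B x + x) _ _ _ (by omega) (hS.mono (by omega))
      (by push_cast; omega) (by rw [fn]; positivity) (Ch.seg hf h4 le_rfl)
    rw [f0] at h₀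
    rw [fn] at h₄
    obtain ⟨a, ha⟩ : ∃ a : ℕ, (a : ℤ) = -v.1 := ⟨(-v.1).toNat, by omega⟩
    obtain ⟨b, hb⟩ : ∃ b : ℕ, (b : ℤ) = u.1 := ⟨u.1.toNat, by omega⟩
    have le_mul : ∀ {m L : ℕ}, m ≤ L → (x : ℤ) * m ≤ x * L := fun h => by gcongr
    have b₁ := ge t₁ le_rfl (by omega)
    have b₄ := ge t₄ (by omega) le_rfl
    have hkab : (0 : ℤ) ≤ (k₁ x * a : ℕ) * u.1 := by positivity
    have eab : ((k₁ x * a : ℕ) : ℤ) * u.1 + (k₁ x * b : ℕ) * v.1 = 0 := by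
      push_cast
      rw [hb, ha]
      ring
    have r₁ := hu.iterHalf hS (z := ((f t₁).2.1, y₁)) (k₁ x * a)
      (by linarith [le_mul hn₁]) (by have := le_mul hn₁; simp only; linarith)
    have r₂ := hw.toHalf hS (z := ((f t₁).2.1, y₁) + (k₁ x * a) • u)
      (by
        have := le_mul hn₂
        simp only [Prod.fst_add, Prod.smul_fst]
        simp only [nsmul_eq_mul]
        linarith)
    have r₃ := hv.iterHalf hS (z := ((f t₁).2.1, y₁) + (k₁ x * a) • u + ((f t₃).2.1 - (f t₂).2.1, y))
      (k₁ x * b)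
      (by
        have := le_mul hn₃
        simp only [Prod.fst_add, Prod.smul_fst]
        simp only [nsmul_eq_mul]
        linarith)
      (by
        have := le_mul hn₃
        simp only [Prod.fst_add, Prod.smul_fst]
        simp only [nsmul_eq_mul]
        linarith)
    obtain ⟨Y, hY⟩ : ∃ Y, Y = y₁ + (k₁ x * a : ℕ) * u.2 + y + (k₁ x * b : ℕ) * v.2 := ⟨_, rfl⟩
    have end₃ : ((f t₁).2.1, y₁) + (k₁ x * a) • u + ((f t₃).2.1 - (f t₂).2.1, y) + (k₁ x * b) • v =
        ((f t₄).2.1, Y) := by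
      ext
      · simp only [Prod.fst_add, Prod.smul_fst]
        simp only [nsmul_eq_mul]
        linarith
      · simp only [Prod.snd_add, Prod.smul_snd]
        simp only [nsmul_eq_mul]
        linarith
    rw [end₃] at r₃
    have r₄ := ch_vshift_half h₄ (Y - (f t₄).2.2)
    rw [add_sub_cancel] at r₄
    have all := (((h₀.append (ch_ofNt r₁)).append (ch_ofNt r₂)).append (ch_ofNt r₃)).append r₄
    refine ⟨_, ?_, _, ?_, all⟩
    · have c₁ := bd hn₀ h₀
      have c₂ := (hw.bdd hS).2
      have c₃ := bd hn₄ h₄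
      have c₄ := le_mul hn₂
      simp only [abs_le] at c₁ c₂ c₃
      have c₅ : ((k₁ x : ℕ) : ℤ) = x * (2 * G x + Fn x) + 1 := by simp [k₁]
      have c₆ : (k₁ x : ℤ) * 1 ≤ k₁ x * (u.1 * v.2 - u.2 * v.1) := by gcongr; omega
      have c₇ : Y = y₁ + y + k₁ x * (u.1 * v.2 - u.2 * v.1) := by
        rw [hY]
        push_cast
        rw [ha, hb]
        ring
      have c₈ : ((x * Fl (B x + x) : ℕ) : ℤ) = x * G x := by simp [G]
      rw [c₈] at c₁ c₃
      rw [sub_zero] at c₁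
      linarith [c₁.1, c₂.1, c₃.1]
    · have d₁ := (hv.bdd hS).1
      have d₂ := (hu.bdd hS).1
      simp only [abs_le] at d₁ d₂
      have d₃ : a ≤ x * Fp (x + W x) := by zify; linarith [le_mul hn₃]
      have d₄ : b ≤ x * Fp (x + W x) := by zify; linarith [le_mul hn₁]
      have d₅ : k₁ x * a * n₁ ≤ E x := by simp only [E]; gcongr
      have d₆ : k₁ x * b * n₃ ≤ E x := by simp only [E]; gcongr
      have d₇ : G x = Fl (B x + x) := rfl
      omega
  · push Not at hT
    have hpos : ∀ i ≤ n, 0 ≤ (f i).2.1 := fun i hi => by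
      rcases Nat.lt_or_ge i n with h | h
      · exact (hf i h).2.1
      · obtain rfl : i = n := by omega
        rw [fn]
    rcases Nat.lt_or_ge n (Kc x) with hn | hn
    · exact ⟨ℓ, hℓ, n, by omega, f, f0, fn, hf⟩
    obtain ⟨i, j, hij, hj, hfij⟩ := pigeon (Finset.univ ×ˢ Finset.Icc (0 : ℤ) (B x))
      (fun i => ((f i).1, (f i).2.1)) (Kc x + 1) (fun i hi => by
        simp only [Finset.mem_product, Finset.mem_univ, Finset.mem_Icc, true_and]
        exact ⟨hpos i (by omega), (hT i (by omega)).le⟩) (by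
        rw [Finset.card_product, Finset.card_univ, Int.card_Icc, Nat.lt_succ_iff]
        simp only [Kc]
        gcongr
        omega)
    simp only [Prod.mk.injEq] at hfij
    have he : 0 < (f j).2.2 - (f i).2.2 := by
      by_contra! he
      have h1 := ch_cut hf hij (by omega) hfij.1 hfij.2
      rw [f0, fn] at h1
      have := hmin _ _ (by simp only; omega) h1
      omega
    obtain ⟨y, m, hm, h₂⟩ := low Q S (B x + x) _ _ _ (by omega) (hS.mono (by omega))
      (by push_cast; linarith [hT i (by omega)]) (by rw [fn]; positivity)
      (Ch.seg hf (show i ≤ n by omega) le_rfl)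
    rw [fn] at h₂
    have h₁ := Ch.seg hf (Nat.zero_le i) (by omega)
    rw [f0, Nat.sub_zero] at h₁
    have h₃ := Ch.seg hf hij.le (by omega)
    have h₄ := ch_loop (q := (f i).1) (a := (f i).2.1) (b := (f i).2.2)
      (e := (f j).2.2 - (f i).2.2)
      (by rw [add_sub_cancel]; nth_rw 2 [hfij.1, hfij.2]; exact h₃) (k₂ x)
    have h₅ := ch_vshift_half h₂ (k₂ x * ((f j).2.2 - (f i).2.2))
    refine ⟨_, ?_, _, ?_, (h₁.append h₄).append h₅⟩
    · have c₁ := bd (show i ≤ Kc x by omega) h₁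
      have c₂ := bd hm h₂
      simp only [abs_le] at c₁ c₂
      have c₅ : ((k₂ x : ℕ) : ℤ) = x * G x + x * Kc x + 1 := by simp [k₂]
      have c₆ : (k₂ x : ℤ) * 1 ≤ k₂ x * ((f j).2.2 - (f i).2.2) := by gcongr; omega
      have c₈ : ((x * Fl (B x + x) : ℕ) : ℤ) = x * G x := by simp [G]
      rw [c₈] at c₂
      push_cast at c₁
      linarith [c₁.1, c₂.1]
    · have d₁ : k₂ x * (j - i) ≤ k₂ x * Kc x := by gcongr; omega
      have d₇ : G x = Fl (B x + x) := rfl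
      omega

end Sys

/-- An injective function with values at mutual distance at most `G` has a small domain. -/
theorem card_le_of_close {α : Type} [LinearOrder α] (s : Finset α) (κ : α → ℤ) (G : ℕ)
    (h : ∀ a ∈ s, ∀ b ∈ s, a < b → κ a ≠ κ b ∧ |κ a - κ b| ≤ G) : s.card ≤ 2 * G + 1 := by
  rcases s.eq_empty_or_nonempty with rfl | ⟨a₀, h₀⟩
  · simp
  have h1 : s.card ≤ (Finset.Icc (κ a₀ - G) (κ a₀ + G)).card := by
    refine Finset.card_le_card_of_injOn κ (fun a ha => ?_) fun a ha b hb hab => ?_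
    · rw [Finset.coe_Icc, Set.mem_Icc]
      rcases lt_trichotomy a a₀ with h' | rfl | h'
      · have := (h a ha a₀ h₀ h').2
        rw [abs_le] at this
        omega
      · omega
      · have := (h a₀ h₀ a ha h').2
        rw [abs_le] at this
        omega
    · rcases lt_trichotomy a b with h' | h' | h'
      · exact absurd hab (h a ha b hb h').1
      · exact h'
      · exact absurd hab.symm (h b hb a ha h').1
  rw [Int.card_Icc] at h1
  omega

namespace Sys
variable {Q : Type} {S : Sys Q} {n : ℕ}

/-- Relaxed runs with almost maximal effect on the second counter can be shortened. -/
theorem rlx_exact : ∃ F, Pol F ∧ ∀ (Q : Type) [Fintype Q] (S : Sys Q) (x n : ℕ) (p q : Q) (ℓ : ℤ),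
    Fintype.card Q ≤ x → S.Bdd x → Ch (S.St half) n (p, 0, 0) (q, 0, ℓ) →
    (∀ m ℓ', Ch (S.St half) m (p, 0, 0) (q, 0, ℓ') → ℓ' ≤ ℓ + x) →
    Cle (S.St half) (F x) (p, 0, 0) (q, 0, ℓ) := by
  classical
  let B : ℕ → ℕ := fun x => (x * (x + 1)) ^ 2 * (2 * x + 1) + 1
  let Kc : ℕ → ℕ := fun x => x * (B x + 1) * (2 * x + 1)
  refine ⟨fun x => Kc x, by simp only [Kc, B]; fun_prop, fun Q _ S x n p q ℓ hQ hS h hmax => ?_⟩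
  beta_reduce
  obtain ⟨n, -, ⟨f, f0, fn, hf⟩, hmin⟩ := h.minimal
  have shorter : ∀ {m e}, Ch (S.St half) m (f 0) ((f n).1, (f n).2.1, (f n).2.2 + e) →
      m < n → e ≠ 0 := fun {m e} h hm he => by
    rw [f0, fn, he] at h
    have := hmin _ (by simpa using h)
    omega
  have bound : ∀ {m e}, Ch (S.St half) m (f 0) ((f n).1, (f n).2.1, (f n).2.2 + e) →
      e ≤ x := fun {m e} h => by
    rw [f0, fn] at h
    have := hmax _ _ h
    linarith
  by_cases hT : ∃ T ≤ n, (B x : ℤ) ≤ (f T).2.1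
  · exfalso
    obtain ⟨T, hTn, hT⟩ := hT
    have hW : (0 : ℤ) + ((((Finset.univ : Finset Q).card * (x + 1)) ^ 2 * (2 * x + 1) : ℕ) : ℤ) <
        B x := by
      rw [zero_add]
      simp only [B]
      norm_cast
      rw [Nat.lt_succ_iff, Finset.card_univ]
      gcongr
    obtain ⟨τ, σ, Lv, hLv, hsub, -, hpair⟩ := levels_fiber (fun i => (f i).2.1) (M := 0) (N := x)
      hTn (by simp [f0]) (by simp [fn]) (fun i hi => ((hf i hi).bdd hS).1) (fun i => (f i).1)
      Finset.univ (fun _ _ => Finset.mem_univ _) (A := 0) (B := B x) le_rfl hT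
      (K := 2 * x + 1) hW
    have h1 := card_le_of_close Lv (fun l => (f (σ l)).2.2 - (f (τ l)).2.2) x
      fun l hl l' hl' hll => by
        have H := hpair l hl l' hl' hll
        have hl1 := Finset.mem_Ioc.1 (hsub hl)
        have a₀ := pair_repeat hf H (by omega) 0
        have a₁ := pair_repeat hf H (by omega) (x + 2)
        have b₀ := bound a₀
        have b₁ := bound a₁
        have c₀ := shorter a₀ (by
          have := H.h12; have := H.h23; have := H.h34; have := H.h4
          omega)
        push_cast at b₀ b₁ c₀
        obtain ⟨e, he⟩ : ∃ e, e = (f (τ l')).2.2 - (f (τ l)).2.2 +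
          ((f (σ l)).2.2 - (f (σ l')).2.2) := ⟨_, rfl⟩
        rw [← he] at b₀ b₁ c₀
        have : e ≤ 0 := by
          by_contra! h
          nlinarith
        rw [abs_le]
        refine ⟨fun h => ?_, ?_, ?_⟩
        · rw [show e = 0 by linarith] at c₀
          simp at c₀
        · linarith
        · linarith
    omega
  · push Not at hT
    have hpos : ∀ i ≤ n, 0 ≤ (f i).2.1 := fun i hi => by
      rcases Nat.lt_or_ge i n with h | h
      · exact (hf i h).2.1
      · obtain rfl : i = n := by omega
        rw [fn]
    refine ⟨n, ?_, f, f0, fn, hf⟩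
    by_contra! hn
    obtain ⟨y, -, hy⟩ := Finset.exists_lt_card_fiber_of_mul_lt_card_of_maps_to
      (s := Finset.range n) (t := Finset.univ ×ˢ Finset.Icc (0 : ℤ) (B x))
      (f := fun i => ((f i).1, (f i).2.1)) (n := 2 * x + 1) (fun i hi => by
        have := Finset.mem_range.1 hi
        simp only [Finset.mem_product, Finset.mem_univ, Finset.mem_Icc, true_and]
        exact ⟨hpos i (by omega), (hT i (by omega)).le⟩) (by
        rw [Finset.card_product, Finset.card_univ, Int.card_Icc, Finset.card_range]
        refine lt_of_le_of_lt ?_ hn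
        simp only [Kc]
        gcongr
        omega)
    have h1 := card_le_of_close {i ∈ Finset.range n | ((f i).1, (f i).2.1) = y}
      (fun i => (f i).2.2) x fun i hi j hj hij => by
        obtain ⟨hi, hiy⟩ := Finset.mem_filter.1 hi
        obtain ⟨hj, hjy⟩ := Finset.mem_filter.1 hj
        have := Finset.mem_range.1 hj
        have e := hiy.trans hjy.symm
        simp only [Prod.mk.injEq] at e
        have a₀ := ch_cut hf hij (by omega) e.1 e.2
        have a₁ := ch_pump hf hij (by omega) e.1 e.2 (x + 1)
        rw [sub_eq_add_neg] at a₀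
        have b₀ := bound a₀
        have b₁ := bound a₁
        have c₀ := shorter a₀ (by omega)
        push_cast at b₁
        have : (f j).2.2 - (f i).2.2 ≤ 0 := by
          by_contra! h
          nlinarith
        rw [abs_le]
        refine ⟨fun h => ?_, ?_, ?_⟩
        · rw [h] at c₀
          simp at c₀
        · linarith
        · linarith
    omega

end Sys

namespace Sys
variable {Q : Type} {S : Sys Q} {n N : ℕ} {V : Set Q} {p q s : Q} {z w : ℤ × ℤ}

/-- The effect on the first counter is achieved modulo `g` by short walks. -/
theorem Wk.residue [Fintype Q] (h : S.Wk n V p w q) {g : ℕ} (hg : 0 < g) :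
    ∃ m u, m ≤ Fintype.card Q * g ∧ S.Wk m ∅ p u q ∧ (g : ℤ) ∣ u.1 - w.1 := by
  have h2 : Ch (OC S.nt.hE S.nt.Z Set.univ) n (p, 0) (q, w.1) := by
    simpa using (h.toCh 0).map _ fun _ _ h => St.toOC (I := Set.univ) (h.mono fun _ _ => trivial)
  obtain ⟨b, ⟨m, hm, h3⟩, h4⟩ := OC.residue (E := S.hE) h2 g hg
  obtain ⟨y, h5⟩ := ch_ofOC (S := S.nt) h3 0
  exact ⟨m, (b, y), hm, by simpa using Wk.ofCh' h5, h4⟩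

theorem Wk.iterQuad (hS : S.Bdd N) (h : S.Wk n V s w s) (k : ℕ) (h1 : N * n ≤ z.1)
    (h1' : N * n ≤ z.1 + k * w.1) (h2 : N * n ≤ z.2) (h2' : 0 ≤ w.2) :
    Ch (S.nt.St quad) (k * n) (s, z) (s, z + k • w) := by
  have key : ∀ i ≤ k, (N : ℤ) * n ≤ z.1 + i * w.1 := fun i hi => by
    rcases le_total 0 w.1 with h0 | h0
    · have : 0 ≤ (i : ℤ) * w.1 := by positivity
      linarith
    · have : (k : ℤ) * w.1 ≤ i * w.1 :=
        mul_le_mul_of_nonpos_right (by exact_mod_cast hi) h0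
      linarith
  clear h1'
  induction k with
  | zero => simpa using Ch.nil _
  | succ k ih =>
    have := h.toCh_quad hS (z := z + k • w) (by simpa using key k (by omega)) (by
      have : 0 ≤ (k : ℤ) * w.2 := by positivity
      simp only [Prod.snd_add, Prod.smul_snd]
      simp only [nsmul_eq_mul]
      linarith)
    rw [add_mul, one_mul, succ_nsmul, ← add_assoc]
    exact (ih fun i hi => key i (by omega)).append this

/-- A cycle that increases the second counter allows for moving the first counter far in the
direction of the effect of the cycle, with a gain on the second counter. -/
theorem Wk.reachFar : ∃ F, Pol F ∧ ∀ (Q : Type) [Fintype Q] (S : Sys Q) (x n m K : ℕ)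
    (V V' : Set Q) (s s' : Q) (u w : ℤ × ℤ) (ε a b : ℤ), Fintype.card Q ≤ x → S.Bdd x →
    |ε| = 1 → S.Wk n V s u s → S.Wk m V' s w s' → 0 < ε * u.1 → 0 < u.2 →
    (K + 1 : ℕ) * F x ≤ ε * w.1 → F x ≤ a → F x ≤ a + w.1 → F x ≤ b →
    ∃ k b', b + K - F x ≤ b' ∧ Ch (S.nt.St quad) k (s, a, b) (s', a + w.1, b') := by
  obtain ⟨F, hF, pos⟩ := Wk.posCycle
  let g₀ : ℕ → ℕ := fun x => (x + 1) * F (x + 1)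
  let M : ℕ → ℕ := fun x => (x + 1) * ((x + 1) * g₀ x)
  refine ⟨fun x => M x + 2 * g₀ x + M x + 1, by simp only [M, g₀]; fun_prop,
    fun Q _ S x n m K V V' s s' u w ε a b hQ hS hε hu hw hu1 hu2 hK ha haw hb => ?_⟩
  beta_reduce at *
  obtain ⟨n₁, u₁, hn₁, hu₁, p1, p2⟩ := pos Q S (x + 1) n V s u ε 0 0 1 (by omega)
    (hS.mono (by omega)) (by push_cast; omega) (by simp; omega) (by simp; omega)
    (by simp) hu (by linarith) (by linarith)
  simp only [zero_mul, add_zero, one_mul, zero_add] at p1 p2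
  have hS' : S.Bdd (x + 1) := hS.mono (by omega)
  obtain ⟨g, hg⟩ : ∃ g : ℕ, (g : ℤ) = ε * u₁.1 := ⟨(ε * u₁.1).toNat, by omega⟩
  have hgn : ((x + 1 : ℕ) : ℤ) * n₁ ≤ g₀ x := by
    simp only [g₀]
    push_cast
    gcongr
  have hεa : ∀ t : ℤ, |ε * t| = |t| := fun t => by rw [abs_mul, hε, one_mul]
  have hgle : (g : ℤ) ≤ g₀ x := by
    have := (hu₁.bdd hS').1
    rw [← hεa, ← hg, abs_of_nonneg (by positivity)] at this
    linarith
  obtain ⟨n₂, u₂, hn₂, hu₂, k, hk⟩ := hw.residue (g := g) (by omega)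
  have hM : ((x + 1 : ℕ) : ℤ) * n₂ ≤ M x := by
    have : n₂ ≤ (x + 1) * g₀ x := hn₂.trans (by gcongr; omega; exact_mod_cast hgle)
    simp only [M]
    push_cast
    gcongr
    exact_mod_cast this
  obtain ⟨q1, q2⟩ := hu₂.bdd hS'
  have q3 := abs_le.1 (q1.trans hM)
  have q4 := abs_le.1 (((hεa u₂.1).le.trans q1).trans hM)
  have q5 := abs_le.1 (q2.trans hM)
  have hεε : ε * ε = 1 := by rw [← abs_mul_abs_self, hε, one_mul]
  obtain ⟨j, hj⟩ : ∃ j : ℤ, j = -(ε * k) := ⟨_, rfl⟩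
  have e1 : w.1 = u₂.1 + j * u₁.1 := by
    rw [hg] at hk
    linear_combination -hk - u₁.1 * hj
  have e2 : ε * w.1 = ε * u₂.1 + j * g := by rw [hg, e1]; ring
  have hjK : K ≤ j := by
    by_contra! hlt
    have h1 : j * g ≤ K * g := by gcongr
    have h2 : (K : ℤ) * g ≤ K * g₀ x := by gcongr
    have h3 : (0 : ℤ) ≤ K * (M x + g₀ x + M x + 1) := by positivity
    push_cast at hK
    linarith
  lift j to ℕ using by omega
  push_cast at ha haw hb hgn hM
  have r₁ := hu₁.iterQuad hS' (z := (a, b)) j (by push_cast; linarith) (by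
    push_cast
    linarith) (by push_cast; linarith) p2.le
  have hju : (K : ℤ) * 1 ≤ j * u₁.2 := by gcongr; omega
  have r₂ := hu₂.toCh_quad hS' (z := (a, b) + j • u₁) (by
      simp only [Prod.fst_add, Prod.smul_fst]
      simp only [nsmul_eq_mul]
      push_cast
      linarith) (by
      simp only [Prod.snd_add, Prod.smul_snd]
      simp only [nsmul_eq_mul]
      push_cast
      linarith)
  refine ⟨j * n₁ + n₂, b + j * u₁.2 + u₂.2, ?_, ?_⟩
  · push_cast
    linarith
  · have e3 : (a, b) + j • u₁ + u₂ = (a + w.1, b + j * u₁.2 + u₂.2) := by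
      ext
      · simp only [Prod.fst_add, Prod.smul_fst]
        simp only [nsmul_eq_mul]
        linarith
      · simp only [Prod.snd_add, Prod.smul_snd]
        simp only [nsmul_eq_mul]
    rw [e3] at r₂
    exact r₁.append r₂

end Sys

namespace Sys
variable {Q : Type} {S : Sys Q} {n : ℕ} {c c' : Q × ℤ × ℤ}

theorem ch_seg_region {f : ℕ → Q × ℤ × ℤ} {R R' : Set (ℤ × ℤ)}
    (hf : ∀ k < n, S.St R (f k) (f (k + 1))) {i j : ℕ} (hij : i ≤ j) (hj : j ≤ n)
    (h : ∀ k, i ≤ k → k ≤ j → (f k).2 ∈ R') : Ch (S.St R') (j - i) (f i) (f j) :=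
  Ch.seg' (fun k hk hk' => ⟨(hf k (by omega)).1, h k hk hk'.le, h _ (by omega) (by omega)⟩) hij

theorem ch_shift_quad {l d : ℤ} (h : Ch (S.nt.St {z | l ≤ z.1 ∧ d ≤ z.2}) n c c') (k e : ℤ)
    (hk : 0 ≤ l + k) (he : 0 ≤ d + e) :
    Ch (S.nt.St quad) n (c.1, c.2.1 + k, c.2.2 + e) (c'.1, c'.2.1 + k, c'.2.2 + e) :=
  h.map (fun c : Q × ℤ × ℤ => (c.1, c.2.1 + k, c.2.2 + e)) fun a b h => h.shift _ _
    ⟨show 0 ≤ a.2.1 + k by linarith [h.2.1.1], show 0 ≤ a.2.2 + e by linarith [h.2.1.2]⟩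
    ⟨show 0 ≤ b.2.1 + k by linarith [h.2.2.1], show 0 ≤ b.2.2 + e by linarith [h.2.2.2]⟩

theorem ch_mem {f : ℕ → Q × ℤ × ℤ} {R : Set (ℤ × ℤ)} (hf : ∀ k < n, S.St R (f k) (f (k + 1)))
    (hn : 0 < n) {i : ℕ} (hi : i ≤ n) : (f i).2 ∈ R := by
  rcases Nat.lt_or_ge i n with h | h
  · exact (hf i h).2.1
  · obtain ⟨j, rfl⟩ : ∃ j, i = j + 1 := ⟨i - 1, by omega⟩
    exact (hf j (by omega)).2.2

/-- Repetition of the two segments of a pair of levels. -/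
theorem pair_pump {f : ℕ → Q × ℤ × ℤ} (hf : ∀ k < n, S.nt.St quad (f k) (f (k + 1)))
    {M l l' : ℤ} {t₁ t₂ t₃ t₄ : ℕ}
    (H : LevelPair (fun i => (f i).2.1) (fun i => (f i).1) n M l l' t₁ t₂ t₃ t₄)
    (hl : 0 ≤ l) (hd : 0 ≤ (f t₂).2.2 - (f t₁).2.2)
    (he : 0 ≤ (f t₂).2.2 - (f t₁).2.2 + ((f t₄).2.2 - (f t₃).2.2)) (k : ℕ) :
    ∃ m, Ch (S.nt.St quad) m (f 0)
      ((f n).1, (f n).2.1, (f n).2.2 +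
        k * ((f t₂).2.2 - (f t₁).2.2 + ((f t₄).2.2 - (f t₃).2.2))) := by
  obtain ⟨lt, h12, h23, h34, h4, e12, e34, g12, g34, ge, ge', -, -⟩ := H
  have mem := fun i (hi : i ≤ n) => ch_mem hf (by omega) hi
  have s₁ := Ch.seg hf (Nat.zero_le t₁) (by omega)
  have s₂ := ch_seg_region (R' := {z | l ≤ z.1 ∧ 0 ≤ z.2}) hf h12.le (by omega)
    fun i h1 h2 => ⟨ge i h1 (by omega), (mem i (by omega)).2⟩
  have s₃ := ch_seg_region (R' := {z | l ≤ z.1 ∧ 0 ≤ z.2}) hf h23 (by omega)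
    fun i h1 h2 => ⟨ge i (by omega) (by omega), (mem i (by omega)).2⟩
  have s₄ := ch_seg_region (R' := {z | l ≤ z.1 ∧ 0 ≤ z.2}) hf h34.le (by omega)
    fun i h1 h2 => ⟨ge i (by omega) (by omega), (mem i (by omega)).2⟩
  have s₅ := ch_seg_region (R' := {z | 0 ≤ z.1 ∧ 0 ≤ z.2}) hf h4 le_rfl
    fun i h1 h2 => mem i (by omega)
  generalize ed : (f t₂).2.2 - (f t₁).2.2 = d at *
  generalize ef : (f t₄).2.2 - (f t₃).2.2 = v at *
  obtain ⟨δ, hδ⟩ : ∃ δ, δ = l' - l := ⟨_, rfl⟩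
  rw [← hδ] at e12 e34
  have up : ∀ k : ℕ, Ch (S.nt.St quad) (k * (t₂ - t₁)) (f t₁)
      ((f t₁).1, (f t₁).2.1 + k * δ, (f t₁).2.2 + k * d) := fun k => by
    induction k with
    | zero => simpa using Ch.nil _
    | succ k ih =>
      have h1 := ch_shift_quad s₂ (k * δ) (k * d)
        (by have : 0 ≤ k * δ := mul_nonneg (by omega) (by omega)
            omega) (by positivity)
      rw [← g12, e12] at h1
      convert ih.append h1 using 3
      · ring
      · push_cast
        ring
      · push_cast
        linarith
  have down : ∀ j ≤ k, Ch (S.nt.St quad) (j * (t₄ - t₃))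
      ((f t₃).1, (f t₃).2.1 + k * δ, (f t₃).2.2 + k * d)
      ((f t₃).1, (f t₃).2.1 + (k - j) * δ, (f t₃).2.2 + k * d + j * v) := fun j => by
    induction j with
    | zero => exact fun _ => by simpa using Ch.nil _
    | succ j ih =>
      intro hj
      have h1 := ch_shift_quad s₄ ((k - j) * δ) (k * d + j * v)
        (by have : 0 ≤ ((k : ℤ) - j) * δ := mul_nonneg (by omega) (by omega)
            omega) (by
          have h1 : (j : ℤ) * (-v) ≤ j * d := by gcongr; linarith
          have h2 : (j : ℤ) * d ≤ k * d := by gcongr; omega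
          linarith)
      rw [← g34, ← add_assoc] at h1
      convert (ih (by omega)).append h1 using 3
      · ring
      · push_cast
        linarith
      · push_cast
        linarith
  have s₃' := ch_shift_quad s₃ (k * δ) (k * d)
    (by have : 0 ≤ k * δ := mul_nonneg (by omega) (by omega)
        omega) (by positivity)
  have s₂' := ch_shift_quad s₂ (k * δ) (k * d)
    (by have : 0 ≤ k * δ := mul_nonneg (by omega) (by omega)
        omega) (by positivity)
  have s₄' := ch_shift_quad s₄ 0 (k * d + k * v) (by linarith) (by
    have : 0 ≤ (k : ℤ) * (d + v) := by positivity
    linarith)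
  have s₅' := ch_shift_quad s₅ 0 (k * (d + v)) (by simp) (by positivity)
  have a₁ := down k le_rfl
  simp only [sub_self, zero_mul, add_zero] at a₁ s₅' s₄'
  rw [add_assoc] at a₁
  rw [mul_add] at s₅' ⊢
  exact ⟨_, (((((s₁.append (up k)).append s₂').append s₃').append a₁).append s₄').append s₅'⟩

/-- Removal of the two segments of a pair of levels. -/
theorem pair_remove {f : ℕ → Q × ℤ × ℤ} (hf : ∀ k < n, S.nt.St quad (f k) (f (k + 1)))
    {M l l' : ℤ} {t₁ t₂ t₃ t₄ : ℕ}
    (H : LevelPair (fun i => (f i).2.1) (fun i => (f i).1) n M l l' t₁ t₂ t₃ t₄)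
    (hl : 0 ≤ l) (hd : ∀ i, t₂ ≤ i → i ≤ t₃ → (f t₂).2.2 - (f t₁).2.2 ≤ (f i).2.2)
    (he : (f t₂).2.2 - (f t₁).2.2 + ((f t₄).2.2 - (f t₃).2.2) ≤ 0) :
    ∃ m < n, Ch (S.nt.St quad) m (f 0)
      ((f n).1, (f n).2.1, (f n).2.2 -
        ((f t₂).2.2 - (f t₁).2.2 + ((f t₄).2.2 - (f t₃).2.2))) := by
  obtain ⟨lt, h12, h23, h34, h4, e12, e34, g12, g34, ge, ge', -, -⟩ := H
  have mem := fun i (hi : i ≤ n) => ch_mem hf (by omega) hi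
  have s₁ := Ch.seg hf (Nat.zero_le t₁) (by omega)
  have s₃ := ch_seg_region (R' := {z | l' ≤ z.1 ∧ (f t₂).2.2 - (f t₁).2.2 ≤ z.2}) hf h23 (by omega)
    fun i h1 h2 => ⟨ge' i h1 h2, hd i h1 h2⟩
  have s₅ := ch_seg_region (R' := {z | 0 ≤ z.1 ∧ 0 ≤ z.2}) hf h4 le_rfl
    fun i h1 h2 => mem i (by omega)
  have s₃' := ch_shift_quad s₃ (-(l' - l)) (-((f t₂).2.2 - (f t₁).2.2)) (by linarith) (by linarith)
  have s₅' := ch_shift_quad s₅ 0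
    (-((f t₂).2.2 - (f t₁).2.2 + ((f t₄).2.2 - (f t₃).2.2))) (by simp) (by linarith)
  rw [← g12, e12, g34, e34] at s₃'
  have r₁ : (f t₂).2.2 + -((f t₂).2.2 - (f t₁).2.2) = (f t₁).2.2 := by ring
  have r₂ : (f t₄).2.2 + -((f t₂).2.2 - (f t₁).2.2 + ((f t₄).2.2 - (f t₃).2.2)) =
    (f t₃).2.2 + -((f t₂).2.2 - (f t₁).2.2) := by ring
  rw [r₁, add_neg_cancel_right, add_neg_cancel_right] at s₃'
  rw [r₂, add_zero, add_zero] at s₅'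
  exact ⟨t₁ - 0 + (t₃ - t₂) + (n - t₄), by omega, (s₁.append s₃').append s₅'⟩

end Sys

namespace Sys
variable {Q : Type} {S : Sys Q} {n : ℕ}

set_option maxHeartbeats 4000000 in
/-- Runs without zero tests between configurations with empty first counter and small second
counter can be shortened, if the second counter cannot become large at the target. -/
theorem real_exact : ∃ F, Pol F ∧ ∀ (Q : Type) [Fintype Q] (S : Sys Q) (x n : ℕ) (r r' : Q)
    (y y' : ℤ), Fintype.card Q ≤ x → S.Bdd x → y ≤ x →
    Ch (S.nt.St quad) n (r, 0, y) (r', 0, y') →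
    (∀ m y'', Ch (S.nt.St quad) m (r, 0, y) (r', 0, y'') → y'' ≤ x) →
    Cle (S.nt.St quad) (F x) (r, 0, y) (r', 0, y') := by
  classical
  obtain ⟨Fr, hFr, far⟩ := Wk.reachFar
  obtain ⟨Fn, hFn, near⟩ := Wk.near
  obtain ⟨Fl, hFl, low⟩ := rlx_low
  obtain ⟨Fs, hFs, strip_low⟩ := strip_low
  obtain ⟨A, eA⟩ : ∃ A : ℕ → ℕ, A = fun x => Fr x + x * Fn (Fr x + x) + x + 1 := ⟨_, rfl⟩
  obtain ⟨K, eK⟩ : ∃ K : ℕ → ℕ, K = fun x => 2 * (x * Fl (A x + x + x)) + x + 1 := ⟨_, rfl⟩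
  obtain ⟨A₂, eA₂⟩ : ∃ A₂ : ℕ → ℕ, A₂ = fun x => A x + x + (K x + 1) * Fr x := ⟨_, rfl⟩
  obtain ⟨B, eB⟩ : ∃ B : ℕ → ℕ, B = fun x =>
    A₂ x + ((x * (A x + 1)) * (x + 1)) ^ 2 * (2 * x + 1) + 1 := ⟨_, rfl⟩
  refine ⟨fun x => Fs (B x + x), by simp only [eB, eA₂, eK, eA]; fun_prop,
    fun Q _ S x n r r' y y' hQ hS hy h hmax => ?_⟩
  beta_reduce
  obtain ⟨n, -, ⟨f, f0, fn, hf⟩, hmin⟩ := h.minimal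
  rcases Nat.eq_zero_or_pos n with rfl | hn0
  · exact ⟨0, by omega, f, f0, fn, hf⟩
  have mem := fun i (hi : i ≤ n) => ch_mem hf hn0 hi
  have hmax' : ∀ {m z}, Ch (S.nt.St quad) m (f 0) ((f n).1, (f n).2.1, z) → z ≤ x :=
    fun {m z} h => by
    rw [f0, fn] at h
    exact hmax _ _ h
  have nearb : ∀ t ≤ n, ∀ {m b}, Ch (S.nt.St quad) m (f 0) ((f t).1, (f t).2.1, b) →
      b ≤ (f t).2.2 + x := fun t ht m b h => by
    by_contra! hlt
    have h1 := ch_seg_region (R' := {z | 0 ≤ z.1 ∧ 0 ≤ z.2}) hf ht le_rfl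
      fun i h1 h2 => mem i (by omega)
    have h2 := ch_shift_quad h1 0 (b - (f t).2.2) (by simp) (by linarith)
    rw [add_zero, add_sub_cancel] at h2
    have h3 := h.append h2
    rw [add_zero] at h3
    have h4 := hmax' h3
    have := (mem n le_rfl).2
    linarith
  have hA : (A x : ℤ) = Fr x + x * Fn (Fr x + x) + x + 1 := by simp [eA]
  have hK : (K x : ℤ) = 2 * (x * Fl (A x + x + x)) + x + 1 := by simp [eK]
  have hA₂ : (A₂ x : ℤ) = A x + x + (K x + 1) * Fr x := by simp [eA₂]
  have hnn₁ : (0 : ℤ) ≤ x * Fn (Fr x + x) := by positivity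
  have hnn₂ : (0 : ℤ) ≤ x * Fl (A x + x + x) := by positivity
  have hnn₃ : (0 : ℤ) ≤ ((K x : ℤ) + 1) * Fr x := by positivity
  by_cases hT : ∃ T ≤ n, (B x : ℤ) ≤ (f T).2.1
  · exfalso
    obtain ⟨T, hTn, hT⟩ := hT
    let g : ℕ → Q × ℤ := fun i => ((f i).1, min (f i).2.2 (A x))
    have hW : (A₂ x : ℤ) + ((((Finset.univ ×ˢ Finset.Icc (0 : ℤ) (A x) : Finset (Q × ℤ)).card *
        (x + 1)) ^ 2 * (2 * x + 1) : ℕ) : ℤ) < B x := by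
      simp only [eB]
      norm_cast
      rw [Nat.lt_succ_iff, Finset.card_product, Finset.card_univ, Int.card_Icc]
      gcongr
      omega
    have hAB : A₂ x ≤ B x := by
      simp only [eB]
      omega
    obtain ⟨τ, σ, Lv, hLv, hsub, hτσ, hpair⟩ := levels_fiber (fun i => (f i).2.1) (M := 0) (N := x)
      hTn (by simp [f0]) (by simp [fn]) (fun i hi => ((hf i hi).bdd hS.nt).1) g
      (Finset.univ ×ˢ Finset.Icc (0 : ℤ) (A x)) (fun i hi => by
        have := (mem i hi).2
        simp only [g, Finset.mem_product, Finset.mem_univ, Finset.mem_Icc, true_and]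
        omega) (A := A₂ x) (B := B x) (by positivity) hT (K := 2 * x + 1) hW
    obtain ⟨t₀, ht₀, hAt₀, ht₀A, hlast⟩ : ∃ t₀ ≤ n, (A x : ℤ) ≤ (f t₀).2.1 ∧
        (f t₀).2.1 ≤ A x + x ∧ ∀ t ≤ n, (A x : ℤ) ≤ (f t).2.1 → t ≤ t₀ := by
      refine ⟨Nat.findGreatest (fun t => (A x : ℤ) ≤ (f t).2.1) n, Nat.findGreatest_le _,
        Nat.findGreatest_spec (P := fun t => (A x : ℤ) ≤ (f t).2.1) hTn (by omega), ?_,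
        fun t ht h => Nat.le_findGreatest ht h⟩
      by_contra! hlt
      set t₀ := Nat.findGreatest (fun t => (A x : ℤ) ≤ (f t).2.1) n with ht₀
      have h1 : t₀ ≤ n := Nat.findGreatest_le _
      rcases h1.lt_or_eq with h1 | h1
      · have h2 := abs_le.1 ((hf t₀ h1).bdd hS.nt).1
        have := Nat.le_findGreatest (P := fun t => (A x : ℤ) ≤ (f t).2.1) (show t₀ + 1 ≤ n from h1)
          (by linarith)
        omega
      · rw [h1, fn] at hlt
        simp only at hlt
        omega
    obtain ⟨yy, m₀, hm₀, hend⟩ := low Q S.nt (A x + x + x) _ _ _ (by omega) (hS.nt.mono (by omega))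
      (by push_cast; linarith) (by rw [fn]; positivity)
      ((Ch.seg hf ht₀ le_rfl).mono fun _ _ h => h.mono fun _ h => h.1)
    have hyy := abs_le.1 (ch_bdd hS.nt hend).2
    have hm₀' : (x : ℤ) * m₀ ≤ x * Fl (A x + x + x) := by gcongr
    have h1 := card_le_of_close Lv (fun l => (f (σ l)).2.2 - (f (τ l)).2.2) x
      fun l hl l' hl' hll => by
        have H := hpair l hl l' hl' hll
        have H' : LevelPair (fun i => (f i).2.1) (fun i => (f i).1) n x l l' (τ l) (τ l') (σ l')
          (σ l) := H.congr fun i j (h : g i = g j) =>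
            (congrArg Prod.fst h : (g i).1 = (g j).1)
        have hl1 := Finset.mem_Ioc.1 (hsub hl)
        have m₁ : min (f (τ l)).2.2 (A x) = min (f (τ l')).2.2 (A x) := congrArg Prod.snd H.g12
        have m₂ : min (f (σ l')).2.2 (A x) = min (f (σ l)).2.2 (A x) := congrArg Prod.snd H.g34
        obtain ⟨lt, h12, h23, h34, h4, e12, e34, g12, g34, ge, ge', le1, le4⟩ := id H'
        obtain ⟨e, he⟩ : ∃ e, e = (f (τ l')).2.2 - (f (τ l)).2.2 +
          ((f (σ l)).2.2 - (f (σ l')).2.2) := ⟨_, rfl⟩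
        have he0 : e ≤ 0 := by
          by_contra! he0
          by_cases hd : 0 ≤ (f (τ l')).2.2 - (f (τ l)).2.2
          · obtain ⟨m, h⟩ := pair_pump hf H' (by omega) hd (by omega) (x + 1)
            rw [← he] at h
            have h1 := hmax' h
            have h2 := (mem n le_rfl).2
            push_cast at h1
            nlinarith
          · have w₁ := Wk.ofCh' (Ch.seg hf h34.le h4)
            rw [g34] at w₁
            have hσt : σ l ≤ t₀ := hlast _ h4 (by have := ge (σ l) (by omega) le_rfl; omega)
            have w₂ := Wk.ofCh' (Ch.seg hf hσt ht₀)
            have hge := ge (σ l) (by omega) le_rfl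
            obtain ⟨k, b, hb, h1⟩ := far Q S x _ _ (K x) _ _ _ _ _ _ (-1) (f (σ l)).2.1
              (f (σ l)).2.2 hQ hS (by simp) w₁ w₂ (by simp only [Prod.fst_sub]; linarith)
              (by simp only [Prod.snd_sub]; omega)
              (by simp only [Prod.fst_sub]; push_cast; linarith) (by linarith)
              (by simp only [Prod.fst_sub]; linarith) (by omega)
            simp only [Prod.fst_sub, add_sub_cancel] at h1
            have h2 := ch_vshift hS.nt hend (b - (f t₀).2.2) (by
              have : (A x : ℤ) ≤ (f (σ l)).2.2 := by omega
              linarith)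
            rw [add_sub_cancel] at h2
            have h3 := hmax' (((Ch.seg hf (Nat.zero_le _) h4).append h1).append h2)
            have : (A x : ℤ) ≤ (f (σ l)).2.2 := by omega
            simp only at hyy
            linarith [hyy.1]
        have hd : ∀ i, τ l' ≤ i → i ≤ σ l' → (f (τ l')).2.2 - (f (τ l)).2.2 ≤ (f i).2.2 := by
          intro i hi hi'
          have hbi := (mem i (by omega)).2
          by_contra! hlt
          have hd : (A x : ℤ) ≤ (f (τ l)).2.2 := by omega
          have hai := ge' i hi hi'
          have haτ := ge' (τ l') le_rfl h23
          have w₁ := Wk.ofCh' (Ch.seg hf h12.le (by omega))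
          rw [← g12] at w₁
          have w₂ := Wk.ofCh' (Ch.seg hf hi (by omega))
          rw [← g12] at w₂
          have pre := Ch.seg hf (Nat.zero_le (τ l')) (by omega)
          rw [show f (τ l') = ((f (τ l)).1, (f (τ l')).2.1, (f (τ l')).2.2) from
            Prod.ext g12.symm rfl] at pre
          obtain ⟨m, b, hb, h⟩ : ∃ m b, (f (τ l')).2.2 - Fr x - x * Fn (Fr x + x) ≤ b ∧
              Ch (S.nt.St quad) m (f 0) ((f i).1, (f i).2.1, b) := by
            rcases le_or_gt (Fr x : ℤ) ((f i).2.1 - (f (τ l')).2.1) with hD | hD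
            · obtain ⟨k, b, hb, h1⟩ := far Q S x _ _ 0 _ _ _ _ _ _ 1 (f (τ l')).2.1
                (f (τ l')).2.2 hQ hS (by simp) w₁ w₂ (by simp only [Prod.fst_sub]; linarith)
                (by simp only [Prod.snd_sub]; omega)
                (by simp only [Prod.fst_sub]; push_cast; linarith) (by linarith)
                (by simp only [Prod.fst_sub]; linarith) (by omega)
              simp only [Prod.fst_sub, add_sub_cancel] at h1
              exact ⟨_, b, by push_cast at hb; linarith, pre.append h1⟩
            · obtain ⟨m, y₀, hm, h1⟩ := near Q S (Fr x + x) _ _ _ _ _ (by omega)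
                (hS.mono (by omega)) (by
                  simp only [Prod.fst_sub, abs_le]
                  push_cast
                  constructor <;> linarith) w₂
              have hm' : (x : ℤ) * m ≤ x * Fn (Fr x + x) := by gcongr
              have h2 := h1.toCh_quad hS (z := ((f (τ l')).2.1, (f (τ l')).2.2)) (by
                simp only
                linarith) (by
                simp only
                linarith)
              simp only [Prod.mk_add_mk, Prod.fst_sub, add_sub_cancel] at h2
              refine ⟨_, _, ?_, pre.append h2⟩
              have := abs_le.1 (h1.bdd hS).2
              simp only at this
              linarith [this.1]
          have := nearb i (by omega) h
          linarith
        obtain ⟨m, hm, h⟩ := pair_remove hf H' (by omega) hd (by omega)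
        rw [← he] at h
        have h1 := hmax' h
        have h2 := (mem n le_rfl).2
        rw [abs_le]
        refine ⟨fun h' => ?_, ?_, ?_⟩
        · rw [show e = 0 by linarith, sub_zero, f0, fn] at h
          have := hmin _ h
          omega
        · linarith
        · linarith
    omega
  · push Not at hT
    obtain ⟨k, hk, h1⟩ := strip_low Q S (B x + x) (B x) n (f 0) (f n) (by omega)
      (hS.mono (by omega)) (by omega) (by rw [f0]; push_cast; linarith)
      (by rw [fn]; push_cast; linarith [hmax _ _ h])
      (by simpa using ch_seg_region (R' := strip (B x)) hf (Nat.zero_le n) le_rfl fun i _ hi =>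
        ⟨⟨(mem i hi).1, (hT i hi).le⟩, (mem i hi).2⟩)
    rw [f0, fn] at h1
    exact ⟨k, hk, ch_mono strip_quad h1⟩

end Sys

namespace Sys
variable {Q : Type} {S : Sys Q} {n N : ℕ} {p q r : Q} {a b y y' : ℤ}

/-- `S.Lb p q a` holds if the second counter changes by `a` along a run from `p` to `q` between
configurations with empty first counter, with the second counter ranging over the integers. -/
def Lb (S : Sys Q) (p q : Q) (a : ℤ) : Prop := ∃ m, Ch (S.St half) m (p, 0, 0) (q, 0, a)

theorem Lb.nil (S : Sys Q) (p : Q) : S.Lb p p 0 := ⟨0, Ch.nil _⟩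

theorem Lb.add (h : S.Lb p q a) (h' : S.Lb q r b) : S.Lb p r (a + b) := by
  obtain ⟨m, h⟩ := h
  obtain ⟨m', h'⟩ := h'
  have := ch_vshift_half h' a
  simp only [zero_add, add_comm b a] at this
  exact ⟨_, h.append this⟩

theorem Lb.nsmul (h : S.Lb p p a) (k : ℕ) : S.Lb p p (k * a) := by
  induction k with
  | zero => simpa using Lb.nil S p
  | succ k ih => simpa [add_mul] using ih.add h

theorem lb_of_half (h : Ch (S.St half) n (p, 0, y) (q, 0, y')) : S.Lb p q (y' - y) := by
  have := ch_vshift_half h (-y)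
  simp only [add_neg_cancel, ← sub_eq_add_neg] at this
  exact ⟨_, this⟩

theorem lb_of_quad (h : Ch (S.St quad) n (p, 0, y) (q, 0, y')) : S.Lb p q (y' - y) :=
  lb_of_half (ch_mono (fun _ h => h.1) h)

theorem Lb.rev (h : S.Lb p q a) : S.rev.Lb q p (-a) := by
  obtain ⟨m, h⟩ := h
  simpa using lb_of_half (ch_rev h)

theorem Lb.unrev (h : S.rev.Lb p q a) : S.Lb q p (-a) := by
  simpa using h.rev

/-- If closed runs of both signs exist, then the effects of closed runs form a group. -/
theorem Lb.neg {w : ℤ} (h : S.Lb p p w) (ha : S.Lb p p a) (hb : S.Lb p p b) (ha0 : 0 < a)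
    (hb0 : b < 0) : S.Lb p p (-w) := by
  rcases lt_trichotomy w 0 with h0 | rfl | h0
  · obtain ⟨k, hk⟩ := Int.eq_ofNat_of_zero_le (show 0 ≤ -w by omega)
    obtain ⟨l, hl⟩ := Int.eq_ofNat_of_zero_le (show 0 ≤ a - 1 by omega)
    have := (ha.nsmul k).add (h.nsmul l)
    rwa [← hk, ← hl, show -w * a + (a - 1) * w = -w by ring] at this
  · simpa using h
  · obtain ⟨k, hk⟩ := Int.eq_ofNat_of_zero_le h0.le
    obtain ⟨l, hl⟩ := Int.eq_ofNat_of_zero_le (show 0 ≤ -b - 1 by omega)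
    have := (hb.nsmul k).add (h.nsmul l)
    rwa [← hk, ← hl, show w * b + (-b - 1) * w = -w by ring] at this

/-- The system that also keeps track of the residue of the second counter. -/
def resSys (S : Sys Q) (g : ℕ) : Sys (Q × ZMod g) :=
  ⟨fun p a b q => S.A p.1 a b q.1 ∧ q.2 = p.2 + b, fun p q => S.Z p.1 q.1 ∧ q.2 = p.2⟩

theorem Lb.residue : ∃ F, Pol F ∧ ∀ (Q : Type) [Fintype Q] (S : Sys Q) (x g : ℕ) (p q : Q) (a : ℤ),
    Fintype.card Q ≤ x → S.Bdd x → 0 < g → g ≤ x → S.Lb p q a →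
    ∃ b, (g : ℤ) ∣ b - a ∧ |b| ≤ F x ∧ Cle (S.St half) (F x) (p, 0, 0) (q, 0, b) := by
  obtain ⟨F, hF, low⟩ := rlx_low
  refine ⟨fun x => (x + 1) * F (x + x * x), by fun_prop,
    fun Q _ S x g p q a hQ hS hg hgx ⟨n, h⟩ => ?_⟩
  beta_reduce
  have : NeZero g := ⟨hg.ne'⟩
  have h1 : Ch ((S.resSys g).St half) n ((p, ((0 : ℤ) : ZMod g)), 0, 0) ((q, (a : ZMod g)), 0, a) :=
    h.map (fun c : Q × ℤ × ℤ => ((c.1, (c.2.2 : ZMod g)), c.2.1, c.2.2)) fun c c' h => by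
      refine ⟨h.1.imp (fun h => ⟨h, by simp⟩) fun h => ⟨⟨h.1, by simp [h.2.2.2]⟩, h.2⟩, h.2⟩
  obtain ⟨b, k, hk, h2⟩ := low _ (S.resSys g) (x + x * x) n _ _ (by
      rw [Fintype.card_prod, ZMod.card]
      have : Fintype.card Q * g ≤ x * x := by gcongr
      omega) (fun p a b q h => by
      have := hS _ _ _ _ h.1
      push_cast
      constructor <;> nlinarith) (by simp only; positivity) (by simp only; positivity) h1
  simp only at h2
  have h3 := h2.inv (P := fun c : (Q × ZMod g) × ℤ × ℤ => c.1.2 = c.2.2) (fun c c' h h' => by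
    rcases h.1 with ⟨-, h⟩ | ⟨⟨-, h⟩, -, -, h2⟩
    · rw [h, h']
      simp
    · rw [h, h', h2]) (by simp)
  simp only at h3
  have h4 : Ch (S.St half) k (p, 0, 0) (q, 0, b) :=
    h2.map (fun c : (Q × ZMod g) × ℤ × ℤ => (c.1.1, c.2)) fun c c' h =>
      ⟨h.1.imp (fun h => h.1) fun h => ⟨h.1.1, h.2⟩, h.2⟩
  refine ⟨b, ?_, ?_, k, hk.trans (by nlinarith), h4⟩
  · rw [← ZMod.intCast_zmod_eq_zero_iff_dvd]
    simp [h3]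
  · have h5 := (ch_bdd hS h4).2
    simp only [sub_zero] at h5
    have : (x : ℤ) * k ≤ (x + 1 : ℤ) * F (x + x * x) := by gcongr; omega
    push_cast
    linarith

theorem posLoop_lb : ∃ F, Pol F ∧ ∀ (Q : Type) [Fintype Q] (S : Sys Q) (x : ℕ) (p : Q) (a : ℤ),
    Fintype.card Q ≤ x → S.Bdd x → 0 < a → S.Lb p p a →
    ∃ b : ℕ, 0 < b ∧ b ≤ F x ∧ Cle (S.St half) (F x) (p, 0, 0) (p, 0, (b : ℤ)) := by
  obtain ⟨F, hF, pos⟩ := posLoop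
  refine ⟨fun x => (x + 1) * F x, by fun_prop, fun Q _ S x p a hQ hS ha ⟨n, h⟩ => ?_⟩
  beta_reduce
  obtain ⟨b, hb, k, hk, h1⟩ := pos Q S x n p a hQ hS ha h
  lift b to ℕ using hb.le
  refine ⟨b, by omega, ?_, k, hk.trans (by nlinarith), h1⟩
  have h2 := (abs_le.1 (ch_bdd hS h1).2).2
  simp only [sub_zero] at h2
  norm_cast at h2
  have : x * k ≤ (x + 1) * F x := by gcongr; omega
  omega

theorem negLoop_lb : ∃ F, Pol F ∧ ∀ (Q : Type) [Fintype Q] (S : Sys Q) (x : ℕ) (p : Q) (a : ℤ),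
    Fintype.card Q ≤ x → S.Bdd x → a < 0 → S.Lb p p a →
    ∃ b : ℕ, 0 < b ∧ b ≤ F x ∧ Cle (S.St half) (F x) (p, 0, 0) (p, 0, -(b : ℤ)) := by
  obtain ⟨F, hF, pos⟩ := posLoop_lb
  refine ⟨F, hF, fun Q _ S x p a hQ hS ha h => ?_⟩
  obtain ⟨b, hb, hb', k, hk, h1⟩ := pos Q S.rev x p (-a) hQ hS.rev (by omega) h.rev
  refine ⟨b, hb, hb', k, hk, ?_⟩
  simpa using ch_vshift_half (ch_unrev h1) (-b)

theorem Flat.loop {L m : ℕ} {p : Q} {b y : ℤ} (hS : S.Bdd N)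
    (h : Cle (S.St half) L (p, 0, 0) (p, 0, b)) (hy : N * L ≤ y) (hy' : N * L ≤ y + m * b) :
    S.Flat 1 L (p, 0, y) (p, 0, y + m * b) := by
  obtain ⟨n, hn, h⟩ := h
  have hNn : (N : ℤ) * n ≤ N * L := by gcongr
  have h1 := ch_vshift hS h (N * L) (by simpa using hNn)
  rw [zero_add, add_comm b] at h1
  refine (Flat.starT h1 fun i hi => ?_).mono le_rfl hn
  have h0 : (i : ℤ) + 1 ≤ m := by exact_mod_cast hi
  rcases le_total 0 b with hb | hb
  · nlinarith
  · nlinarith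

theorem Flat.ofHalf {L : ℕ} {p q : Q} {b y : ℤ} (hS : S.Bdd N)
    (h : Cle (S.St half) L (p, 0, 0) (q, 0, b)) (hy : N * L ≤ y) :
    S.Flat 0 L (p, 0, y) (q, 0, y + b) := by
  obtain ⟨n, hn, h⟩ := h
  have hNn : (N : ℤ) * n ≤ N * L := by gcongr
  have h1 := ch_vshift hS h y (by simp only; linarith)
  rw [zero_add, add_comm b] at h1
  exact Flat.ofCle ⟨n, hn, h1⟩

end Sys

namespace Sys

theorem high_neg : ∃ F, Pol F ∧ ∀ (Q : Type) [Fintype Q] (S : Sys Q) (x : ℕ) (p q : Q)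
    (y y' u : ℤ), Fintype.card Q ≤ x → S.Bdd x → S.Lb p q (y' - y) → S.Lb q p u →
    (∀ a, S.Lb p p a → a ≤ 0) → F x ≤ y → F x ≤ y' → S.Flat 1 (F x) (p, 0, y) (q, 0, y') := by
  obtain ⟨R, hR, res⟩ := Lb.residue
  obtain ⟨G, hG, neg⟩ := negLoop_lb
  obtain ⟨H, hH, exact⟩ := rlx_exact
  refine ⟨fun x => (x + 1) * (H (x + R x + (R x + R (x + G x))) + G x + R (x + G x) + R (x + G x)),
    by fun_prop, fun Q _ S x p q y y' u hQ hS hl hu hneg hy hy' => ?_⟩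
  beta_reduce at *
  obtain ⟨P, hP⟩ : ∃ P, P = R x + R (x + G x) := ⟨_, rfl⟩
  have hx : 0 < x := (Fintype.card_pos_iff.2 ⟨p⟩).trans_le hQ
  obtain ⟨v, -, hv, kv, -, hv'⟩ := res Q S x 1 q p u hQ hS one_pos hx hu
  have hv' : S.Lb q p v := ⟨kv, hv'⟩
  rw [abs_le] at hv
  rw [← hP] at hy hy' ⊢
  push_cast at hy hy'
  have e₁ : (0 : ℤ) ≤ x * G x := by positivity
  have e₂ : (0 : ℤ) ≤ x * R (x + G x) := by positivity
  have e₃ : (0 : ℤ) ≤ x * H (x + R x + P) := by positivity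
  by_cases hlow : -(P : ℤ) ≤ y' - y
  · obtain ⟨n, hl'⟩ := hl
    have h1 := exact Q S (x + R x + P) n p q _ (by omega) (hS.mono (by omega)) hl'
      fun m a ha => by
        have := hneg _ (Lb.add ⟨m, ha⟩ hv')
        push_cast
        linarith
    have h2 := Flat.ofHalf hS h1 (y := y) (by linarith)
    rw [add_sub_cancel] at h2
    exact h2.mono (by omega) (by nlinarith)
  · push Not at hlow
    obtain ⟨g, hg, hg', loop⟩ := neg Q S x p _ hQ hS (by subst hP; push_cast at hlow; linarith)
      (hl.add hv')
    obtain ⟨s, ⟨k, hk⟩, hs, path⟩ := res Q S (x + G x) g p q _ (by omega) (hS.mono (by omega)) hg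
      (by omega) hl
    rw [abs_le] at hs
    subst hP
    push_cast at hlow
    have hk0 : 0 ≤ k := by
      by_contra! hk0
      have : (g : ℤ) * k ≤ 0 := mul_nonpos_of_nonneg_of_nonpos (by positivity) hk0.le
      linarith
    lift k to ℕ using hk0
    have e : y + k * -(g : ℤ) = y' - s := by linarith
    have h1 := Flat.loop hS loop (y := y) (m := k) (by linarith) (by rw [e]; linarith)
    have h2 := Flat.ofHalf hS path (y := y' - s) (by linarith)
    rw [e] at h1
    rw [sub_add_cancel] at h2
    exact (h1.append h2).mono (by omega) (by nlinarith)

theorem high_both : ∃ F, Pol F ∧ ∀ (Q : Type) [Fintype Q] (S : Sys Q) (x : ℕ) (p q : Q)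
    (y y' a b : ℤ), Fintype.card Q ≤ x → S.Bdd x → S.Lb p q (y' - y) → S.Lb p p a → S.Lb p p b →
    0 < a → b < 0 → F x ≤ y → F x ≤ y' → S.Flat 2 (F x) (p, 0, y) (q, 0, y') := by
  obtain ⟨R, hR, res⟩ := Lb.residue
  obtain ⟨G, hG, neg⟩ := negLoop_lb
  obtain ⟨G', hG', pos⟩ := posLoop_lb
  refine ⟨fun x => (x + 1) * (G x + G' x + R (x + G' x) + R (x + G' x)),
    by fun_prop, fun Q _ S x p q y y' a b hQ hS hl ha hb ha0 hb0 hy hy' => ?_⟩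
  beta_reduce at *
  obtain ⟨g, hg, hg', loop⟩ := neg Q S x p _ hQ hS hb0 hb
  obtain ⟨g', hg0', hgg', loop'⟩ := pos Q S x p _ hQ hS ha0 ha
  obtain ⟨s, ⟨t, ht⟩, hs, path⟩ := res Q S (x + G' x) g' p q _ (by omega) (hS.mono (by omega)) hg0'
    (by omega) hl
  rw [abs_le] at hs
  push_cast at hy hy'
  have e₁ : (0 : ℤ) ≤ x * G x := by positivity
  have e₂ : (0 : ℤ) ≤ x * R (x + G' x) := by positivity
  have e₃ : (0 : ℤ) ≤ x * G' x := by positivity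
  obtain ⟨k, hk⟩ : ∃ k : ℕ, (k : ℤ) = -t + t.natAbs * g := by
    refine ⟨(-t + t.natAbs * g : ℤ).toNat, Int.toNat_of_nonneg ?_⟩
    have : (1 : ℤ) ≤ g := by exact_mod_cast hg
    nlinarith [Int.le_natAbs (a := t), Int.natCast_nonneg t.natAbs]
  have e : y + k * (g' : ℤ) + ((t.natAbs * g' : ℕ) : ℤ) * -(g : ℤ) = y' - s := by
    rw [hk]
    push_cast
    linarith
  have e' : 0 ≤ (k : ℤ) * g' := by positivity
  have h1 := Flat.loop hS loop' (y := y) (m := k) (by linarith) (by linarith)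
  have h2 := Flat.loop hS loop (y := y + k * (g' : ℤ)) (m := t.natAbs * g') (by linarith)
    (by rw [e]; linarith)
  have h3 := Flat.ofHalf hS path (y := y' - s) (by linarith)
  rw [e] at h2
  rw [sub_add_cancel] at h3
  exact ((h1.append h2).append h3).mono (by omega) (by nlinarith)

/-- Flat runs between configurations with empty first counter and large second counter. -/
theorem high_flat : ∃ F, Pol F ∧ ∀ (Q : Type) [Fintype Q] (S : Sys Q) (x : ℕ) (p q : Q)
    (y y' u : ℤ), Fintype.card Q ≤ x → S.Bdd x → S.Lb p q (y' - y) → S.Lb q p u →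
    F x ≤ y → F x ≤ y' → S.Flat 2 (F x) (p, 0, y) (q, 0, y') := by
  obtain ⟨F, hF, neg⟩ := high_neg
  obtain ⟨G, hG, both⟩ := high_both
  refine ⟨fun x => F x + G x, by fun_prop, fun Q _ S x p q y y' u hQ hS hl hu hy hy' => ?_⟩
  beta_reduce at *
  push_cast at hy hy'
  by_cases h1 : ∀ a, S.Lb p p a → a ≤ 0
  · exact (neg Q S x p q y y' u hQ hS hl hu h1 (by linarith) (by linarith)).mono (by omega)
      (by omega)
  push Not at h1
  obtain ⟨a, ha, ha0⟩ := h1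
  by_cases h2 : ∀ b, S.Lb p p b → 0 ≤ b
  · refine (Flat.unrev (neg Q S.rev x q p y' y (-u) hQ hS.rev (by simpa using hl.rev) hu.rev
      (fun w hw => ?_) (by linarith) (by linarith))).mono (by omega) (by omega)
    by_contra! hw0
    have h3 := h2 _ ((hl.add (hw.unrev.nsmul ((y' - y).natAbs + u.natAbs + 1))).add hu)
    push_cast at h3
    nlinarith [le_abs_self (y' - y), le_abs_self u, abs_nonneg (y' - y), abs_nonneg u]
  · push Not at h2
    obtain ⟨b, hb, hb0⟩ := h2
    exact (both Q S x p q y y' a b hQ hS hl ha hb ha0 hb0 (by linarith) (by linarith)).mono le_rfl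
      (by omega)

end Sys

namespace Sys
variable {Q : Type} {S : Sys Q} {n N : ℕ} {a b : Q × ℤ}

/-- The configuration with empty first counter. -/
def ax (a : Q × ℤ) : Q × ℤ × ℤ := (a.1, 0, a.2)

/-- A run without zero tests, or a single zero test, between configurations with empty first
counter. -/
def Mac (S : Sys Q) (a b : Q × ℤ) : Prop :=
  0 ≤ a.2 ∧ 0 ≤ b.2 ∧ ((∃ n, Ch (S.nt.St quad) n (ax a) (ax b)) ∨ (S.Z a.1 b.1 ∧ a.2 = b.2))

theorem Mac.test (h : S.Mac a b) (hZ : S.Z a.1 b.1 ∧ a.2 = b.2) : S.St quad (ax a) (ax b) :=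
  ⟨Or.inr ⟨hZ.1, rfl, rfl, hZ.2.symm⟩, ⟨le_rfl, h.1⟩, ⟨le_rfl, h.2.1⟩⟩

theorem Mac.ch (h : S.Mac a b) : ∃ n, Ch (S.St quad) n (ax a) (ax b) := by
  rcases h.2.2 with ⟨n, h1⟩ | h1
  · exact ⟨n, ch_ofNt h1⟩
  · exact ⟨1, Ch.single (h.test h1)⟩

theorem Mac.rev (h : S.Mac a b) : S.rev.Mac b a := by
  refine ⟨h.2.1, h.1, h.2.2.imp ?_ fun h => ⟨h.1, h.2.symm⟩⟩
  rintro ⟨n, h⟩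
  exact ⟨n, by simpa using ch_rev h⟩

theorem ch_ofMac (h : Ch S.Mac n a b) : ∃ m, Ch (S.St quad) m (ax a) (ax b) := by
  induction n generalizing a with
  | zero => exact ⟨0, h.zero ▸ Ch.nil _⟩
  | succ n ih =>
    obtain ⟨c, h1, h2⟩ := h.succ
    obtain ⟨m, h1⟩ := h1.ch
    obtain ⟨m', h2⟩ := ih h2
    exact ⟨_, h1.append h2⟩

theorem lb_ofMac (h : Ch S.Mac n a b) : S.Lb a.1 b.1 (b.2 - a.2) :=
  lb_of_quad (ch_ofMac h).choose_spec

theorem mac_flat : ∃ F, Pol F ∧ ∀ (Q : Type) [Fintype Q] (S : Sys Q) (x : ℕ) (a b : Q × ℤ),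
    Fintype.card Q ≤ x → S.Bdd x → S.Mac a b →
    S.Flat (4 * Fintype.card Q + 2) (F x) (ax a) (ax b) := by
  obtain ⟨F, hF, flat⟩ := nt_flat
  refine ⟨fun x => F x + 1, by fun_prop, fun Q _ S x a b hQ hS h => ?_⟩
  beta_reduce
  rcases h.2.2 with ⟨n, h1⟩ | h1
  · exact (flat Q S x n _ _ hQ hS h1).ofNt.mono le_rfl (by omega)
  · exact (Flat.path (Ch.single (h.test h1))).mono (by omega) (by omega)

/-- A `Mac` step from a small configuration whose target state cannot be reached with a large
second counter. -/
def Lo (S : Sys Q) (D E : ℤ) (a b : Q × ℤ) : Prop :=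
  a.2 < D ∧ S.Mac a b ∧ ∀ n y, Ch (S.nt.St quad) n (ax a) (ax (b.1, y)) → y ≤ E

theorem lo_low : ∃ F, Pol F ∧ ∀ (Q : Type) [Fintype Q] (S : Sys Q) (x n : ℕ) (D E : ℤ)
    (a b : Q × ℤ), Fintype.card Q ≤ x → S.Bdd x → D ≤ x → E ≤ x → Ch (S.Lo D E) n a b →
    Cle (S.St quad) (F x) (ax a) (ax b) := by
  obtain ⟨F, hF, exact⟩ := real_exact
  refine ⟨fun x => x * (x + 1) * (F x + 1), by fun_prop,
    fun Q _ S x n D E a b hQ hS hD hE h => ?_⟩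
  beta_reduce
  obtain ⟨k, hk, h1⟩ := h.short (Finset.univ ×ˢ Finset.Icc (0 : ℤ) x) (by
    rintro a b ⟨h1, h2, h3⟩
    simp only [Finset.mem_product, Finset.mem_univ, Finset.mem_Icc, true_and]
    refine ⟨h2.2.1, ?_⟩
    rcases h2.2.2 with ⟨n, h⟩ | h
    · exact (h3 n _ h).trans hE
    · linarith [h.2])
  simp only [Finset.card_product, Finset.card_univ, Int.card_Icc, sub_zero] at hk
  have h2 := (h1.map (r' := fun c c' => Cle (S.St quad) (F x + 1) c c') ax fun a b h => by
    obtain ⟨h1, h2, h3⟩ := h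
    rcases h2.2.2 with ⟨n, h⟩ | h
    · exact ((exact Q S x n a.1 b.1 a.2 b.2 hQ hS (by linarith) h
        fun m y hy => (h3 m y hy).trans hE).mono (by omega)).map id fun _ _ h => h.ofNt
    · exact (Ch.single (h2.test h)).cle.mono (by omega)).flatten fun _ _ h => h
  refine h2.mono ?_
  gcongr
  refine hk.trans ?_
  gcongr
  omega

theorem mac_prefix {D E : ℤ} (h : Ch S.Mac n a b) : (∃ k, Ch (S.Lo D E) k a b) ∨
    (∃ k j c, Ch (S.Lo D E) k a c ∧ D ≤ c.2 ∧ Ch S.Mac j c b) ∨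
    ∃ k j m y c c', Ch (S.Lo D E) k a c ∧ S.Mac c c' ∧ Ch S.Mac j c' b ∧
      Ch (S.nt.St quad) m (ax c) (ax (c'.1, y)) ∧ E < y := by
  induction n generalizing a with
  | zero => exact Or.inl ⟨0, h.zero ▸ Ch.nil _⟩
  | succ n ih =>
    by_cases hD : D ≤ a.2
    · exact Or.inr (Or.inl ⟨0, _, a, Ch.nil _, hD, h⟩)
    obtain ⟨c, h1, h2⟩ := h.succ
    by_cases hE : ∀ n y, Ch (S.nt.St quad) n (ax a) (ax (c.1, y)) → y ≤ E
    · have h3 : S.Lo D E a c := ⟨not_le.1 hD, h1, hE⟩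
      rcases ih h2 with ⟨k, h4⟩ | ⟨k, j, d, h4, h5⟩ | ⟨k, j, m, y, d, d', h4, h5⟩
      · exact Or.inl ⟨_, Ch.cons h3 h4⟩
      · exact Or.inr (Or.inl ⟨_, j, d, Ch.cons h3 h4, h5⟩)
      · exact Or.inr (Or.inr ⟨_, j, m, y, d, d', Ch.cons h3 h4, h5⟩)
    · push Not at hE
      obtain ⟨m, y, h3, h4⟩ := hE
      exact Or.inr (Or.inr ⟨0, n, m, y, a, c, Ch.nil _, h1, h2, h3, h4⟩)

theorem Lo.mac {D E : ℤ} (h : S.Lo D E a b) : S.Mac a b := h.2.1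

theorem reach_high : ∃ F, Pol F ∧ ∀ (Q : Type) [Fintype Q] (S : Sys Q) (x D n : ℕ)
    (a b : Q × ℤ), Fintype.card Q ≤ x → S.Bdd x → D ≤ x → Ch S.Mac n a b →
    Cle (S.St quad) (F x) (ax a) (ax b) ∨ ∃ (c : Q × ℤ) (u : ℤ), (D : ℤ) ≤ c.2 ∧
      S.Flat (4 * Fintype.card Q + 2) (F x) (ax a) (ax c) ∧ S.Lb a.1 c.1 (c.2 - a.2) ∧
      S.Lb c.1 b.1 u := by
  obtain ⟨F, hF, low⟩ := lo_low
  obtain ⟨G, hG, flat⟩ := nt_flat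
  refine ⟨fun x => F x + G x, by fun_prop, fun Q _ S x D n a b hQ hS hD h => ?_⟩
  beta_reduce
  have hD' : (D : ℤ) ≤ x := by exact_mod_cast hD
  rcases mac_prefix (D := D) (E := D) h with ⟨k, h1⟩ | ⟨k, j, c, h1, h2, h3⟩ |
    ⟨k, j, m, y, c, c', h1, h2, h3, h4, h5⟩
  · exact Or.inl ((low Q S x k D D _ _ hQ hS hD' hD' h1).mono (by omega))
  · exact Or.inr ⟨c, _, h2, (Flat.ofCle (low Q S x k D D _ _ hQ hS hD' hD' h1)).mono (by omega)
      (by omega), lb_ofMac (h1.mono fun _ _ h => h.mac), lb_ofMac h3⟩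
  · refine Or.inr ⟨(c'.1, y), b.2 - c'.2, h5.le,
      ((Flat.ofCle (low Q S x k D D _ _ hQ hS hD' hD' h1)).append
      (flat Q S x m _ _ hQ hS h4).ofNt).mono (by omega) (by omega), ?_, show S.Lb c'.1 b.1 _ from lb_ofMac h3⟩
    have h6 := (lb_ofMac (h1.mono fun _ _ h => h.mac)).add (lb_of_quad (ch_ofNt h4))
    rwa [show c.2 - a.2 + (y - c.2) = y - a.2 by ring] at h6

theorem closed_both : ∃ F, Pol F ∧ ∀ (Q : Type) [Fintype Q] (S : Sys Q) (x n : ℕ)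
    (p : Q) (y y' a b : ℤ), Fintype.card Q ≤ x → S.Bdd x → S.Lb p p a → S.Lb p p b →
    0 < a → b < 0 → Ch S.Mac n (p, y) (p, y') →
    S.Flat (8 * Fintype.card Q + 6) (F x) (ax (p, y)) (ax (p, y')) := by
  obtain ⟨F, hF, reach⟩ := reach_high
  obtain ⟨H, hH, high⟩ := high_flat
  refine ⟨fun x => F (x + H x) + H x + F (x + H x), by fun_prop,
    fun Q _ S x n p y y' a b hQ hS ha hb ha0 hb0 h => ?_⟩
  beta_reduce
  rcases reach Q S (x + H x) (H x) n _ _ (by omega) (hS.mono (by omega)) (by omega) h with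
    h1 | ⟨c, u, hc, h1, hac, hca⟩
  · exact (Flat.ofCle h1).mono (by omega) (by omega)
  rcases reach Q S.rev (x + H x) (H x) n _ _ (by omega) (hS.rev.mono (by omega)) (by omega)
      (h.rev fun _ _ h => h.rev) with h2 | ⟨d, v, hd, h2, had, hda⟩
  · exact (Flat.ofCle (h2.rev fun _ _ h => h.unrev)).mono (by omega) (by omega)
  simp only at hac hca had hda
  replace hda := hda.unrev
  replace had := had.unrev
  have h3 := (lb_ofMac h).add ((hac.add hca).neg ha hb ha0 hb0)
  have h4 := h3.add ((hda.add had).neg ha hb ha0 hb0)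
  have h5 := (hca.add h4).add hda
  rw [show u + (y' - y + -(c.2 - y + u) + -(-v + -(d.2 - y'))) + -v = d.2 - c.2 by ring] at h5
  exact ((h1.append (high Q S x c.1 d.1 c.2 d.2 _ hQ hS h5 (had.add hac) hc hd)).append
    h2.unrev).mono (by omega) (by omega)

theorem Lb.nonpos {p q : Q} {u v : ℤ} (hp : ∀ a, S.Lb p p a → a ≤ 0) (hu : S.Lb p q u)
    (hv : S.Lb q p v) {a : ℤ} (ha : S.Lb q q a) : a ≤ 0 := by
  by_contra! h0
  have := hp _ ((hu.add (ha.nsmul (u.natAbs + v.natAbs + 1))).add hv)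
  push_cast at this
  nlinarith [neg_abs_le u, neg_abs_le v, abs_nonneg u, abs_nonneg v]

theorem closed_neg : ∃ F, Pol F ∧ ∀ (Q : Type) [Fintype Q] (S : Sys Q) (x n : ℕ)
    (p : Q) (y y' : ℤ), Fintype.card Q ≤ x → S.Bdd x → (∀ a, S.Lb p p a → a ≤ 0) →
    Ch S.Mac n (p, y) (p, y') →
    S.Flat (8 * Fintype.card Q + 6) (F x) (ax (p, y)) (ax (p, y')) := by
  obtain ⟨F, hF, low⟩ := lo_low
  obtain ⟨G, hG, flat⟩ := mac_flat
  obtain ⟨H, hH, high⟩ := high_flat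
  obtain ⟨R, hR, res⟩ := Lb.residue
  refine ⟨fun x => F (x + H x + R x) + H x + G x + F (x + H x + R x), by fun_prop,
    fun Q _ S x n p y y' hQ hS hp h => ?_⟩
  beta_reduce
  have hx : 0 < x := (Fintype.card_pos_iff.2 ⟨p⟩).trans_le hQ
  obtain ⟨M, hM⟩ : ∃ M : Q × ℤ → Q × ℤ → Prop, M = fun a b => S.Mac a b ∧
    (∃ u, S.Lb p a.1 u) ∧ ∃ v, S.Lb b.1 p v := ⟨_, rfl⟩
  have hM1 : ∀ {a b}, M a b → S.Mac a b := fun h => by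
    subst hM
    exact h.1
  have hMac : ∀ {k a b}, Ch M k a b → Ch S.Mac k a b := fun h => h.mono fun _ _ => hM1
  have h1 : Ch M n (p, y) (p, y') := by
    obtain ⟨f, f0, fn, hf⟩ := h
    subst hM
    refine ⟨f, f0, fn, fun i hi => ⟨hf i hi, ?_, ?_⟩⟩
    · have := lb_ofMac (Ch.seg hf (Nat.zero_le i) hi.le)
      rw [f0] at this
      exact ⟨_, this⟩
    · have := lb_ofMac (Ch.seg hf (show i + 1 ≤ n from hi) le_rfl)
      rw [fn] at this
      exact ⟨_, this⟩
  have lo : ∀ {a b}, M a b → ¬ (H x : ℤ) ≤ a.2 → S.Lo (H x) (H x + R x) a b := fun {a b} h ha => by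
    subst hM
    obtain ⟨h, ⟨u, hu⟩, v, hv⟩ := h
    refine ⟨not_le.1 ha, h, fun m z hz => ?_⟩
    have h1 := lb_of_quad (ch_ofNt hz)
    obtain ⟨w, -, hw, k, -, hw'⟩ := res Q S x 1 _ _ _ hQ hS one_pos hx (hv.add hu)
    have h2 := Lb.nonpos hp hu ((lb_ofMac (Ch.single h)).add hv) (h1.add ⟨k, hw'⟩)
    linarith [(abs_le.1 hw).1]
  have off : ∀ {k a b}, Ch (Off M fun a => (H x : ℤ) ≤ a.2) k a b →
      Ch (S.Lo (H x) (H x + R x)) k a b := fun h => h.mono fun _ _ h => lo h.1 h.2.1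
  have low' : ∀ {k a b}, Ch (S.Lo (H x) (H x + R x)) k a b →
      S.Flat 0 (F (x + H x + R x)) (ax a) (ax b) := fun {k a b} h =>
    Flat.ofCle (low Q S (x + H x + R x) k _ _ _ _ (by omega) (hS.mono (by omega))
      (by push_cast; linarith) (by push_cast; linarith) h)
  rcases Ch.first (P := fun a : Q × ℤ => (H x : ℤ) ≤ a.2) h1 with ⟨h1, -, -⟩ |
    ⟨k, l, c, -, hc, h2, h3⟩
  · exact (low' (off h1)).mono (by omega) (by omega)
  have h2 : ∃ j, Ch (S.Lo (H x) (H x + R x)) j (p, y) c := by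
    rcases h2 with ⟨-, rfl⟩ | ⟨j, b, -, -, hb, h2, h3⟩
    · exact ⟨0, Ch.nil _⟩
    · exact ⟨_, (off h2).append (Ch.single (lo h3 hb))⟩
  obtain ⟨j, h2⟩ := h2
  rcases Ch.last (P := fun a : Q × ℤ => (H x : ℤ) ≤ a.2) h3 with ⟨-, h, -⟩ |
    ⟨k, l, d, -, hd, h3, h4⟩
  · exact absurd hc h
  obtain ⟨h5, v, hv⟩ : S.Flat (4 * Fintype.card Q + 2) (G x + F (x + H x + R x)) (ax d)
      (ax (p, y')) ∧ ∃ v, S.Lb d.1 p v := by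
    rcases h4 with ⟨-, rfl⟩ | ⟨j, b, -, -, -, h5, h6⟩
    · exact ⟨(Flat.path (Ch.nil _)).mono (by omega) (by omega), 0, Lb.nil _ _⟩
    · refine ⟨((flat Q S x _ _ hQ hS (hM1 h5)).append
        (low' (off h6))).mono (by omega) le_rfl, _, (lb_ofMac (hMac (Ch.single h5))).add
        (lb_ofMac (hMac (h6.mono fun _ _ h => h.1)))⟩
  have h6 := high Q S x c.1 d.1 c.2 d.2 _ hQ hS (lb_ofMac (hMac h3))
    (hv.add (lb_ofMac (h2.mono fun _ _ h => h.mac))) hc hd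
  exact (((low' h2).append h6).append h5).mono (by omega) (by omega)

/-- Flat runs between configurations with empty first counter and the same state. -/
theorem closed_flat : ∃ F, Pol F ∧ ∀ (Q : Type) [Fintype Q] (S : Sys Q) (x n : ℕ)
    (p : Q) (y y' : ℤ), Fintype.card Q ≤ x → S.Bdd x → Ch S.Mac n (p, y) (p, y') →
    S.Flat (8 * Fintype.card Q + 6) (F x) (ax (p, y)) (ax (p, y')) := by
  obtain ⟨F, hF, neg⟩ := closed_neg
  obtain ⟨G, hG, both⟩ := closed_both
  refine ⟨fun x => F x + G x, by fun_prop, fun Q _ S x n p y y' hQ hS h => ?_⟩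
  beta_reduce
  by_cases h1 : ∀ a, S.Lb p p a → a ≤ 0
  · exact (neg Q S x n p y y' hQ hS h1 h).mono le_rfl (by omega)
  push Not at h1
  obtain ⟨a, ha, ha0⟩ := h1
  by_cases h2 : ∀ b, S.Lb p p b → 0 ≤ b
  · exact (Flat.unrev (neg Q S.rev x n p y' y hQ hS.rev (fun w hw => by linarith [h2 _ hw.unrev])
      (h.rev fun _ _ h => h.rev))).mono le_rfl (by omega)
  · push Not at h2
    obtain ⟨b, hb, hb0⟩ := h2
    exact (both Q S x n p y y' a b hQ hS ha hb ha0 hb0 h).mono le_rfl (by omega)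

end Sys

namespace Sys
variable {Q : Type} {S : Sys Q} {n : ℕ}

theorem axis_flat : ∃ F, Pol F ∧ ∀ (Q : Type) [Fintype Q] (S : Sys Q) (x n : ℕ) (a b : Q × ℤ),
    Fintype.card Q ≤ x → S.Bdd x → Ch S.Mac n a b →
    S.Flat (Fintype.card Q * (12 * Fintype.card Q + 8)) (F x) (ax a) (ax b) := by
  classical
  obtain ⟨F, hF, closed⟩ := closed_flat
  obtain ⟨G, hG, step⟩ := mac_flat
  refine ⟨fun x => x * (F x + G x), by fun_prop, fun Q _ S x n a b hQ hS h => ?_⟩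
  beta_reduce
  have main : ∀ (s : Finset Q) (n : ℕ) (f : ℕ → Q × ℤ), (∀ i < n, S.Mac (f i) (f (i + 1))) →
      (∀ i ≤ n, (f i).1 ∈ s) → S.Flat (s.card * (12 * Fintype.card Q + 8))
        (s.card * (F x + G x)) (ax (f 0)) (ax (f n)) := fun s => by
    induction s using Finset.strongInduction with
    | H s ih =>
      intro n f hf hs
      obtain ⟨j, hj, hfj, hmax⟩ : ∃ j ≤ n, (f j).1 = (f 0).1 ∧
          ∀ i ≤ n, (f i).1 = (f 0).1 → i ≤ j :=
        ⟨Nat.findGreatest (fun i => (f i).1 = (f 0).1) n, Nat.findGreatest_le _,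
          Nat.findGreatest_spec (P := fun i => (f i).1 = (f 0).1) (Nat.zero_le n) rfl,
          fun i hi h => Nat.le_findGreatest hi h⟩
      have h0 := hs 0 (Nat.zero_le _)
      have hcard := Finset.card_erase_add_one h0
      have h1 := Ch.seg hf (Nat.zero_le j) hj
      rw [show f j = ((f 0).1, (f j).2) from Prod.ext hfj rfl] at h1
      have h2 := closed Q S x _ (f 0).1 (f 0).2 _ hQ hS h1
      rw [show ((f 0).1, (f j).2) = f j from Prod.ext hfj.symm rfl] at h2
      rw [← hcard, add_mul, add_mul, one_mul, one_mul]
      rcases hj.lt_or_eq with hj | rfl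
      · have h3 := step Q S x _ _ hQ hS (hf j hj)
        have h4 := ih (s.erase (f 0).1) (Finset.erase_ssubset h0) (n - (j + 1))
          (fun i => f (j + 1 + i)) (fun i hi => hf _ (by omega)) fun i hi =>
            Finset.mem_erase.2 ⟨fun h => by
              have := hmax _ (by omega) h
              omega, hs _ (by omega)⟩
        rw [add_zero, show j + 1 + (n - (j + 1)) = n by omega] at h4
        exact ((h2.append h3).append h4).mono (by omega) (by omega)
      · exact h2.mono (by omega) (by omega)
  obtain ⟨f, rfl, rfl, hf⟩ := h
  refine (main Finset.univ n f hf fun _ _ => Finset.mem_univ _).mono le_rfl ?_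
  rw [Finset.card_univ]
  gcongr

theorem St.nt_of {R : Set (ℤ × ℤ)} {c c' : Q × ℤ × ℤ} (h : S.St R c c')
    (h0 : c.2.1 = 0 → c'.2.1 = 0 → False) : S.nt.St R c c' :=
  ⟨Or.inl (h.1.resolve_right fun h => h0 h.2.1 h.2.2.1), h.2⟩

theorem off_nt {c c' : Q × ℤ × ℤ} (h : Ch (Off (S.St quad) fun c => c.2.1 = 0) n c c') :
    Ch (S.nt.St quad) n c c' := h.mono fun _ _ h => h.1.nt_of fun h' _ => h.2.1 h'

theorem ent_nt {k : ℕ} {c c' : Q × ℤ × ℤ} (h : Ent (S.St quad) (fun c => c.2.1 = 0) k c c') :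
    ∃ m, Ch (S.nt.St quad) m c c' := by
  rcases h with ⟨-, rfl⟩ | ⟨j, b, -, -, hb, h1, h2⟩
  · exact ⟨0, Ch.nil _⟩
  · exact ⟨_, (off_nt h1).append (Ch.single (h2.nt_of fun h _ => hb h))⟩

theorem hop_mac {c c' : Q × ℤ × ℤ} (h : Hop (S.St quad) (fun c => c.2.1 = 0) c c') :
    S.Mac (c.1, c.2.2) (c'.1, c'.2.2) := by
  obtain ⟨s, x, y⟩ := c
  obtain ⟨s', x', y'⟩ := c'
  obtain ⟨rfl, rfl, z, k, h, hk⟩ := h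
  obtain ⟨m, hm⟩ := ent_nt hk
  refine ⟨h.2.1.2, (ch_region hm h.2.2).2, ?_⟩
  by_cases hz : z.2.1 = 0
  · obtain rfl : z = (s', 0, y') := by
      rcases hk with ⟨-, rfl⟩ | ⟨j, b, -, h, -⟩
      · rfl
      · exact absurd hz h
    rcases h.1 with h1 | ⟨h1, -, -, h2⟩
    · exact Or.inl ⟨1, Ch.single ⟨Or.inl h1, h.2⟩⟩
    · exact Or.inr ⟨h1, h2.symm⟩
  · exact Or.inl ⟨_, Ch.cons (h.nt_of fun _ h => hz h) hm⟩

/-- All runs can be replaced by runs of short linear path schemes with few stars. -/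
theorem run_flat : ∃ F, Pol F ∧ ∀ (Q : Type) [Fintype Q] (S : Sys Q) (x n : ℕ)
    (c c' : Q × ℤ × ℤ), Fintype.card Q ≤ x → S.Bdd x → Ch (S.St quad) n c c' →
    S.Flat (Fintype.card Q * (12 * Fintype.card Q + 8) + 2 * (4 * Fintype.card Q + 2)) (F x)
      c c' := by
  obtain ⟨F, hF, flat⟩ := axis_flat
  obtain ⟨G, hG, step⟩ := nt_flat
  refine ⟨fun x => G x + F x + G x, by fun_prop, fun Q _ S x n c c' hQ hS h => ?_⟩
  beta_reduce
  rcases Ch.first (P := fun c : Q × ℤ × ℤ => c.2.1 = 0) h with ⟨h1, -, -⟩ |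
    ⟨k, l, a, -, ha, h1, h2⟩
  · exact (step Q S x _ _ _ hQ hS (off_nt h1)).ofNt.mono (by omega) (by omega)
  rcases Ch.last (P := fun c : Q × ℤ × ℤ => c.2.1 = 0) h2 with ⟨-, h, -⟩ |
    ⟨k, l, b, -, hb, h3, h4⟩
  · exact absurd ha h
  obtain ⟨m, h1⟩ := ent_nt h1
  obtain ⟨m', h4⟩ : ∃ m, Ch (S.nt.St quad) m b c' := by
    rcases h4 with ⟨-, rfl⟩ | ⟨j, d, -, hd, -, h4, h5⟩
    · exact ⟨0, Ch.nil _⟩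
    · exact ⟨_, Ch.cons (h4.nt_of fun _ h => hd h) (off_nt h5)⟩
  obtain ⟨k', h3⟩ := Ch.hops (P := fun c : Q × ℤ × ℤ => c.2.1 = 0) ha hb h3
  have h5 := flat Q S x _ _ _ hQ hS (h3.map (fun c : Q × ℤ × ℤ => (c.1, c.2.2))
    fun _ _ h => hop_mac h)
  rw [show ax (a.1, a.2.2) = a from Prod.ext rfl (Prod.ext ha.symm rfl),
    show ax (b.1, b.2.2) = b from Prod.ext rfl (Prod.ext hb.symm rfl)] at h5
  exact (((step Q S x _ _ _ hQ hS h1).ofNt.append h5).append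
    (step Q S x _ _ _ hQ hS h4).ofNt).mono (by omega) le_rfl

end Sys

section
variable {Q : Type} {V : TVASS 2 Q}

/-- The transition system of a 2-TVASS. -/
def TVASS.sys (V : TVASS 2 Q) : Sys Q where
  A p a b q := ∃ v : Fin 2 → ℤ, (p, some v, q) ∈ V.trans ∧ v 0 = a ∧ v 1 = b
  Z p q := (p, none, q) ∈ V.trans

theorem TVASS.sys_bdd (V : TVASS 2 Q) : V.sys.Bdd V.actNorm := by
  rintro p a b q ⟨v, hv, rfl, rfl⟩
  have h : vnormZ v ≤ V.actNorm :=
    Finset.le_sup (f := fun a : Act 2 => a.elim 0 vnormZ) (V.mem_acts _ hv)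
  have hi (i : Fin 2) : (v i).natAbs ≤ V.actNorm :=
    (Finset.le_sup (f := fun i => (v i).natAbs) (Finset.mem_univ i)).trans h
  constructor <;> rw [Int.abs_eq_natAbs] <;> exact_mod_cast hi _

/-- A configuration as a point of the integer plane. -/
def enc (c : Config 2 Q) : Q × ℤ × ℤ := (c.1, c.2 0, c.2 1)

/-- The configuration at a point of the quadrant. -/
def dec (c : Q × ℤ × ℤ) : Config 2 Q := (c.1, ![c.2.1.toNat, c.2.2.toNat])

theorem dec_enc (c : Config 2 Q) : dec (enc c) = c := by
  obtain ⟨q, x⟩ := c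
  refine Prod.ext rfl (funext fun i => ?_)
  fin_cases i <;> simp [dec, enc]

theorem Run.ch {c c' : Config 2 Q} {π : List (Trans 2 Q)} (h : Run V c π c') :
    Ch (V.sys.St Sys.quad) π.length (enc c) (enc c') := by
  induction h with
  | nil c => exact .nil _
  | @cons t c c' c'' π ht hs _ ih =>
    refine .cons ⟨?_, by simp [enc, Sys.quad], by simp [enc, Sys.quad]⟩ ih
    obtain ⟨p, a, q⟩ := t
    obtain ⟨rfl, rfl, hs⟩ := hs
    cases a with
    | none =>
      obtain ⟨h0, he⟩ := hs
      exact .inr ⟨ht, by simp [enc, h0], by simp [enc, he, h0], by simp [enc, he]⟩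
    | some v =>
      have h0 := hs 0
      have h1 := hs 1
      exact .inl ⟨v, ht, by simp [enc, h0], by simp [enc, h1]⟩

theorem Run.isPathFrom {c c' : Config 2 Q} {π : List (Trans 2 Q)} (h : Run V c π c') :
    IsPathFrom V c.1 π c'.1 := by
  induction h with
  | nil c => exact .nil _
  | cons ht hs _ ih =>
    obtain ⟨h1, h2, -⟩ := hs
    rw [← h2] at ih
    rw [← h1]
    exact .cons ht ih

theorem Run.append {c c' c'' : Config 2 Q} {π ρ : List (Trans 2 Q)} (h : Run V c π c')
    (h' : Run V c' ρ c'') : Run V c (π ++ ρ) c'' := by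
  induction h with
  | nil c => exact h'
  | cons ht hs _ ih => exact .cons ht hs (ih h')

theorem Run.shift {c c' : Config 2 Q} {π : List (Trans 2 Q)} (h : Run V c π c') (z : Fin 2 → ℕ)
    (hz : z 0 = 0 ∨ noTst π) : Run V (c.1, c.2 + z) π (c'.1, c'.2 + z) := by
  induction h with
  | nil c => exact .nil _
  | @cons t c c' c'' π ht hs _ ih =>
    refine .cons ht ?_ (ih (hz.imp_right fun h s hs => h s (List.mem_cons_of_mem _ hs)))
    obtain ⟨p, a, q⟩ := t
    obtain ⟨h1, h2, hs⟩ := hs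
    refine ⟨h1, h2, ?_⟩
    cases a with
    | none =>
      rcases hz with hz | hz
      · exact ⟨by simp [hs.1, hz], by simp [hs.2]⟩
      · exact absurd rfl (hz _ List.mem_cons_self)
    | some v =>
      intro i
      have := hs i
      simp only [Pi.add_apply]
      push_cast
      linarith

theorem ch_run {S : Sys Q} (hA : ∀ p a b q, S.A p a b q → V.sys.A p a b q)
    (hZ : ∀ p q, S.Z p q → V.sys.Z p q) {n : ℕ} :
    ∀ {c c' : Q × ℤ × ℤ}, Ch (S.St Sys.quad) n c c' → ∃ π, π.length = n ∧
      Run V (dec c) π (dec c') ∧ ((∀ p q, ¬ S.Z p q) → noTst π) := by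
  induction n with
  | zero =>
    intro c c' h
    obtain rfl := h.zero
    exact ⟨[], rfl, .nil _, fun _ t ht => by simp at ht⟩
  | succ n ih =>
    intro c c' h
    obtain ⟨d, hd, h⟩ := h.succ
    obtain ⟨π, hl, hr, hn⟩ := ih h
    obtain ⟨hs, ⟨hc1, hc2⟩, hd1, hd2⟩ := hd
    rcases hs with hs | ⟨hs, h1, h2, h3⟩
    · obtain ⟨v, hv, h0, h1⟩ := hA _ _ _ _ hs
      refine ⟨_ :: π, by simp [hl], .cons hv ⟨rfl, rfl, fun i => ?_⟩ hr, fun hS t ht => ?_⟩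
      · fin_cases i <;> simp [dec] <;> omega
      · rcases List.mem_cons.mp ht with rfl | ht
        · simp
        · exact hn hS t ht
    · refine ⟨_ :: π, by simp [hl], .cons (hZ _ _ hs) ⟨rfl, rfl, ?_, ?_⟩ hr,
        fun hS => absurd hs (hS _ _)⟩
      · simp [dec, h1]
      · simp [dec, h1, h2, h3]

theorem Run.pw {c : ℕ → Config 2 Q} {π : List (Trans 2 Q)} {m : ℕ}
    (h : ∀ i < m, Run V (c i) π (c (i + 1))) : Run V (c 0) (pw π m) (c m) := by
  induction m generalizing c with
  | zero => exact .nil _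
  | succ m ih =>
    have := ih (c := fun i => c (i + 1)) fun i hi => h (i + 1) (by omega)
    simpa [TVASSpaper.pw, List.replicate_succ] using (h 0 (by omega)).append this

theorem LPS.exists_append (V : TVASS 2 Q) (r : List (List (Trans 2 Q) × List (Trans 2 Q))) :
    ∀ (h : List (Trans 2 Q)) (M : LPS 2 Q), ∃ N : LPS 2 Q,
      N.len = (LPS.mk h r).len + M.len ∧ N.stars = (LPS.mk h r).stars + M.stars ∧
      (∀ p s q, IsLPS V p ⟨h, r⟩ s → IsLPS V s M q → IsLPS V p N q) ∧
      ∀ ns ns', ∃ ms, N.word ms = (LPS.mk h r).word ns ++ M.word ns' := by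
  have path {p s q : Q} {π ρ : List (Trans 2 Q)} (h : IsPathFrom V p π s)
      (h' : IsPathFrom V s ρ q) : IsPathFrom V p (π ++ ρ) q := by
    induction h with
    | nil => exact h'
    | cons ht _ ih => exact .cons ht (ih h')
  induction r with
  | nil =>
    refine fun h M => ⟨⟨h ++ M.head, M.rest⟩, by simp [LPS.len]; omega, by simp [LPS.stars], ?_,
      fun ns ns' => ⟨ns', by simp [LPS.word, wordRest]⟩⟩
    rintro p s q ⟨t, h1, ⟨⟩⟩ ⟨u, h2, h3⟩
    exact ⟨u, path h1 h2, h3⟩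
  | cons e r ih =>
    obtain ⟨β, α⟩ := e
    intro h M
    obtain ⟨N, hl, hs, hp, hw⟩ := ih α M
    refine ⟨⟨h, (β, N.head) :: N.rest⟩, ?_, ?_, ?_, fun ns ns' => ?_⟩
    · simp only [LPS.len, List.map_cons, List.sum_cons] at hl ⊢
      omega
    · simp only [LPS.stars, List.length_cons] at hs ⊢
      omega
    · rintro p s q ⟨t, h1, h2⟩ h3
      cases h2 with
      | cons hb ha hr =>
        obtain ⟨u, h4, h5⟩ := hp _ _ _ ⟨_, ha, hr⟩ h3
        exact ⟨t, h1, .cons hb h4 h5⟩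
    · obtain ⟨ms, hms⟩ := hw ns.tail ns'
      refine ⟨ns.headD 0 :: ms, ?_⟩
      simp only [LPS.word, wordRest, List.headD_cons, List.tail_cons, List.append_assoc] at hms ⊢
      rw [hms]

/-- The second point is reached from the first one along a linear path scheme. -/
def Schemed (V : TVASS 2 Q) (k L : ℕ) (c c' : Q × ℤ × ℤ) : Prop :=
  ∃ M : LPS 2 Q, IsLPS V c.1 M c'.1 ∧ M.len ≤ L ∧ M.stars ≤ k ∧ ReachLPS V M (dec c) (dec c')

theorem Schemed.loop {q : Q} {n m : ℕ} {a b v w x y : ℤ} {π : List (Trans 2 Q)}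
    (hn : π.length = n) (h : Run V (dec (q, a, b)) π (dec (q, a + v, b + w)))
    (hab : n ≠ 0 → 0 ≤ a ∧ 0 ≤ b ∧ 0 ≤ a + v ∧ 0 ≤ b + w) (hvw : n = 0 → v = 0 ∧ w = 0)
    (hm : ∀ i < m, a ≤ x + i * v ∧ b ≤ y + i * w)
    (hz : (∀ i < m, x + i * v = a) ∨ noTst π) :
    Schemed V 1 n (q, x, y) (q, x + m * v, y + m * w) := by
  refine ⟨⟨[], [(π, [])]⟩, ⟨q, .nil _, .cons h.isPathFrom (.nil _) (.nil _)⟩,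
    by simp [LPS.len, hn], by simp [LPS.stars], [m], ?_⟩
  have := Run.pw (V := V) (c := fun i : ℕ => dec (q, x + i * v, y + i * w)) (π := π) (m := m) ?_
  · simpa [LPS.word, wordRest] using this
  intro i hi
  obtain ⟨hx, hy⟩ := hm i hi
  by_cases h0 : n = 0
  · obtain ⟨rfl, rfl⟩ := hvw h0
    obtain rfl := List.length_eq_zero_iff.mp (hn.trans h0)
    simpa using Run.nil _
  obtain ⟨ha, hb, hv, hw⟩ := hab h0
  have h1 := h.shift ![(x + i * v - a).toNat, (y + i * w - b).toNat]
    (hz.imp_left fun hz => by simp [hz i hi])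
  convert h1 using 1
  · refine Prod.ext rfl (funext fun j => ?_)
    fin_cases j <;> simp [dec] <;> omega
  · refine Prod.ext rfl (funext fun j => ?_)
    push_cast
    rw [add_mul, add_mul, one_mul, one_mul]
    fin_cases j <;> simp [dec] <;> omega

theorem Sys.Flat.schemed {k L : ℕ} {c c' : Q × ℤ × ℤ} (h : V.sys.Flat k L c c') :
    Schemed V k L c c' := by
  have ends {S : Sys Q} {n : ℕ} {c c' : Q × ℤ × ℤ} (h : Ch (S.St Sys.quad) n c c') (hn : n ≠ 0) :
      c.2 ∈ Sys.quad ∧ c'.2 ∈ Sys.quad := by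
    obtain ⟨f, rfl, rfl, hf⟩ := h
    have h1 := hf (n - 1) (by omega)
    rw [Nat.sub_add_cancel (by omega)] at h1
    exact ⟨(hf 0 (by omega)).2.1, h1.2.2⟩
  have cycle {S : Sys Q} {n : ℕ} {q : Q} {a b v w : ℤ}
      (h : Ch (S.St Sys.quad) n (q, a, b) (q, a + v, b + w)) :
      (n ≠ 0 → 0 ≤ a ∧ 0 ≤ b ∧ 0 ≤ a + v ∧ 0 ≤ b + w) ∧ (n = 0 → v = 0 ∧ w = 0) := by
    constructor
    · intro hn
      obtain ⟨⟨h1, h2⟩, h3, h4⟩ := ends h hn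
      exact ⟨h1, h2, h3, h4⟩
    · rintro rfl
      simpa using h.zero
  induction h with
  | path h =>
    obtain ⟨π, hl, hr, -⟩ := ch_run (V := V) (fun _ _ _ _ h => h) (fun _ _ h => h) h
    exact ⟨⟨π, []⟩, ⟨_, hr.isPathFrom, .nil _⟩, by simp [LPS.len, hl], by simp [LPS.stars], [],
      by simpa [LPS.word, wordRest] using hr⟩
  | star h hm =>
    obtain ⟨π, hl, hr, hn⟩ := ch_run (S := V.sys.nt) (fun _ _ _ _ h => h) (fun _ _ h => False.elim h) h
    exact .loop hl hr (cycle h).1 (cycle h).2 hm (.inr (hn fun _ _ h => False.elim h))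
  | @starT n q b w m y h hm =>
    obtain ⟨π, hl, hr, -⟩ := ch_run (V := V) (fun _ _ _ _ h => h) (fun _ _ h => h) h
    have h' : Ch (V.sys.St Sys.quad) n (q, 0, b) (q, 0 + 0, b + w) := by simpa using h
    have := Schemed.loop (V := V) (v := 0) (x := 0) (m := m) (y := y) hl (by simpa using hr)
      (cycle h').1 (cycle h').2 (fun i hi => ⟨by simp, hm i hi⟩) (.inl fun i _ => by simp)
    simpa using this
  | append _ _ h1 h2 =>
    obtain ⟨⟨h, r⟩, p1, l1, s1, ns, r1⟩ := h1
    obtain ⟨M, p2, l2, s2, ns', r2⟩ := h2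
    obtain ⟨N, hl, hs, hp, hw⟩ := LPS.exists_append V r h M
    obtain ⟨ms, hms⟩ := hw ns ns'
    exact ⟨N, hp _ _ _ p1 p2, by omega, by omega, ms, hms ▸ r1.append r2⟩
  | mono _ hk hL h =>
    obtain ⟨M, p, l, s, r⟩ := h
    exact ⟨M, p, l.trans hL, s.trans hk, r⟩

/-- Without a counter effect and with a single state, nothing changes. -/
theorem Run.eq_of_trivial [Subsingleton Q] (hV : V.actNorm = 0) {c c' : Config 2 Q}
    {π : List (Trans 2 Q)} (h : Run V c π c') : c' = c := by
  induction h with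
  | nil c => rfl
  | @cons t c c' c'' π ht hs _ ih =>
    subst ih
    obtain ⟨p, a, q⟩ := t
    obtain ⟨h1, h2, hs⟩ := hs
    refine Prod.ext (Subsingleton.elim _ _) ?_
    cases a with
    | none => exact hs.2
    | some v =>
      have hb := V.sys_bdd p (v 0) (v 1) q ⟨v, ht, rfl, rfl⟩
      rw [hV] at hb
      simp only [Nat.cast_zero, abs_nonpos_iff] at hb
      funext i
      have := hs i
      fin_cases i <;> simp_all

end

/-- Corollary: succinct flattenability of 2-TVASS. -/
theorem succinct_flattenability_2TVASS :
    ∃ c : ℕ, 1 ≤ c ∧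
      ∀ (Q : Type) [Fintype Q] [Nonempty Q] (V : TVASS 2 Q)
        (p q : Q) (x y : Fin 2 → ℕ),
        Reach V (p, x) (q, y) →
        ∃ L : LPS 2 Q, IsLPS V p L q ∧
          L.len ≤ (Fintype.card Q + V.actNorm) ^ c ∧
          L.stars ≤ c * Fintype.card Q ^ 3 ∧
          ReachLPS V L (p, x) (q, y) := by
  obtain ⟨F, ⟨c, hc⟩, flat⟩ := Sys.run_flat
  refine ⟨2 * c + 32, by omega, fun Q _ _ V p q x y ⟨π, h⟩ => ?_⟩
  have hQ : 1 ≤ Fintype.card Q := Fintype.card_pos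
  by_cases hx : Fintype.card Q + V.actNorm = 1
  · have : Subsingleton Q := Fintype.card_le_one_iff_subsingleton.mp (by omega)
    obtain ⟨rfl, rfl⟩ := Prod.mk.inj (h.eq_of_trivial (by omega))
    exact ⟨⟨[], []⟩, ⟨_, .nil _, .nil _⟩, by simp [LPS.len], by simp [LPS.stars], [], .nil _⟩
  obtain ⟨M, hp, hl, hs, hr⟩ := (flat Q V.sys (Fintype.card Q + V.actNorm) π.length _ _ (by omega)
    (fun p a b q h => by
      obtain ⟨h1, h2⟩ := V.sys_bdd p a b q h
      have : (V.actNorm : ℤ) ≤ (Fintype.card Q + V.actNorm : ℕ) := by simp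
      exact ⟨h1.trans this, h2.trans this⟩) h.ch).schemed
  rw [dec_enc, dec_enc] at hr
  refine ⟨M, hp, ?_, ?_, hr⟩
  · have hz : 2 ≤ Fintype.card Q + V.actNorm := by omega
    generalize Fintype.card Q + V.actNorm = z at *
    calc M.len ≤ (z + 2) ^ c := hl.trans (hc z)
      _ ≤ (z ^ 2) ^ c := Nat.pow_le_pow_left (by nlinarith) c
      _ = z ^ (2 * c) := (pow_mul z 2 c).symm
      _ ≤ z ^ (2 * c + 32) := Nat.pow_le_pow_right (by omega) (by omega)
  · refine hs.trans ?_
    generalize Fintype.card Q = k at *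
    have h1 : k ≤ k ^ 3 := Nat.le_self_pow (by omega) k
    have h2 : k * k ≤ k ^ 3 := by
      rw [← pow_two]
      exact Nat.pow_le_pow_right hQ (by omega)
    have h3 : 1 ≤ k ^ 3 := hQ.trans h1
    have h4 : 0 ≤ c * k ^ 3 := by positivity
    nlinarith

end TVASSpaper
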